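/- For every rational number r of the form r = 2 - 2/(2s+1) with s ≥ 2 an integer, and also for r = 7/5, there exists a single bipartite graph H_r and constants c_1, c_2 > 0 such that for all sufficiently large n, c_1 · n^r ≤ ex(n, H_r) ≤ c_2 · n^r; that is, ex(n, H_r) = Θ(n^r). -/

import Mathlib

open SimpleGraph Filter

/-- `G` contains a copy of `H` (an injective graph homomorphism from `H` to `G`). -/
def SimpleGraph.Contains {α β : Type*} (G : SimpleGraph α) (H : SimpleGraph β) : Prop :=
  ∃ f : H →g G, Function.Injective f

/-- The Turán number `ex(n, H)`: the maximum number of edges in an `n`-vertex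
graph containing no copy of `H`. -/
noncomputable def exNum {β : Type*} (n : ℕ) (H : SimpleGraph β) : ℕ :=
  sSup {N : ℕ | ∃ G : SimpleGraph (Fin n), ¬ G.Contains H ∧ G.edgeSet.ncard = N}

/-- The space of functions on `ι → F` given by polynomials of total degree at most `t`. -/
def polyFun (F ι : Type*) [Field F] [Fintype ι] (t : ℕ) : Submodule F ((ι → F) → F) :=
  Submodule.span F (Set.range fun (e : {e : ι → ℕ // ∑ i, e i ≤ t}) (σ : ι → F) => ∏ i, σ i ^ e.1 i)

section PolyFun

variable {F ι κ : Type*} [Field F] [Fintype ι] [Fintype κ]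

lemma polyFun_mono {s t : ℕ} (h : s ≤ t) : polyFun F ι s ≤ polyFun F ι t := by
  apply Submodule.span_mono
  rintro _ ⟨e, rfl⟩
  exact ⟨⟨e.1, e.2.trans h⟩, rfl⟩

lemma mul_mem_polyFun {s t : ℕ} {f g : (ι → F) → F} (hf : f ∈ polyFun F ι s)
    (hg : g ∈ polyFun F ι t) : f * g ∈ polyFun F ι (s + t) := by
  have h := Submodule.mul_mem_mul hf hg
  rw [polyFun, polyFun, Submodule.span_mul_span] at h
  refine Submodule.span_mono ?_ h
  rintro _ ⟨_, ⟨e, rfl⟩, _, ⟨e', rfl⟩, rfl⟩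
  refine ⟨⟨e.1 + e'.1, ?_⟩, ?_⟩
  · simpa [Finset.sum_add_distrib] using add_le_add e.2 e'.2
  · ext σ
    simp [pow_add, Finset.prod_mul_distrib]

lemma const_mem_polyFun (c : F) (t : ℕ) : (fun _ => c) ∈ polyFun F ι t := by
  have h : (fun _ => (1 : F)) ∈ polyFun F ι t :=
    Submodule.subset_span ⟨⟨0, by simp⟩, by ext; simp⟩
  convert Submodule.smul_mem _ c h using 1
  ext; simp

lemma coord_mem_polyFun (i : ι) : (fun σ => σ i) ∈ polyFun F ι 1 := by
  classical
  refine Submodule.subset_span ⟨⟨Pi.single i 1, by simp⟩, ?_⟩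
  ext σ
  simp only
  rw [Finset.prod_eq_single i] <;> simp +contextual

lemma pow_mem_polyFun {s : ℕ} {f : (ι → F) → F} (hf : f ∈ polyFun F ι s) (n : ℕ) :
    f ^ n ∈ polyFun F ι (n * s) := by
  induction n with
  | zero =>
    rw [pow_zero, zero_mul]
    exact const_mem_polyFun (ι := ι) (1 : F) 0
  | succ n ih =>
    rw [pow_succ, Nat.add_mul, one_mul]
    exact mul_mem_polyFun ih hf

lemma prod_mem_polyFun {α : Type*} (A : Finset α) (d : α → ℕ) (f : α → (ι → F) → F)
    (hf : ∀ a ∈ A, f a ∈ polyFun F ι (d a)) : ∏ a ∈ A, f a ∈ polyFun F ι (∑ a ∈ A, d a) := by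
  classical
  induction A using Finset.induction_on with
  | empty =>
    rw [Finset.prod_empty, Finset.sum_empty]
    exact const_mem_polyFun (ι := ι) (1 : F) 0
  | insert a A ha ih =>
    rw [Finset.prod_insert ha, Finset.sum_insert ha]
    exact mul_mem_polyFun (hf a (by simp)) (ih fun b hb => hf b (by simp [hb]))

lemma comp_mem_polyFun {t : ℕ} {g : (κ → F) → F} (hg : g ∈ polyFun F κ t) (j : κ → ι) :
    (fun σ : ι → F => g (fun k => σ (j k))) ∈ polyFun F ι t := by
  have h := Submodule.mem_map_of_mem (f := LinearMap.funLeft F F fun (σ : ι → F) k => σ (j k)) hg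
  rw [polyFun, Submodule.map_span] at h
  refine Submodule.span_le.2 ?_ h
  rintro _ ⟨_, ⟨e, rfl⟩, rfl⟩
  refine polyFun_mono e.2 ?_
  have := prod_mem_polyFun (ι := ι) Finset.univ e.1 (fun k => (fun σ : ι → F => σ (j k)) ^ e.1 k)
    (fun k _ => by
      simpa only [mul_one] using pow_mem_polyFun (coord_mem_polyFun (F := F) (j k)) (e.1 k))
  convert this using 1
  ext σ
  simp [LinearMap.funLeft]

lemma finrank_polyFun_le (t : ℕ) :
    Module.finrank F (polyFun F ι t) ≤ (t + 1) ^ Fintype.card ι := by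
  classical
  let v : (ι → Fin (t + 1)) → ((ι → F) → F) := fun e σ => ∏ i, σ i ^ (e i : ℕ)
  have h : polyFun F ι t ≤ Submodule.span F (Set.range v) := by
    apply Submodule.span_mono
    rintro _ ⟨e, rfl⟩
    refine ⟨fun i => ⟨e.1 i, ?_⟩, rfl⟩
    have := (Finset.single_le_sum (f := e.1) (fun _ _ => Nat.zero_le _)
      (Finset.mem_univ i)).trans e.2
    omega
  have := FiniteDimensional.span_of_finite F (Set.finite_range v)
  calc _ ≤ Module.finrank F (Submodule.span F (Set.range v)) := Submodule.finrank_mono h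
    _ ≤ Fintype.card (ι → Fin (t + 1)) := finrank_range_le_card v
    _ = _ := by simp

lemma exists_interpolation (Z : Finset (ι → F)) {z : ι → F} (hz : z ∉ Z) :
    ∃ L ∈ polyFun F ι Z.card, L z = 1 ∧ ∀ w ∈ Z, L w = 0 := by
  classical
  induction Z using Finset.induction_on with
  | empty => exact ⟨fun _ => 1, const_mem_polyFun _ _, rfl, by simp⟩
  | insert a Z ha ih =>
    simp only [Finset.mem_insert, not_or] at hz
    obtain ⟨L, hL, h1, h0⟩ := ih hz.2
    obtain ⟨i, hi⟩ := Function.ne_iff.1 hz.1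
    have hd : (fun σ : ι → F => (z i - a i)⁻¹ * (σ i - a i)) ∈ polyFun F ι 1 :=
      Submodule.smul_mem _ (z i - a i)⁻¹
        (Submodule.sub_mem _ (coord_mem_polyFun i) (const_mem_polyFun (a i) 1))
    refine ⟨L * _, by rw [Finset.card_insert_of_notMem ha]; exact mul_mem_polyFun hL hd, ?_, ?_⟩
    · simp [h1, inv_mul_cancel₀ (sub_ne_zero.2 hi)]
    · intro w hw
      rcases Finset.mem_insert.1 hw with rfl | hw
      · simp
      · simp [h0 w hw]

end PolyFun

section Hilbert

lemma map_restrict_of_subset {F ι : Type*} [Field F] {S S' : Set (ι → F)} (h : S' ⊆ S)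
    (M : Submodule F ((ι → F) → F)) :
    (M.map (LinearMap.funLeft F F (Subtype.val : S → ι → F))).map
      (LinearMap.funLeft F F (Set.inclusion h)) =
    M.map (LinearMap.funLeft F F (Subtype.val : S' → ι → F)) := by
  rw [← Submodule.map_comp]
  rfl

lemma finrank_map_add_finrank_le {F V V' : Type*} [Field F] [AddCommGroup V] [Module F V]
    [AddCommGroup V'] [Module F V'] [FiniteDimensional F V] (ρ : V →ₗ[F] V')
    {M Y : Submodule F V} (hY : Y ≤ M) (hk : Y ≤ LinearMap.ker ρ) :
    Module.finrank F (M.map ρ) + Module.finrank F Y ≤ Module.finrank F M := by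
  have h := LinearMap.finrank_range_add_finrank_ker (ρ.domRestrict M)
  rw [LinearMap.range_domRestrict] at h
  have h2 : Module.finrank F Y ≤ Module.finrank F (LinearMap.ker (ρ.domRestrict M)) := by
    refine LinearMap.finrank_le_finrank_of_injective
      (f := LinearMap.codRestrict _ (Submodule.inclusion hY) ?_) ?_
    · intro y
      simpa using hk y.2
    · intro a b hab
      exact Subtype.ext (congrArg (fun x => (x.1 : V)) (Subtype.ext_iff.1 hab))
  omega

variable {F ι : Type*} [Field F] [Finite F] [Fintype ι]

/-- The dimension of the space of restrictions to `S` of polynomial functions of degree at most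
`t`. -/
noncomputable def hilb (S : Set (ι → F)) (t : ℕ) : ℕ :=
  Module.finrank F ((polyFun F ι t).map (LinearMap.funLeft F F (Subtype.val : S → ι → F)))

lemma hilb_le (S : Set (ι → F)) (t : ℕ) : hilb S t ≤ (t + 1) ^ Fintype.card ι :=
  (Submodule.finrank_map_le _ _).trans (finrank_polyFun_le t)

lemma hilb_mono_deg (S : Set (ι → F)) {s t : ℕ} (h : s ≤ t) : hilb S s ≤ hilb S t :=
  Submodule.finrank_mono (Submodule.map_mono (polyFun_mono h))

lemma hilb_mono_set {S S' : Set (ι → F)} (h : S' ⊆ S) (t : ℕ) : hilb S' t ≤ hilb S t := by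
  rw [hilb, ← map_restrict_of_subset h]
  exact Submodule.finrank_map_le _ _

/-- Products of functions of degree at most `T` vanish on `S` only if a factor does. -/
def IrredSet (T : ℕ) (S : Set (ι → F)) : Prop :=
  ∀ f ∈ polyFun F ι T, ∀ g ∈ polyFun F ι T, (∀ σ ∈ S, f σ * g σ = 0) →
    (∀ σ ∈ S, f σ = 0) ∨ (∀ σ ∈ S, g σ = 0)

lemma hilb_cut {S : Set (ι → F)} {f : (ι → F) → F} {m t : ℕ} (hf : f ∈ polyFun F ι m)
    (hinj : ∀ g ∈ polyFun F ι t, (∀ σ ∈ S, f σ * g σ = 0) → ∀ σ ∈ S, g σ = 0) :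
    hilb {σ ∈ S | f σ = 0} (t + m) + hilb S t ≤ hilb S (t + m) := by
  have hsub : {σ ∈ S | f σ = 0} ⊆ S := Set.sep_subset _ _
  let μ : (S → F) →ₗ[F] (S → F) := LinearMap.mulLeft F (fun σ : S => f σ)
  let Y := ((polyFun F ι t).map (LinearMap.funLeft F F (Subtype.val : S → ι → F))).map μ
  have hY : Module.finrank F Y = hilb S t := by
    let M := (polyFun F ι t).map (LinearMap.funLeft F F (Subtype.val : S → ι → F))
    have : Function.Injective (μ.domRestrict M) := by
      rw [← LinearMap.ker_eq_bot, LinearMap.ker_eq_bot']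
      rintro ⟨_, g, hg, rfl⟩ h0
      have h1 : ∀ σ ∈ S, f σ * g σ = 0 := fun σ hσ => congrFun h0 ⟨σ, hσ⟩
      ext ⟨σ, hσ⟩
      exact hinj g hg h1 σ hσ
    rw [show Y = LinearMap.range (μ.domRestrict M) from (LinearMap.range_domRestrict _ _).symm]
    exact LinearMap.finrank_range_of_inj this
  rw [← hY, hilb, ← map_restrict_of_subset hsub]
  apply finrank_map_add_finrank_le
  · rintro _ ⟨_, ⟨g, hg, rfl⟩, rfl⟩
    exact ⟨g * f, mul_mem_polyFun hg hf, by ext σ; simp [μ, LinearMap.funLeft, mul_comm]⟩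
  · rintro _ ⟨_, ⟨g, hg, rfl⟩, rfl⟩
    ext ⟨σ, hσ⟩
    simp [μ, LinearMap.funLeft, hσ.2]

lemma hilb_sep_lt {S : Set (ι → F)} {f : (ι → F) → F} {T : ℕ} (hf : f ∈ polyFun F ι T)
    {τ : ι → F} (hτ : τ ∈ S) (hfτ : f τ ≠ 0) : hilb {σ ∈ S | f σ = 0} T < hilb S T := by
  have hsub : {σ ∈ S | f σ = 0} ⊆ S := Set.sep_subset _ _
  have h1 : Module.finrank F (Submodule.span F {(fun σ : S => f σ)}) = 1 :=
    finrank_span_singleton fun h => hfτ (congrFun h ⟨τ, hτ⟩)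
  have := finrank_map_add_finrank_le (LinearMap.funLeft F F (Set.inclusion hsub))
    (M := (polyFun F ι T).map (LinearMap.funLeft F F (Subtype.val : S → ι → F)))
    (Y := Submodule.span F {(fun σ : S => f σ)}) ?_ ?_
  · rw [map_restrict_of_subset hsub, h1] at this
    exact this
  · rw [Submodule.span_le, Set.singleton_subset_iff]
    exact ⟨f, hf, rfl⟩
  · rw [Submodule.span_le, Set.singleton_subset_iff]
    ext ⟨σ, hσ⟩
    exact hσ.2

lemma exists_irred_cover (T : ℕ) (n : ℕ) (S : Set (ι → F)) (hS : hilb S T ≤ n) :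
    ∃ 𝒜 : Finset (Set (ι → F)), 𝒜.card ≤ 2 ^ n ∧ (∀ A ∈ 𝒜, IrredSet T A ∧ A ⊆ S) ∧
      ∀ σ ∈ S, ∃ A ∈ 𝒜, σ ∈ A := by
  classical
  induction n generalizing S with
  | zero =>
    refine ⟨{S}, by simp, ?_, by simp⟩
    simp only [Finset.mem_singleton, forall_eq, subset_refl, and_true]
    intro f hf g _ _
    left
    by_contra! h
    obtain ⟨σ, hσ, h⟩ := h
    have := hilb_sep_lt hf hσ h
    omega
  | succ n ih =>
    by_cases hI : IrredSet T S
    · exact ⟨{S}, by simpa using Nat.one_le_two_pow, by simpa using hI, by simp⟩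
    · unfold IrredSet at hI
      push Not at hI
      obtain ⟨f, hf, g, hg, hfg, ⟨a, ha, hfa⟩, b, hb, hgb⟩ := hI
      obtain ⟨𝒜, h1, h2, h3⟩ := ih {σ ∈ S | f σ = 0} (by have := hilb_sep_lt hf ha hfa; omega)
      obtain ⟨ℬ, h4, h5, h6⟩ := ih {σ ∈ S | g σ = 0} (by have := hilb_sep_lt hg hb hgb; omega)
      refine ⟨𝒜 ∪ ℬ, (Finset.card_union_le _ _).trans (by rw [pow_succ]; omega), ?_, ?_⟩
      · intro A hA
        rcases Finset.mem_union.1 hA with hA | hA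
        · exact ⟨(h2 A hA).1, (h2 A hA).2.trans (Set.sep_subset _ _)⟩
        · exact ⟨(h5 A hA).1, (h5 A hA).2.trans (Set.sep_subset _ _)⟩
      · intro σ hσ
        rcases mul_eq_zero.1 (hfg σ hσ) with h | h
        · obtain ⟨A, hA, h⟩ := h3 σ ⟨hσ, h⟩
          exact ⟨A, by simp [hA], h⟩
        · obtain ⟨A, hA, h⟩ := h6 σ ⟨hσ, h⟩
          exact ⟨A, by simp [hA], h⟩

lemma card_le_of_hilb_le {S : Set (ι → F)} {t : ℕ} (h : hilb S t ≤ t) (Z : Finset (ι → F))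
    (hZ : ∀ z ∈ Z, z ∈ S) : Z.card ≤ t := by
  classical
  by_contra! hc
  obtain ⟨Y, hYZ, hY⟩ := Finset.exists_subset_card_eq (Nat.succ_le_of_lt hc)
  have h1 : hilb (Y : Set (ι → F)) t = t + 1 := by
    have : (polyFun F ι t).map (LinearMap.funLeft F F
        (Subtype.val : ((Y : Set (ι → F)) : Type _) → ι → F))
        = ⊤ := by
      rw [eq_top_iff]
      intro g _
      choose! L hL h1 h0 using fun (y : ι → F) (hy : y ∈ Y) =>
        exists_interpolation (Y.erase y) (Finset.notMem_erase y Y)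
      refine ⟨∑ y : Y, g y • L y, Submodule.sum_mem _ fun y _ => Submodule.smul_mem _ _ ?_, ?_⟩
      · have := hL y y.2
        rwa [Finset.card_erase_of_mem y.2, hY] at this
      · ext z
        have hz : (z : ι → F) ∈ Y := z.2
        simp only [LinearMap.funLeft_apply, Finset.sum_apply, Pi.smul_apply, smul_eq_mul]
        rw [Finset.sum_eq_single ⟨z, hz⟩]
        · simp [h1 _ hz]
        · intro y _ hy
          rw [h0 y y.2 z (Finset.mem_erase.2 ⟨fun h => hy (Subtype.ext h.symm), hz⟩), mul_zero]
        · simp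
    rw [hilb, this, finrank_top, Module.finrank_fintype_fun_eq_card]
    simpa using hY
  have h2 := hilb_mono_set (S := S) (S' := Y) (fun z hz => hZ z (hYZ hz)) t
  omega

lemma hilb_sep_le {S : Set (ι → F)} {f : (ι → F) → F} {m T T' A d : ℕ}
    (hf : f ∈ polyFun F ι m) (hI : IrredSet T S) {τ : ι → F} (hτ : τ ∈ S) (hfτ : f τ ≠ 0)
    (hT' : (T' + 1) * (m + 1) ≤ T + 1) {T₀ : ℕ} (hT₀ : (T' + 1) * (m + 1) ≤ T₀ + 1)
    (hS : ∀ t ≤ T₀, hilb S t ≤ A * (t + 1) ^ (d + 1)) :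
    ∀ t ≤ T', hilb {σ ∈ S | f σ = 0} t ≤ A * (m + 1) ^ (d + 1) * (t + 1) ^ d := by
  intro t ht
  have hmT : (t + 1) * (m + 1) ≤ T + 1 := (Nat.mul_le_mul_right _ (by omega)).trans hT'
  have hmT₀ : (t + 1) * (m + 1) ≤ T₀ + 1 := (Nat.mul_le_mul_right _ (by omega)).trans hT₀
  have key : ∀ J ≤ t + 1, J * hilb {σ ∈ S | f σ = 0} t ≤ hilb S (t + J * m) := by
    intro J
    induction J with
    | zero => simp
    | succ J ih =>
      intro hJ
      have hle : t + (J + 1) * m ≤ T := by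
        have : (J + 1) * m ≤ (t + 1) * m := Nat.mul_le_mul_right _ hJ
        nlinarith
      have h1 := hilb_cut (t := t + J * m) (S := S) hf (fun g hg h0 => by
        rcases hI f (polyFun_mono (by nlinarith) hf) g (polyFun_mono (by nlinarith) hg) h0
          with h | h
        · exact absurd (h τ hτ) hfτ
        · exact h)
      have h2 := hilb_mono_deg {σ ∈ S | f σ = 0} (show t ≤ t + J * m + m by omega)
      have h3 := ih (by omega)
      rw [show t + (J + 1) * m = t + J * m + m by ring]
      calc (J + 1) * _ = J * hilb {σ ∈ S | f σ = 0} t + hilb {σ ∈ S | f σ = 0} t := by ring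
        _ ≤ _ := by omega
  have h1 := (key (t + 1) le_rfl).trans (hS _ (by nlinarith))
  have h2 : t + (t + 1) * m + 1 = (t + 1) * (m + 1) := by ring
  rw [h2, mul_pow] at h1
  refine Nat.le_of_mul_le_mul_left (h1.trans (le_of_eq ?_)) (Nat.succ_pos t)
  ring

end Hilbert

section Cut

/-- If every coset `w + K w` meets `P` in proportion at most `M / Q`, then so does the whole
group. -/
lemma card_mul_le_of_coset {W : Type*} [AddCommGroup W] [Fintype W] (K : W → AddSubgroup W)
    (hK : ∀ w, ∀ κ ∈ K w, K (w + κ) = K w) (P : W → Prop) (Q M : ℕ)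
    (h : ∀ w, Nat.card {κ : K w // P (w + κ)} * Q ≤ M * Nat.card (K w)) :
    Nat.card {w // P w} * Q ≤ M * Nat.card W := by
  classical
  let c : W → Set W := fun w => {w' | w' - w ∈ K w}
  have hc : ∀ w w', c w' = c w ↔ w' - w ∈ K w := by
    intro w w'
    constructor
    · intro e
      have : w' ∈ c w' := by simp [c, (K w').zero_mem]
      rw [e] at this
      exact this
    · intro e
      have e2 : K w' = K w := by
        have := hK w _ e
        rwa [add_sub_cancel] at this
      ext v
      simp only [c, Set.mem_ofPred_eq, e2]
      have : v - w = (v - w') + (w' - w) := by abel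
      rw [this, AddSubgroup.add_mem_cancel_right _ e]
  have hfib : ∀ w₀ (R : W → Prop), ((Finset.univ.filter R).filter (fun w => c w = c w₀)).card =
      Nat.card {κ : K w₀ // R (w₀ + κ)} := by
    intro w₀ R
    rw [Nat.card_eq_fintype_card, ← Fintype.card_coe]
    refine Fintype.card_congr ⟨fun w => ⟨⟨w.1 - w₀, ?_⟩, ?_⟩, fun κ => ⟨w₀ + κ.1, ?_⟩, ?_, ?_⟩
    · exact (hc _ _).1 (Finset.mem_filter.1 w.2).2
    · have := (Finset.mem_filter.1 (Finset.mem_filter.1 w.2).1).2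
      simpa using this
    · simp only [Finset.mem_filter, Finset.mem_univ, true_and]
      exact ⟨κ.2, (hc _ _).2 (by simp)⟩
    · intro w; simp
    · intro κ; simp
  have e1 : Nat.card {w // P w} = ∑ b ∈ Finset.univ.image c,
      ((Finset.univ.filter P).filter (fun w => c w = b)).card := by
    rw [Nat.card_eq_fintype_card, Fintype.card_subtype]
    exact Finset.card_eq_sum_card_fiberwise fun w _ => by simp
  have e2 : Nat.card W = ∑ b ∈ Finset.univ.image c,
      ((Finset.univ.filter fun _ : W => True).filter (fun w => c w = b)).card := by
    rw [Nat.card_eq_fintype_card]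
    rw [← Finset.card_eq_sum_card_fiberwise fun w _ => by simp]
    simp
  rw [e1, e2, Finset.sum_mul, Finset.mul_sum]
  refine Finset.sum_le_sum fun b hb => ?_
  obtain ⟨w₀, -, rfl⟩ := Finset.mem_image.1 hb
  have e3 := hfib w₀ fun _ => True
  have e4 : Nat.card {κ : K w₀ // True} = Nat.card (K w₀) := by simp
  rw [e4] at e3
  rw [hfib]
  refine (h w₀).trans (Nat.mul_le_mul_left _ ?_)
  rw [← e3]
  exact Finset.card_le_card (by simp)

lemma card_fiber_mul_le {A B : Type*} [AddCommGroup A] [Finite A] [AddCommGroup B] [Finite B]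
    (φ : A →+ B) (hφ : Function.Surjective φ) (b : B) :
    Nat.card {x // φ x = b} * Nat.card B ≤ Nat.card A := by
  choose s hs using hφ
  rw [← Nat.card_prod]
  refine Nat.card_le_card_of_injective (fun x : {x // φ x = b} × B => x.1.1 + s x.2) ?_
  rintro ⟨⟨x, hx⟩, u⟩ ⟨⟨y, hy⟩, v⟩ h
  simp only at h
  have h1 := congrArg φ h
  rw [map_add, map_add, hs, hs, hx, hy, add_right_inj] at h1
  subst h1
  simpa using h

variable {F ι : Type*} [Field F]

/-- The set of points of `S` at which the first `i` equations vanish. -/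
def cutSet {W : Type*} [AddCommGroup W] (E : ℕ → W →+ ((ι → F) → F)) (S : Set (ι → F))
    (i : ℕ) (w : W) : Set (ι → F) :=
  {σ ∈ S | ∀ i' < i, E i' w σ = 0}

/-- The perturbations not affecting the first `i` cuts. -/
def cutStab {W : Type*} [AddCommGroup W] (E : ℕ → W →+ ((ι → F) → F)) (S : Set (ι → F))
    (i : ℕ) (w : W) : AddSubgroup W where
  carrier := {κ | ∀ i' < i, ∀ σ ∈ cutSet E S i' w, E i' κ σ = 0}
  zero_mem' := by intro i' _ σ _; simp
  add_mem' := by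
    intro a b ha hb i' hi σ hσ
    simp [ha i' hi σ hσ, hb i' hi σ hσ]
  neg_mem' := by
    intro a ha i' hi σ hσ
    simp [ha i' hi σ hσ]

lemma cutSet_add {W : Type*} [AddCommGroup W] (E : ℕ → W →+ ((ι → F) → F)) (S : Set (ι → F))
    (i : ℕ) (w κ : W) (hκ : κ ∈ cutStab E S i w) (j : ℕ) (hj : j ≤ i) :
    cutSet E S j (w + κ) = cutSet E S j w := by
  induction j with
  | zero => simp [cutSet]
  | succ j ih =>
    have h1 : ∀ w, cutSet E S (j + 1) w = {σ ∈ cutSet E S j w | E j w σ = 0} := by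
      intro w
      ext σ
      simp only [cutSet, Set.mem_ofPred_eq, Nat.lt_succ_iff_lt_or_eq, or_imp, forall_and,
        forall_eq, and_assoc]
    rw [h1, h1, ih (by omega)]
    ext σ
    simp only [Set.mem_ofPred_eq]
    refine and_congr_right fun hσ => ?_
    rw [map_add, Pi.add_apply, hκ j (by omega) σ hσ, add_zero]

lemma cutStab_add {W : Type*} [AddCommGroup W] (E : ℕ → W →+ ((ι → F) → F)) (S : Set (ι → F))
    (i : ℕ) (w κ : W) (hκ : κ ∈ cutStab E S i w) : cutStab E S i (w + κ) = cutStab E S i w := by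
  ext κ'
  change (∀ i' < i, ∀ σ ∈ cutSet E S i' (w + κ), E i' κ' σ = 0) ↔
    (∀ i' < i, ∀ σ ∈ cutSet E S i' w, E i' κ' σ = 0)
  refine forall₂_congr fun j hj => ?_
  rw [cutSet_add E S i w κ hκ j hj.le]

variable [Finite F] [Fintype ι]

/-- `U` is covered by at most `M` subsets, each of which either contains no `D`-clique with more
than `R` elements or has a Hilbert function of polynomial growth of degree `d` up to `T`. -/
def CoverBound (D : (ι → F) → (ι → F) → Prop) (R T A d M : ℕ) (U : Set (ι → F)) : Prop :=
  ∃ 𝒜 : Finset (Set (ι → F)), 𝒜.card ≤ M ∧ (∀ σ ∈ U, ∃ B ∈ 𝒜, σ ∈ B) ∧ ∀ B ∈ 𝒜, B ⊆ U ∧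
    ((∀ Z : Finset (ι → F), ↑Z ⊆ B → (Z : Set (ι → F)).Pairwise D → Z.card ≤ R) ∨
      ∀ t ≤ T, hilb B t ≤ A * (t + 1) ^ d)

/-- Every large `D`-clique in `U` has `r + 1` elements on which the values of `e` can be prescribed
by elements of `K`. -/
def Spreads {W : Type*} [AddCommGroup W] (D : (ι → F) → (ι → F) → Prop) (R r : ℕ)
    (e : W →+ ((ι → F) → F)) (U : Set (ι → F)) (K : AddSubgroup W) : Prop :=
  ∀ Z : Finset (ι → F), ↑Z ⊆ U → (Z : Set (ι → F)).Pairwise D → R < Z.card →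
    ∃ τ : Fin (r + 1) → ι → F, (∀ j, τ j ∈ Z) ∧
      ∀ g : Fin (r + 1) → F, ∃ κ ∈ K, ∀ j, e κ (τ j) = g j

lemma card_not_coverBound_le {W : Type*} [AddCommGroup W] [Finite W]
    {D : (ι → F) → (ι → F) → Prop} {R r T T' A d M m : ℕ} {e : W →+ ((ι → F) → F)}
    (he : ∀ w, e w ∈ polyFun F ι m) (hT : (T' + 1) * (m + 1) ≤ T + 1)
    {U : Set (ι → F)} {K : AddSubgroup W}
    (hU : CoverBound D R T A (d + 1) M U) (hs : Spreads D R r e U K) (w₀ : W) :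
    Nat.card {κ : K // ¬ CoverBound D R T' (A * (m + 1) ^ (d + 1)) d
      (M * 2 ^ ((T + 1) ^ Fintype.card ι)) {σ ∈ U | e (w₀ + κ) σ = 0}} * Nat.card F ^ (r + 1) ≤
    (M * 2 ^ ((T + 1) ^ Fintype.card ι)) * Nat.card K := by
  classical
  have : Fintype K := Fintype.ofFinite K
  obtain ⟨𝒜, hM, hcov, h𝒜⟩ := hU
  choose 𝒞 h𝒞card h𝒞 h𝒞cov using fun B : Set (ι → F) => exists_irred_cover T _ B (hilb_le B T)
  set 𝒟 := 𝒜.biUnion 𝒞 with h𝒟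
  have hcard : 𝒟.card ≤ M * 2 ^ ((T + 1) ^ Fintype.card ι) :=
    Finset.card_biUnion_le.trans <| (Finset.sum_le_card_nsmul _ _ _ fun B _ => h𝒞card B).trans <| by
      rw [smul_eq_mul]; gcongr
  have hcov' : ∀ σ ∈ U, ∃ C ∈ 𝒟, σ ∈ C := by
    intro σ hσ
    obtain ⟨B, hB, hσB⟩ := hcov σ hσ
    obtain ⟨C, hC, hσC⟩ := h𝒞cov B σ hσB
    exact ⟨C, Finset.mem_biUnion.2 ⟨B, hB, hC⟩, hσC⟩
  have hprop : ∀ C ∈ 𝒟, IrredSet T C ∧ C ⊆ U ∧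
      ((∀ Z : Finset (ι → F), ↑Z ⊆ C → (Z : Set (ι → F)).Pairwise D → Z.card ≤ R) ∨
      ∀ t ≤ T, hilb C t ≤ A * (t + 1) ^ (d + 1)) := by
    intro C hC
    obtain ⟨B, hB, hC⟩ := Finset.mem_biUnion.1 hC
    obtain ⟨hI, hCB⟩ := h𝒞 B C hC
    obtain ⟨hBU, h⟩ := h𝒜 B hB
    refine ⟨hI, hCB.trans hBU, h.imp (fun h Z hZ => h Z (hZ.trans hCB))
      fun h t ht => (hilb_mono_set hCB t).trans (h t ht)⟩
  let Sm : Set (ι → F) → Prop := fun C =>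
    ∀ Z : Finset (ι → F), ↑Z ⊆ C → (Z : Set (ι → F)).Pairwise D → Z.card ≤ R
  have hpiece : ∀ C ∈ 𝒟, ¬ Sm C →
      Nat.card {κ : K // ∀ σ ∈ C, e (w₀ + κ) σ = 0} * Nat.card F ^ (r + 1) ≤ Nat.card K := by
    intro C hC hSm
    simp only [Sm, not_forall, not_le] at hSm
    obtain ⟨Z, hZC, hZD, hZR⟩ := hSm
    obtain ⟨τ, hτ, hg⟩ := hs Z (hZC.trans (hprop C hC).2.1) hZD hZR
    let φ : K →+ (Fin (r + 1) → F) :=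
      { toFun := fun κ j => e κ (τ j)
        map_zero' := by ext; simp
        map_add' := by intros; ext; simp }
    have hφ : Function.Surjective φ := fun g => by
      obtain ⟨κ, hκ, h⟩ := hg g
      exact ⟨⟨κ, hκ⟩, funext h⟩
    have h1 := card_fiber_mul_le φ hφ fun j => - e w₀ (τ j)
    rw [Nat.card_fun, Nat.card_fin] at h1
    refine le_trans (Nat.mul_le_mul_right _ ?_) h1
    refine Nat.card_le_card_of_injective
      (fun κ => ⟨κ.1, ?_⟩) ?_
    · ext j
      have := κ.2 (τ j) (hZC (hτ j))
      rw [map_add, Pi.add_apply, add_comm] at this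
      exact eq_neg_of_add_eq_zero_left this
    · rintro ⟨x, _⟩ ⟨y, _⟩ h
      simpa using h
  have hbad : ∀ κ : K, (∀ C ∈ 𝒟, ¬ Sm C → ¬ ∀ σ ∈ C, e (w₀ + κ) σ = 0) →
      CoverBound D R T' (A * (m + 1) ^ (d + 1)) d
      (M * 2 ^ ((T + 1) ^ Fintype.card ι)) {σ ∈ U | e (w₀ + κ) σ = 0} := by
    intro κ hκ
    refine ⟨𝒟.image fun C => {σ ∈ C | e (w₀ + κ) σ = 0}, Finset.card_image_le.trans hcard, ?_, ?_⟩
    · rintro σ ⟨hσ, hσ0⟩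
      obtain ⟨C, hC, hσC⟩ := hcov' σ hσ
      exact ⟨_, Finset.mem_image_of_mem _ hC, hσC, hσ0⟩
    · intro B hB
      obtain ⟨C, hC, rfl⟩ := Finset.mem_image.1 hB
      obtain ⟨hI, hCU, h⟩ := hprop C hC
      refine ⟨fun σ hσ => ⟨hCU hσ.1, hσ.2⟩, ?_⟩
      by_cases hSm : Sm C
      · exact Or.inl fun Z hZ => hSm Z (hZ.trans (Set.sep_subset _ _))
      · right
        have hb := h.resolve_left hSm
        have := hκ C hC hSm
        push Not at this
        obtain ⟨σ, hσ, hσ0⟩ := this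
        exact hilb_sep_le (he _) hI hσ hσ0 hT hT hb
  have hunion : Nat.card {κ : K // ¬ CoverBound D R T' (A * (m + 1) ^ (d + 1)) d
      (M * 2 ^ ((T + 1) ^ Fintype.card ι)) {σ ∈ U | e (w₀ + κ) σ = 0}} ≤
      ∑ C ∈ 𝒟.filter (fun C => ¬ Sm C), Nat.card {κ : K // ∀ σ ∈ C, e (w₀ + κ) σ = 0} := by
    simp only [Nat.card_eq_fintype_card, Fintype.card_subtype]
    refine le_trans (Finset.card_le_card ?_) Finset.card_biUnion_le
    intro κ hκ
    rw [Finset.mem_filter] at hκ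
    by_contra hcon
    refine hκ.2 (hbad κ fun C hC hSm h => hcon ?_)
    exact Finset.mem_biUnion.2 ⟨C, Finset.mem_filter.2 ⟨hC, hSm⟩, by simpa using h⟩
  calc _ ≤ (∑ C ∈ 𝒟.filter (fun C => ¬ Sm C), Nat.card {κ : K // ∀ σ ∈ C, e (w₀ + κ) σ = 0}) *
        Nat.card F ^ (r + 1) := Nat.mul_le_mul_right _ hunion
    _ = ∑ C ∈ 𝒟.filter (fun C => ¬ Sm C), Nat.card {κ : K // ∀ σ ∈ C, e (w₀ + κ) σ = 0} *
        Nat.card F ^ (r + 1) := Finset.sum_mul ..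
    _ ≤ (𝒟.filter (fun C => ¬ Sm C)).card * Nat.card K := by
      rw [← smul_eq_mul]
      refine Finset.sum_le_card_nsmul _ _ _ fun C hC => ?_
      exact hpiece C (Finset.mem_filter.1 hC).1 (Finset.mem_filter.1 hC).2
    _ ≤ _ := Nat.mul_le_mul_right _ ((Finset.card_filter_le _ _).trans hcard)

/-- Constant in the growth of the Hilbert functions after `i` cuts. -/
def cutGrowth (N m : ℕ) : ℕ → ℕ
  | 0 => 1
  | i + 1 => cutGrowth N m i * (m + 1) ^ (N - i)

/-- Range of degrees in which the Hilbert functions are controlled after `i` cuts. -/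
def cutDegree (N m i : ℕ) : ℕ := (m + 1) ^ (N - i) * (cutGrowth N m N + 1) - 1

/-- Number of pieces after `i` cuts. -/
def cutPieces (N m : ℕ) : ℕ → ℕ
  | 0 => 1
  | i + 1 => cutPieces N m i * 2 ^ ((cutDegree N m i + 1) ^ N)

lemma cutDegree_add_one (N m i : ℕ) :
    cutDegree N m i + 1 = (m + 1) ^ (N - i) * (cutGrowth N m N + 1) :=
  Nat.sub_add_cancel (Nat.mul_pos (by positivity) (Nat.succ_pos _))

/-- Bound for the size of a clique after `N` cuts. -/
def cutBound (N m R : ℕ) : ℕ := cutPieces N m N * (R + cutDegree N m N)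

/-- Weight of the exceptional event. -/
def cutWeight (N m : ℕ) : ℕ := ∑ i ∈ Finset.range N, cutPieces N m (i + 1)

lemma card_clique_le_of_coverBound {D : (ι → F) → (ι → F) → Prop} {R T A M : ℕ}
    {U : Set (ι → F)} (hA : A ≤ T) (hU : CoverBound D R T A 0 M U) (Z : Finset (ι → F))
    (hZ : ↑Z ⊆ U) (hD : (Z : Set (ι → F)).Pairwise D) : Z.card ≤ M * (R + T) := by
  classical
  obtain ⟨𝒜, hM, hcov, h𝒜⟩ := hU
  have h1 : Z ⊆ 𝒜.biUnion fun B => Z.filter (· ∈ B) := by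
    intro z hz
    obtain ⟨B, hB, hzB⟩ := hcov z (hZ hz)
    exact Finset.mem_biUnion.2 ⟨B, hB, Finset.mem_filter.2 ⟨hz, hzB⟩⟩
  refine (Finset.card_le_card h1).trans <| Finset.card_biUnion_le.trans <|
    (Finset.sum_le_card_nsmul _ _ (R + T) fun B hB => ?_).trans (Nat.mul_le_mul_right _ hM)
  rcases (h𝒜 B hB).2 with h | h
  · refine (h _ ?_ (hD.mono ?_)).trans (Nat.le_add_right _ _)
    · intro z hz; simpa using (Finset.mem_filter.1 hz).2
    · exact Finset.coe_subset.2 (Finset.filter_subset _ _)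
  · refine (card_le_of_hilb_le (S := B) ((h T le_rfl).trans (by simpa using hA)) _ ?_).trans
      (Nat.le_add_left _ _)
    intro z hz; exact (Finset.mem_filter.1 hz).2

theorem card_large_cutSet_le {W : Type*} [AddCommGroup W] [Finite W]
    {D : (ι → F) → (ι → F) → Prop} {R r m N : ℕ} (hN : Fintype.card ι = N)
    (E : ℕ → W →+ ((ι → F) → F)) (hE : ∀ i w, E i w ∈ polyFun F ι m) (S : Set (ι → F))
    (Exc : W → Prop)
    (hs : ∀ w, ¬ Exc w → ∀ i < N, Spreads D R r (E i) (cutSet E S i w) (cutStab E S i w)) :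
    Nat.card {w // ∃ Z : Finset (ι → F), ↑Z ⊆ cutSet E S N w ∧ (Z : Set (ι → F)).Pairwise D ∧
      cutBound N m R < Z.card} * Nat.card F ^ (r + 1) ≤
    cutWeight N m * Nat.card W + Nat.card {w // Exc w} * Nat.card F ^ (r + 1) := by
  classical
  have : Fintype W := Fintype.ofFinite W
  let Nice : ℕ → W → Prop := fun i w => CoverBound D R (cutDegree N m i) (cutGrowth N m i) (N - i)
    (cutPieces N m i) (cutSet E S i w)
  have h0 : ∀ w, Nice 0 w := fun w =>
    ⟨{cutSet E S 0 w}, by simp [cutPieces], fun σ hσ => ⟨_, Finset.mem_singleton_self _, hσ⟩, by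
      intro B hB
      rw [Finset.mem_singleton] at hB
      subst hB
      refine ⟨subset_rfl, Or.inr fun t _ => ?_⟩
      simpa [cutGrowth, hN] using hilb_le (cutSet E S 0 w) t⟩
  let Bad : ℕ → W → Prop := fun i w => Nice i w ∧
    Spreads D R r (E i) (cutSet E S i w) (cutStab E S i w) ∧ ¬ Nice (i + 1) w
  have hstep : ∀ i < N, Nat.card {w // Bad i w} * Nat.card F ^ (r + 1) ≤
      cutPieces N m (i + 1) * Nat.card W := by
    intro i hi
    refine card_mul_le_of_coset (cutStab E S i) (fun w κ hκ => cutStab_add E S i w κ hκ) _ _ _ ?_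
    intro w
    by_cases hw : Nice i w ∧ Spreads D R r (E i) (cutSet E S i w) (cutStab E S i w)
    · obtain ⟨hn, hsp⟩ := hw
      obtain ⟨d, hd⟩ : ∃ d, N - i = d + 1 := ⟨N - i - 1, by omega⟩
      have hd' : N - (i + 1) = d := by omega
      have hn' : CoverBound D R (cutDegree N m i) (cutGrowth N m i) (d + 1)
        (cutPieces N m i) (cutSet E S i w) := hd ▸ hn
      have key := card_not_coverBound_le (T' := cutDegree N m (i + 1)) (hE i)
        (by rw [cutDegree_add_one, cutDegree_add_one, hd, hd', pow_succ]; exact le_of_eq (by ring))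
        hn' hsp w
      rw [hN] at key
      refine le_trans (Nat.mul_le_mul_right _ ?_) key
      refine Nat.card_le_card_of_injective (fun κ => ⟨κ.1, ?_⟩) ?_
      · intro hcon
        refine κ.2.2.2 ?_
        change CoverBound _ _ _ _ _ _ _
        rw [hd']
        have e1 : cutSet E S (i + 1) (w + κ.1) =
            {σ ∈ cutSet E S i w | E i (w + κ.1) σ = 0} := by
          rw [← cutSet_add E S i w κ.1 κ.1.2 i le_rfl]
          ext σ
          simp only [cutSet, Set.mem_ofPred_eq, Nat.lt_succ_iff_lt_or_eq, or_imp, forall_and,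
            forall_eq, and_assoc]
        rw [e1, cutGrowth, cutPieces, hd]
        exact hcon
      · rintro ⟨x, _⟩ ⟨y, _⟩ h
        simpa using h
    · have : IsEmpty {κ : cutStab E S i w // Bad i (w + κ)} := by
        refine ⟨fun κ => hw ?_⟩
        have e1 := cutSet_add E S i w κ.1 κ.1.2 i le_rfl
        have e2 := cutStab_add E S i w κ.1 κ.1.2
        have h1 := κ.2.1
        have h2 := κ.2.2.1
        rw [e1, e2] at h2
        simp only [Nice, e1] at h1
        exact ⟨h1, h2⟩
      simp
  have hfinal : ∀ w, (∃ Z : Finset (ι → F), ↑Z ⊆ cutSet E S N w ∧ (Z : Set (ι → F)).Pairwise D ∧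
      cutBound N m R < Z.card) → Exc w ∨ ∃ i < N, Bad i w := by
    rintro w ⟨Z, hZU, hZD, hZ⟩
    by_contra! hcon
    have hall : ∀ i ≤ N, Nice i w := by
      intro i hi
      induction i with
      | zero => exact h0 w
      | succ i ih =>
        by_contra hc
        exact hcon.2 i (by omega) ⟨ih (by omega), hs w hcon.1 i (by omega), hc⟩
    have hN' := hall N le_rfl
    simp only [Nice, Nat.sub_self] at hN'
    refine absurd (card_clique_le_of_coverBound ?_ hN' Z hZU hZD) (not_le.2 hZ)
    have := cutDegree_add_one N m N
    simp at this
    omega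
  have hcount : Nat.card {w // ∃ Z : Finset (ι → F), ↑Z ⊆ cutSet E S N w ∧
      (Z : Set (ι → F)).Pairwise D ∧ cutBound N m R < Z.card} ≤
      Nat.card {w // Exc w} + ∑ i ∈ Finset.range N, Nat.card {w // Bad i w} := by
    simp only [Nat.card_eq_fintype_card, Fintype.card_subtype]
    refine le_trans (Finset.card_le_card (t := (Finset.univ.filter Exc) ∪
      (Finset.range N).biUnion fun i => Finset.univ.filter (Bad i)) ?_) ?_
    · intro w hw
      rw [Finset.mem_filter] at hw
      rcases hfinal w hw.2 with h | ⟨i, hi, h⟩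
      · exact Finset.mem_union_left _ (by simpa using h)
      · refine Finset.mem_union_right _ (Finset.mem_biUnion.2 ⟨i, by simpa using hi, ?_⟩)
        rw [Finset.mem_filter]
        exact ⟨Finset.mem_univ _, h⟩
    · exact (Finset.card_union_le _ _).trans (Nat.add_le_add_left Finset.card_biUnion_le _)
  calc _ ≤ (Nat.card {w // Exc w} + ∑ i ∈ Finset.range N, Nat.card {w // Bad i w}) *
        Nat.card F ^ (r + 1) := Nat.mul_le_mul_right _ hcount
    _ = (∑ i ∈ Finset.range N, Nat.card {w // Bad i w} * Nat.card F ^ (r + 1)) +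
        Nat.card {w // Exc w} * Nat.card F ^ (r + 1) := by rw [add_mul, Finset.sum_mul, add_comm]
    _ ≤ _ := by
      refine Nat.add_le_add_right ?_ _
      rw [cutWeight, Finset.sum_mul]
      exact Finset.sum_le_sum fun i hi => hstep i (Finset.mem_range.1 hi)

end Cut

section BiPoly

/-- Span of the functions `g(x) h(y)` with `g` and `h` polynomial functions of degree at
most `D` on `F ^ b`. -/
def biPoly (F : Type*) [Field F] (b D : ℕ) : Submodule F ((Fin b → F) → (Fin b → F) → F) :=
  Submodule.span F {f | ∃ g ∈ polyFun F (Fin b) D, ∃ h ∈ polyFun F (Fin b) D,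
    f = fun x y => g x * h y}

/-- Systems of `a` elements of `biPoly`. -/
abbrev PolyTuple (F : Type*) [Field F] (a b D : ℕ) : Type _ := Fin a → biPoly F b D

variable {F ι : Type*} [Field F] [Fintype ι] {a b D : ℕ}

/-- Maps between coordinate spaces pulling back polynomial functions without raising degrees. -/
def IsPolyMap (P : (ι → F) → (Fin b → F)) : Prop :=
  ∀ t, ∀ g ∈ polyFun F (Fin b) t, (fun σ => g (P σ)) ∈ polyFun F ι t

lemma isPolyMap_const (p : Fin b → F) : IsPolyMap (fun _ : ι → F => p) :=
  fun t g _ => const_mem_polyFun (g p) t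

lemma isPolyMap_comp (j : Fin b → ι) : IsPolyMap (fun (σ : ι → F) k => σ (j k)) :=
  fun _ _ hg => comp_mem_polyFun hg j

lemma comp_biPoly_mem {P Q : (ι → F) → (Fin b → F)} (hP : IsPolyMap P) (hQ : IsPolyMap Q)
    {f : (Fin b → F) → (Fin b → F) → F} (hf : f ∈ biPoly F b D) :
    (fun σ => f (P σ) (Q σ)) ∈ polyFun F ι (2 * D) := by
  induction hf using Submodule.span_induction with
  | mem f hf =>
    obtain ⟨g, hg, h, hh, rfl⟩ := hf
    rw [two_mul]
    exact mul_mem_polyFun (hP _ g hg) (hQ _ h hh)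
  | zero => exact Submodule.zero_mem _
  | add f g _ _ hf hg => exact Submodule.add_mem _ hf hg
  | smul c f _ hf => exact Submodule.smul_mem _ c hf

lemma biPoly_apply_mem {f : (Fin b → F) → (Fin b → F) → F} (hf : f ∈ biPoly F b D)
    (x : Fin b → F) : f x ∈ polyFun F (Fin b) D := by
  induction hf using Submodule.span_induction with
  | mem f hf =>
    obtain ⟨g, hg, h, hh, rfl⟩ := hf
    exact Submodule.smul_mem _ (g x) hh
  | zero => exact Submodule.zero_mem _
  | add f g _ _ hf hg => exact Submodule.add_mem _ hf hg
  | smul c f _ hf => exact Submodule.smul_mem _ c hf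

/-- The value at `(P σ, Q σ)` of the combination of the tuple with coefficients `c`. -/
def evalStep (D : ℕ) (c : Fin a → F) (P Q : (ι → F) → (Fin b → F)) :
    PolyTuple F a b D →+ ((ι → F) → F) where
  toFun w σ := ∑ k, c k * (w k).1 (P σ) (Q σ)
  map_zero' := by ext; simp
  map_add' := by intro w w'; ext; simp [mul_add, Finset.sum_add_distrib]

lemma evalStep_apply {ι : Type*} (c : Fin a → F) (P Q : (ι → F) → (Fin b → F))
    (w : PolyTuple F a b D)
    (σ : ι → F) : evalStep D c P Q w σ = ∑ k, c k * (w k).1 (P σ) (Q σ) := rfl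

lemma evalStep_mem (c : Fin a → F) {P Q : (ι → F) → (Fin b → F)} (hP : IsPolyMap P)
    (hQ : IsPolyMap Q) (w : PolyTuple F a b D) : evalStep D c P Q w ∈ polyFun F ι (2 * D) := by
  have : evalStep D c P Q w = ∑ k, c k • fun σ => (w k).1 (P σ) (Q σ) := by
    ext σ; simp [evalStep_apply]
  rw [this]
  exact Submodule.sum_mem _ fun k _ => Submodule.smul_mem _ _ (comp_biPoly_mem hP hQ (w k).2)

/-- The tuple with entries `ν k • ∑ j, g j • (L j ⊗ M j)`. -/
def tensorTuple {r : ℕ} (ν : Fin a → F) (g : Fin (r + 1) → F)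
    (L M : Fin (r + 1) → (Fin b → F) → F)
    (hL : ∀ j, L j ∈ polyFun F (Fin b) D) (hM : ∀ j, M j ∈ polyFun F (Fin b) D) :
    PolyTuple F a b D := fun k =>
  ν k • ∑ j, g j • (⟨fun x y => L j x * M j y,
    Submodule.subset_span ⟨L j, hL j, M j, hM j, rfl⟩⟩ : biPoly F b D)

lemma evalStep_tensorTuple {ι : Type*} {r : ℕ} (c ν : Fin a → F) (g : Fin (r + 1) → F)
    (L M : Fin (r + 1) → (Fin b → F) → F)
    (hL : ∀ j, L j ∈ polyFun F (Fin b) D) (hM : ∀ j, M j ∈ polyFun F (Fin b) D)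
    (P Q : (ι → F) → (Fin b → F)) (σ : ι → F) :
    evalStep D c P Q (tensorTuple ν g L M hL hM) σ =
      (∑ k, c k * ν k) * ∑ j, g j * (L j (P σ) * M j (Q σ)) := by
  rw [evalStep_apply, Finset.sum_mul]
  refine Finset.sum_congr rfl fun k _ => ?_
  rw [mul_assoc]
  congr 1
  simp only [tensorTuple, Submodule.coe_smul, Pi.smul_apply, smul_eq_mul]
  congr 1
  simp [Finset.sum_apply]

lemma exists_separating {r : ℕ} (p : Fin (r + 1) → Fin b → F) (hp : Function.Injective p)
    (Z : Finset (Fin b → F)) (hZ : ∀ j, p j ∉ Z) (hD : r + Z.card ≤ D) :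
    ∃ L : Fin (r + 1) → (Fin b → F) → F, (∀ j, L j ∈ polyFun F (Fin b) D) ∧
      (∀ j, L j (p j) = 1) ∧ (∀ j j', j ≠ j' → L j (p j') = 0) ∧ ∀ j, ∀ z ∈ Z, L j z = 0 := by
  classical
  have h : ∀ j, ∃ L ∈ polyFun F (Fin b) D, L (p j) = 1 ∧ (∀ j', j ≠ j' → L (p j') = 0) ∧
      ∀ z ∈ Z, L z = 0 := by
    intro j
    obtain ⟨L, hL, h1, h0⟩ := exists_interpolation (((Finset.univ.erase j).image p) ∪ Z)
      (z := p j) (by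
        simp only [Finset.mem_union, Finset.mem_image, Finset.mem_erase, Finset.mem_univ, not_or,
          not_exists, and_true]
        exact ⟨fun i hi => hi.1 (hp hi.2), hZ j⟩)
    refine ⟨L, polyFun_mono ?_ hL, h1, fun j' hj => h0 _ ?_, fun z hz => h0 _ ?_⟩
    · refine (Finset.card_union_le _ _).trans (le_trans (Nat.add_le_add_right ?_ _) hD)
      refine Finset.card_image_le.trans ?_
      simp
    · exact Finset.mem_union_left _ (Finset.mem_image_of_mem _ (by simp [hj.symm]))
    · exact Finset.mem_union_right _ hz
  choose L h1 h2 h3 h4 using h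
  exact ⟨L, h1, h2, h3, h4⟩

lemma exists_separating_one (p : Fin b → F) (Z : Finset (Fin b → F)) (hZ : p ∉ Z)
    (hD : Z.card ≤ D) :
    ∃ L ∈ polyFun F (Fin b) D, L p = 1 ∧ ∀ z ∈ Z, L z = 0 := by
  obtain ⟨L, hL, h⟩ := exists_interpolation Z hZ
  exact ⟨L, polyFun_mono hD hL, h⟩

/-- Interpolation data showing that prescribed values can be reached at a step without affecting
the previous ones. -/
def TensorSpread (D r : ℕ) (Z : Finset (ι → F)) (P Q : (ι → F) → (Fin b → F))
    (V : ((Fin b → F) → F) → ((Fin b → F) → F) → Prop) : Prop :=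
  ∃ τ : Fin (r + 1) → ι → F, (∀ j, τ j ∈ Z) ∧ ∃ L M : Fin (r + 1) → (Fin b → F) → F,
    (∀ j, L j ∈ polyFun F (Fin b) D) ∧ (∀ j, M j ∈ polyFun F (Fin b) D) ∧
    (∀ j, L j (P (τ j)) * M j (Q (τ j)) = 1) ∧
    (∀ j j', j ≠ j' → L j (P (τ j')) * M j (Q (τ j')) = 0) ∧ ∀ j, V (L j) (M j)

lemma spreads_of_tensorSpread {ι : Type*} {Dis : (ι → F) → (ι → F) → Prop} {R r : ℕ}
    {U : Set (ι → F)} (c : Fin a → F) (P Q : (ι → F) → (Fin b → F))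
    (K : AddSubgroup (PolyTuple F a b D)) (ν : Fin a → F) (hν : ∑ k, c k * ν k = 1)
    (V : ((Fin b → F) → F) → ((Fin b → F) → F) → Prop)
    (hV : ∀ L M : Fin (r + 1) → (Fin b → F) → F,
      ∀ (hL : ∀ j, L j ∈ polyFun F (Fin b) D) (hM : ∀ j, M j ∈ polyFun F (Fin b) D),
      (∀ j, V (L j) (M j)) → ∀ g, tensorTuple ν g L M hL hM ∈ K)
    (h : ∀ Z : Finset (ι → F), ↑Z ⊆ U → (Z : Set (ι → F)).Pairwise Dis → R < Z.card →
      TensorSpread D r Z P Q V) :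
    Spreads Dis R r (evalStep D c P Q) U K := by
  intro Z hZU hZD hZ
  obtain ⟨τ, hτ, L, M, hL, hM, h1, h0, hv⟩ := h Z hZU hZD hZ
  refine ⟨τ, hτ, fun g => ⟨tensorTuple ν g L M hL hM, hV L M hL hM hv g, fun j => ?_⟩⟩
  rw [evalStep_tensorTuple, hν, one_mul, Finset.sum_eq_single j, h1, mul_one]
  · intro i _ hij
    rw [h0 i j hij, mul_zero]
  · simp

/-- The points of `S` satisfying the equations of the first `e` edges. -/
def edgeCut (P Q : ℕ → (ι → F) → (Fin b → F)) (S : Set (ι → F)) (e : ℕ)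
    (w : PolyTuple F a b D) : Set (ι → F) :=
  {σ ∈ S | ∀ e' < e, ∀ k, (w k).1 (P e' σ) (Q e' σ) = 0}

theorem card_large_edgeCut_le [Finite F] (ha : 0 < a) {Dis : (ι → F) → (ι → F) → Prop}
    {R r t : ℕ} (hN : Fintype.card ι = t * a) (P Q : ℕ → (ι → F) → (Fin b → F))
    (hP : ∀ e, IsPolyMap (P e)) (hQ : ∀ e, IsPolyMap (Q e)) (S : Set (ι → F))
    (Exc : PolyTuple F a b D → Prop)
    (hs : ∀ w, ¬ Exc w → ∀ e < t, ∀ Z : Finset (ι → F), ↑Z ⊆ edgeCut P Q S e w →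
      (Z : Set (ι → F)).Pairwise Dis → R < Z.card →
      TensorSpread D r Z (P e) (Q e) fun L M =>
        ∀ e' < e, ∀ σ ∈ edgeCut P Q S e' w, L (P e' σ) * M (Q e' σ) = 0) :
    Nat.card {w : PolyTuple F a b D // ∃ Z : Finset (ι → F), ↑Z ⊆ edgeCut P Q S t w ∧
      (Z : Set (ι → F)).Pairwise Dis ∧ cutBound (t * a) (2 * D) R < Z.card} *
        Nat.card F ^ (r + 1) ≤
    cutWeight (t * a) (2 * D) * Nat.card (PolyTuple F a b D) +
      Nat.card {w // Exc w} * Nat.card F ^ (r + 1) := by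
  classical
  have : NeZero a := ⟨ha.ne'⟩
  let E : ℕ → PolyTuple F a b D →+ ((ι → F) → F) := fun i =>
    evalStep D (Pi.single (Fin.ofNat a i) 1) (P (i / a)) (Q (i / a))
  have hE : ∀ i w σ, E i w σ = (w (Fin.ofNat a i)).1 (P (i / a) σ) (Q (i / a) σ) := by
    intro i w σ
    simp only [E, evalStep_apply]
    rw [Finset.sum_eq_single (Fin.ofNat a i)]
    · simp
    · intro k _ hk
      rw [Pi.single_eq_of_ne hk, zero_mul]
    · simp
  have hsub : ∀ i w, cutSet E S i w ⊆ edgeCut P Q S (i / a) w := by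
    rintro i w σ ⟨hσ, h⟩
    refine ⟨hσ, fun e he k => ?_⟩
    have h1 := h (e * a + k) (by
      calc e * a + k < (e + 1) * a := by rw [add_mul, one_mul]; exact Nat.add_lt_add_left k.2 _
        _ ≤ (i / a) * a := Nat.mul_le_mul_right _ he
        _ ≤ i := Nat.div_mul_le_self i a)
    rw [hE] at h1
    have e1 : (e * a + k) / a = e := by
      rw [mul_comm, Nat.mul_add_div ha, Nat.div_eq_of_lt k.2, add_zero]
    have e2 : Fin.ofNat a (e * a + k) = k := by
      ext
      simp [Fin.ofNat, Nat.mod_eq_of_lt k.2]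
    rwa [e1, e2] at h1
  have heq : ∀ w, edgeCut P Q S t w ⊆ cutSet E S (t * a) w := by
    rintro w σ ⟨hσ, h⟩
    refine ⟨hσ, fun i hi => ?_⟩
    rw [hE]
    exact h _ (Nat.div_lt_of_lt_mul (by rwa [mul_comm])) _
  have main := card_large_cutSet_le (D := Dis) (R := R) (r := r) (m := 2 * D) hN E
    (fun i w => evalStep_mem _ (hP _) (hQ _) w) S Exc ?_
  · refine le_trans (Nat.mul_le_mul_right _ ?_) main
    have : Finite (PolyTuple F a b D) := inferInstance
    refine Nat.card_le_card_of_injective (fun w => ⟨w.1, ?_⟩) ?_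
    · obtain ⟨Z, hZ, h⟩ := w.2
      exact ⟨Z, hZ.trans (heq _), h⟩
    · rintro ⟨x, _⟩ ⟨y, _⟩ h
      simpa using h
  · intro w hw i hi
    refine spreads_of_tensorSpread _ _ _ _ (Pi.single (Fin.ofNat a i) 1) ?_
      (fun L M => ∀ e' < i / a, ∀ σ ∈ edgeCut P Q S e' w, L (P e' σ) * M (Q e' σ) = 0) ?_ ?_
    · rw [Finset.sum_eq_single (Fin.ofNat a i)]
      · simp
      · intro k _ hk
        rw [Pi.single_eq_of_ne hk, zero_mul]
      · simp
    · intro L M hL hM hv g i' hi' σ hσ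
      rw [evalStep_tensorTuple]
      by_cases hk : Fin.ofNat a i' = Fin.ofNat a i
      · have hmod : i' % a = i % a := congrArg Fin.val hk
        have hlt : i' / a < i / a := by
          by_contra! hcon
          have e1 := Nat.div_add_mod i a
          have e2 := Nat.div_add_mod i' a
          have := Nat.mul_le_mul_left a hcon
          omega
        have h0 : ∑ j, g j * (L j (P (i' / a) σ) * M j (Q (i' / a) σ)) = 0 :=
          Finset.sum_eq_zero fun j _ => by rw [hv j _ hlt σ (hsub _ _ hσ), mul_zero]
        rw [h0, mul_zero]
      · rw [Finset.sum_eq_zero, zero_mul]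
        intro k _
        by_cases hki : k = Fin.ofNat a i'
        · subst hki
          rw [Pi.single_eq_of_ne hk, mul_zero]
        · rw [Pi.single_eq_of_ne hki, zero_mul]
    · intro Z hZ hD hR
      exact hs w hw _ (Nat.div_lt_of_lt_mul (by rwa [mul_comm])) Z (hZ.trans (hsub _ _)) hD hR

end BiPoly

section Transfer

lemma edgeSet_ncard_le_exNum {β : Type*} {H : SimpleGraph β} {n : ℕ} (G : SimpleGraph (Fin n))
    (hG : ¬ G.Contains H) : G.edgeSet.ncard ≤ exNum n H := by
  refine le_csSup ⟨Nat.card (Sym2 (Fin n)), ?_⟩ ⟨G, hG, rfl⟩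
  rintro _ ⟨G', -, rfl⟩
  exact Set.ncard_le_card _

lemma edgeSet_ncard_le_exNum_of_card_le {V β : Type*} [Finite V] {H : SimpleGraph β}
    (hH : ∀ v, ∃ u, H.Adj v u) {n : ℕ} (hn : Nat.card V ≤ n) (G : SimpleGraph V)
    (hG : ¬ G.Contains H) : G.edgeSet.ncard ≤ exNum n H := by
  have : Fintype V := Fintype.ofFinite V
  obtain ⟨φ⟩ : Nonempty (V ↪ Fin n) := by
    rw [Function.Embedding.nonempty_iff_card_le, Fintype.card_fin, ← Nat.card_eq_fintype_card]
    exact hn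
  have h1 : (G.map φ).edgeSet.ncard = G.edgeSet.ncard := by
    rw [SimpleGraph.edgeSet_map]
    exact Set.ncard_image_of_injective _ φ.sym2Map.injective
  rw [← h1]
  refine edgeSet_ncard_le_exNum _ ?_
  rintro ⟨f, hf⟩
  have h2 : ∀ v, ∃ x, φ x = f v := by
    intro v
    obtain ⟨u, hu⟩ := hH v
    have := f.map_rel hu
    rw [SimpleGraph.map_adj] at this
    obtain ⟨x, y, -, hx, -⟩ := this
    exact ⟨x, hx⟩
  choose g hg using h2
  refine hG ⟨⟨g, fun {u v} huv => ?_⟩, fun u v huv => ?_⟩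
  · have := f.map_rel huv
    rw [← hg, ← hg] at this
    simpa using this
  · refine hf ?_
    rw [← hg u, ← hg v]
    exact congrArg φ huv

variable {F : Type*} [Field F] {a b D : ℕ}

/-- The bipartite graph on two copies of `F ^ b` defined by the vanishing of the tuple `w`. -/
def polyGraph (w : PolyTuple F a b D) : SimpleGraph ((Fin b → F) ⊕ (Fin b → F)) where
  Adj
    | Sum.inl x, Sum.inr y => ∀ k, (w k).1 x y = 0
    | Sum.inr y, Sum.inl x => ∀ k, (w k).1 x y = 0
    | _, _ => False
  symm := ⟨by rintro (x | x) (y | y) <;> simp⟩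
  loopless := ⟨by rintro (x | x) <;> simp⟩

variable [Finite F]

lemma card_le_card_zero_mul (x y : Fin b → F) :
    Nat.card (PolyTuple F a b D) ≤
      Nat.card {w : PolyTuple F a b D // ∀ k, (w k).1 x y = 0} * Nat.card F ^ a := by
  have hone : (fun _ _ => (1 : F)) ∈ biPoly F b D :=
    Submodule.subset_span ⟨_, const_mem_polyFun 1 D, _, const_mem_polyFun 1 D, by simp⟩
  rw [← Nat.card_fin a, ← Nat.card_fun, Nat.card_fin a, ← Nat.card_prod]
  refine Nat.card_le_card_of_injective (fun w =>
    (⟨fun k => w k - (w k).1 x y • ⟨_, hone⟩, fun k => by simp⟩, fun k => (w k).1 x y)) ?_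
  intro w w' h
  simp only [Prod.mk.injEq, Subtype.mk.injEq] at h
  ext1 k
  have h1 := congrFun h.1 k
  have h2 := congrFun h.2 k
  rw [h2] at h1
  exact sub_left_injective h1

lemma exists_many_zeros (Bad : PolyTuple F a b D → Prop)
    (hBad : Nat.card {w // Bad w} * (2 * Nat.card F ^ a) ≤ Nat.card (PolyTuple F a b D)) :
    ∃ w : PolyTuple F a b D, ¬ Bad w ∧ Nat.card F ^ (2 * b) ≤ 2 * Nat.card F ^ a *
      Nat.card {p : (Fin b → F) × (Fin b → F) // ∀ k, (w k).1 p.1 p.2 = 0} := by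
  classical
  have : Fintype F := Fintype.ofFinite F
  have : Fintype (PolyTuple F a b D) := Fintype.ofFinite _
  by_contra! hcon
  set q := Nat.card F
  have hq : 0 < q := Nat.card_pos
  let e : PolyTuple F a b D → ℕ := fun w =>
    Nat.card {p : (Fin b → F) × (Fin b → F) // ∀ k, (w k).1 p.1 p.2 = 0}
  have hpt : Nat.card ((Fin b → F) × (Fin b → F)) = q ^ (2 * b) := by
    rw [Nat.card_prod, Nat.card_fun, Nat.card_fin, two_mul, pow_add]
  have hele : ∀ w, e w ≤ q ^ (2 * b) := fun w => by
    rw [← hpt]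
    exact Nat.card_le_card_of_injective _ Subtype.val_injective
  have hsum : Nat.card (PolyTuple F a b D) * q ^ (2 * b) ≤ (∑ w, e w) * q ^ a := by
    have h1 : ∑ w, e w = ∑ p : (Fin b → F) × (Fin b → F),
        Nat.card {w : PolyTuple F a b D // ∀ k, (w k).1 p.1 p.2 = 0} := by
      simp only [e, Nat.card_eq_fintype_card, Fintype.card_subtype, Finset.card_filter]
      exact Finset.sum_comm
    rw [h1, Finset.sum_mul, ← hpt, Nat.card_eq_fintype_card (α := (Fin b → F) × (Fin b → F)),
      mul_comm, ← smul_eq_mul, ← Finset.card_univ]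
    exact Finset.card_nsmul_le_sum _ _ _ fun p _ => card_le_card_zero_mul p.1 p.2
  have hsplit := Finset.sum_filter_add_sum_filter_not Finset.univ Bad e
  have hb : ∑ w with Bad w, e w ≤ Nat.card {w // Bad w} * q ^ (2 * b) := by
    rw [Nat.card_eq_fintype_card, Fintype.card_subtype, ← smul_eq_mul]
    exact Finset.sum_le_card_nsmul _ _ _ fun w _ => hele w
  have hW : 0 < Nat.card (PolyTuple F a b D) := Nat.card_pos
  have hcards : Nat.card {w // Bad w} + (Finset.univ.filter fun w => ¬ Bad w).card =
      Nat.card (PolyTuple F a b D) := by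
    rw [Nat.card_eq_fintype_card, Fintype.card_subtype, Nat.card_eq_fintype_card,
      Finset.card_filter_add_card_filter_not, Finset.card_univ]
  have hqa : 0 < q ^ a := by positivity
  have hne : (Finset.univ.filter fun w : PolyTuple F a b D => ¬ Bad w).Nonempty := by
    rw [← Finset.card_pos]
    by_contra! h0
    have : Nat.card {w // Bad w} = Nat.card (PolyTuple F a b D) := by omega
    rw [this] at hBad
    nlinarith
  have hg : ∑ w with ¬ Bad w, 2 * q ^ a * e w <
      (Finset.univ.filter fun w : PolyTuple F a b D => ¬ Bad w).card * q ^ (2 * b) := by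
    rw [← smul_eq_mul (_ : ℕ) (q ^ (2 * b)), ← Finset.sum_const]
    exact Finset.sum_lt_sum_of_nonempty hne fun w hw => hcon w (by simpa using hw)
  rw [← Finset.mul_sum] at hg
  have h3 : (Finset.univ.filter fun w : PolyTuple F a b D => ¬ Bad w).card * q ^ (2 * b) ≤
      Nat.card (PolyTuple F a b D) * q ^ (2 * b) := Nat.mul_le_mul_right _ (by omega)
  have h4 : Nat.card {w // Bad w} * (2 * q ^ a) * q ^ (2 * b) ≤
      Nat.card (PolyTuple F a b D) * q ^ (2 * b) := Nat.mul_le_mul_right _ hBad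
  have h5 : 2 * q ^ a * ∑ w with Bad w, e w ≤ 2 * q ^ a * (Nat.card {w // Bad w} * q ^ (2 * b)) :=
    Nat.mul_le_mul_left _ hb
  rw [← hsplit] at hsum
  nlinarith

lemma card_zeros_le_edgeSet_ncard (w : PolyTuple F a b D) :
    Nat.card {p : (Fin b → F) × (Fin b → F) // ∀ k, (w k).1 p.1 p.2 = 0} ≤
      (polyGraph w).edgeSet.ncard := by
  rw [← Nat.card_coe_set_eq]
  refine Nat.card_le_card_of_injective
    (fun p => ⟨s(Sum.inl p.1.1, Sum.inr p.1.2), p.2⟩) ?_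
  rintro ⟨⟨x, y⟩, h⟩ ⟨⟨x', y'⟩, h'⟩ hp
  simpa using congrArg Subtype.val hp

end Transfer

theorem exists_lower_bound {β : Type*} (H : SimpleGraph β)
    (hH : ∀ v, ∃ u, H.Adj v u) (a b D C : ℕ) (hb : 0 < b) (hab : a ≤ b)
    (hbad : ∀ (F : Type) [Field F] [Finite F],
      Nat.card {w : PolyTuple F a b D // (polyGraph w).Contains H} * Nat.card F ^ (a + 1) ≤
        C * Nat.card (PolyTuple F a b D)) :
    ∃ c : ℝ, 0 < c ∧ ∀ᶠ n : ℕ in atTop, c * (n : ℝ) ^ (2 - (a : ℝ) / b) ≤ exNum n H := by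
  have key : ∀ q : ℕ, q.Prime → 2 * C ≤ q → ∀ n, 2 * q ^ b ≤ n →
      q ^ (2 * b) ≤ 2 * q ^ a * exNum n H := by
    intro q hq hC n hn
    have : Fact q.Prime := ⟨hq⟩
    have hcF : Nat.card (ZMod q) = q := Nat.card_zmod q
    have h1 := hbad (ZMod q)
    obtain ⟨w, hw, hcard⟩ := exists_many_zeros (F := ZMod q) (a := a) (b := b) (D := D)
      (fun w => (polyGraph w).Contains H) (by
        rw [hcF] at h1 ⊢
        have : Finite (ZMod q) := inferInstance
        have hW : 0 < Nat.card (PolyTuple (ZMod q) a b D) := Nat.card_pos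
        have hq0 := hq.pos
        by_contra! hcon
        have h2 := Nat.mul_le_mul_right (Nat.card (PolyTuple (ZMod q) a b D)) hC
        have h3 := Nat.mul_lt_mul_of_pos_right hcon hq0
        rw [pow_succ] at h1
        nlinarith)
    rw [hcF] at hcard
    refine hcard.trans (Nat.mul_le_mul_left _ ((card_zeros_le_edgeSet_ncard w).trans ?_))
    refine edgeSet_ncard_le_exNum_of_card_le hH ?_ _ hw
    rw [Nat.card_sum, Nat.card_fun, Nat.card_fin, hcF]
    omega
  have hbR : (0 : ℝ) < b := by exact_mod_cast hb
  set ρ : ℝ := 2 - (a : ℝ) / b with hρ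
  have hρ0 : 0 ≤ ρ := by
    have : (a : ℝ) / b ≤ 1 := by
      rw [div_le_one hbR]; exact_mod_cast hab
    linarith
  refine ⟨((2 : ℝ) * (2 * 2 ^ b) ^ ρ)⁻¹, by positivity, ?_⟩
  filter_upwards [eventually_ge_atTop (2 * (4 * C + 4) ^ b)] with n hn
  obtain ⟨k, hk1, hk2⟩ : ∃ k, 2 * k ^ b ≤ n ∧ n < 2 * (k + 1) ^ b := by
    have hex : ∃ k, n < 2 * (k + 1) ^ b := ⟨n, by
      have : n + 1 ≤ (n + 1) ^ b := Nat.le_self_pow hb.ne' _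
      omega⟩
    classical
    refine ⟨Nat.find hex, ?_, Nat.find_spec hex⟩
    rcases h : Nat.find hex with _ | k
    · simp [hb.ne']
    · have := Nat.find_min hex (m := k) (by omega)
      omega
  have hkC : 4 * C + 4 ≤ k := by
    by_contra! hlt
    have : (k + 1) ^ b ≤ (4 * C + 4) ^ b := Nat.pow_le_pow_left (by omega) _
    omega
  obtain ⟨q, hq, hq1, hq2⟩ := Nat.exists_prime_lt_and_le_two_mul (k / 2) (by omega)
  have hqn : 2 * q ^ b ≤ n := by
    have : q ^ b ≤ k ^ b := Nat.pow_le_pow_left (by omega) _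
    omega
  have hnq : n ≤ 2 * (2 * q) ^ b := by
    have : (k + 1) ^ b ≤ (2 * q) ^ b := Nat.pow_le_pow_left (by omega) _
    omega
  have hmain := key q hq (by omega) n hqn
  have hq0 : (0 : ℝ) < q := by exact_mod_cast hq.pos
  have h1 : (n : ℝ) ^ ρ ≤ (2 * 2 ^ b) ^ ρ * (q : ℝ) ^ (b * ρ) := by
    have h2 : (n : ℝ) ≤ (2 * 2 ^ b) * (q : ℝ) ^ b := by
      have : (n : ℝ) ≤ 2 * (2 * q) ^ b := by exact_mod_cast hnq
      rw [mul_pow] at this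
      linarith
    refine (Real.rpow_le_rpow (by positivity) h2 hρ0).trans ?_
    rw [Real.mul_rpow (by positivity) (by positivity), ← Real.rpow_natCast (q : ℝ) b,
      ← Real.rpow_mul hq0.le]
  have h3 : (q : ℝ) ^ (b * ρ) * (q : ℝ) ^ a = (q : ℝ) ^ (2 * b) := by
    rw [← Real.rpow_natCast, ← Real.rpow_natCast, ← Real.rpow_add hq0]
    congr 1
    rw [hρ]
    push_cast
    field_simp
    ring
  have h4 : (q : ℝ) ^ (b * ρ) ≤ 2 * exNum n H := by
    have h5 : (q : ℝ) ^ (2 * b) ≤ 2 * q ^ a * exNum n H := by exact_mod_cast hmain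
    rw [← h3] at h5
    have : (0 : ℝ) < (q : ℝ) ^ a := by positivity
    nlinarith
  rw [inv_mul_le_iff₀ (by positivity)]
  calc (n : ℝ) ^ ρ ≤ (2 * 2 ^ b) ^ ρ * (q : ℝ) ^ (b * ρ) := h1
    _ ≤ (2 * 2 ^ b) ^ ρ * (2 * exNum n H) := by gcongr
    _ = _ := by ring

lemma card_mul_le_of_forall_exists {W I : Type*} [Finite W] [Finite I] (B : W → Prop)
    (C : I → W → Prop) (h : ∀ w, B w → ∃ i, C i w) (Q M : ℕ)
    (hC : ∀ i, Nat.card {w // C i w} * Q ≤ M) : Nat.card {w // B w} * Q ≤ Nat.card I * M := by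
  classical
  have : Fintype W := Fintype.ofFinite W
  have : Fintype I := Fintype.ofFinite I
  have h1 : Nat.card {w // B w} ≤ ∑ i, Nat.card {w // C i w} := by
    simp only [Nat.card_eq_fintype_card, Fintype.card_subtype]
    refine le_trans (Finset.card_le_card ?_) Finset.card_biUnion_le
    intro w hw
    obtain ⟨i, hi⟩ := h w (by simpa using hw)
    exact Finset.mem_biUnion.2 ⟨i, Finset.mem_univ _, by simpa using hi⟩
  refine (Nat.mul_le_mul_right _ h1).trans ?_
  rw [Finset.sum_mul, Nat.card_eq_fintype_card, ← smul_eq_mul, ← Finset.card_univ]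
  exact Finset.sum_le_card_nsmul _ _ _ fun i _ => hC i

lemma exists_fin_embedding {X : Type*} {p : ℕ} (Z : Finset X) (h : p ≤ Z.card) :
    ∃ τ : Fin p → X, Function.Injective τ ∧ ∀ j, τ j ∈ Z := by
  obtain ⟨φ⟩ : Nonempty (Fin p ↪ Z) :=
    Function.Embedding.nonempty_iff_card_le.2 (by simpa using h)
  exact ⟨fun j => φ j, fun i j hij => φ.injective (Subtype.ext hij), fun j => (φ j).2⟩

section PolyGraphAdj

variable {F : Type*} [Field F] {a b D : ℕ} {w : PolyTuple F a b D}

lemma polyGraph_adj_inl {x : Fin b → F} {z : (Fin b → F) ⊕ (Fin b → F)}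
    (h : (polyGraph w).Adj (Sum.inl x) z) : ∃ y, z = Sum.inr y := by
  rcases z with z | z
  · exact h.elim
  · exact ⟨z, rfl⟩

lemma polyGraph_adj_inr {x : Fin b → F} {z : (Fin b → F) ⊕ (Fin b → F)}
    (h : (polyGraph w).Adj (Sum.inr x) z) : ∃ y, z = Sum.inl y := by
  rcases z with z | z
  · exact ⟨z, rfl⟩
  · exact h.elim

end PolyGraphAdj

/-- Two copies of the complete bipartite graph between `Fin s` and `Fin p`, with a perfect
matching between the two sides of size `p`. -/
def doubleStar (s p : ℕ) : SimpleGraph (Bool × (Fin s ⊕ Fin p)) where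
  Adj
    | (c, Sum.inl _), (c', Sum.inr _) => c = c'
    | (c, Sum.inr _), (c', Sum.inl _) => c = c'
    | (c, Sum.inr j), (c', Sum.inr j') => c ≠ c' ∧ j = j'
    | (_, Sum.inl _), (_, Sum.inl _) => False
  symm := ⟨by rintro ⟨c, x | x⟩ ⟨c', y | y⟩ <;> simp +contextual [eq_comm]⟩
  loopless := ⟨by rintro ⟨c, x | x⟩ <;> simp⟩

lemma doubleStar_colorable (s p : ℕ) : (doubleStar s p).Colorable 2 := by
  refine ⟨SimpleGraph.Coloring.mk
    (fun v => if xor v.1 v.2.isLeft then (0 : Fin 2) else 1) ?_⟩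
  rintro ⟨c, x | x⟩ ⟨c', y | y⟩ <;> cases c <;> cases c' <;> simp [doubleStar]

lemma doubleStar_exists_adj {s p : ℕ} (hs : 0 < s) (hp : 0 < p) (v : Bool × (Fin s ⊕ Fin p)) :
    ∃ u, (doubleStar s p).Adj v u := by
  rcases v with ⟨c, x | x⟩
  · exact ⟨(c, Sum.inr ⟨0, hp⟩), rfl⟩
  · exact ⟨(c, Sum.inl ⟨0, hs⟩), rfl⟩

section DoubleStar

variable {F : Type*} [Field F] {a b D : ℕ}

/-- A copy of the double star power in `polyGraph w`, in coordinates. -/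
structure DoubleStarIn (w : PolyTuple F a b D) {s : ℕ} (A B : Fin s → Fin b → F) (p : ℕ)
    (u v : Fin p → Fin b → F) : Prop where
  injA : Function.Injective A
  injB : Function.Injective B
  inju : Function.Injective u
  injv : Function.Injective v
  uB : ∀ j i, u j ≠ B i
  vA : ∀ j i, v j ≠ A i
  adjA : ∀ j i k, (w k).1 (u j) (A i) = 0
  adjB : ∀ j i k, (w k).1 (B i) (v j) = 0
  adj : ∀ j k, (w k).1 (u j) (v j) = 0

lemma exists_doubleStarIn_of_hom {w : PolyTuple F a b D} {s p : ℕ} (hs : 0 < s) (hp : 0 < p)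
    (f : doubleStar s p →g polyGraph w) (hf : Function.Injective f) (c : Bool)
    (hc : ∃ x, f (c, Sum.inr ⟨0, hp⟩) = Sum.inl x) :
    ∃ A B : Fin s → Fin b → F, ∃ u v : Fin p → Fin b → F, DoubleStarIn w A B p u v := by
  have hA : ∀ i, ∃ y, f (c, Sum.inl i) = Sum.inr y := by
    intro i
    obtain ⟨x, hx⟩ := hc
    have h : (doubleStar s p).Adj (c, Sum.inr ⟨0, hp⟩) (c, Sum.inl i) := rfl
    have := f.map_rel h
    rw [hx] at this
    exact polyGraph_adj_inl this
  have hu : ∀ j, ∃ y, f (c, Sum.inr j) = Sum.inl y := by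
    intro j
    obtain ⟨x, hx⟩ := hA ⟨0, hs⟩
    have h : (doubleStar s p).Adj (c, Sum.inl ⟨0, hs⟩) (c, Sum.inr j) := rfl
    have := f.map_rel h
    rw [hx] at this
    exact polyGraph_adj_inr this
  have hv : ∀ j, ∃ y, f (!c, Sum.inr j) = Sum.inr y := by
    intro j
    obtain ⟨x, hx⟩ := hu j
    have h : (doubleStar s p).Adj (c, Sum.inr j) (!c, Sum.inr j) := ⟨by simp, rfl⟩
    have := f.map_rel h
    rw [hx] at this
    exact polyGraph_adj_inl this
  have hB : ∀ i, ∃ y, f (!c, Sum.inl i) = Sum.inl y := by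
    intro i
    obtain ⟨x, hx⟩ := hv ⟨0, hp⟩
    have h : (doubleStar s p).Adj (!c, Sum.inr ⟨0, hp⟩) (!c, Sum.inl i) := rfl
    have := f.map_rel h
    rw [hx] at this
    exact polyGraph_adj_inr this
  choose A hA using hA
  choose u hu using hu
  choose v hv using hv
  choose B hB using hB
  have hc' : ¬ c = !c := by cases c <;> simp
  refine ⟨A, B, u, v, ?_, ?_, ?_, ?_, ?_, ?_, ?_, ?_, ?_⟩
  · intro i j h
    have := hf ((hA i).trans ((congrArg Sum.inr h).trans (hA j).symm))
    simpa using this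
  · intro i j h
    have := hf ((hB i).trans ((congrArg Sum.inl h).trans (hB j).symm))
    simpa using this
  · intro i j h
    have := hf ((hu i).trans ((congrArg Sum.inl h).trans (hu j).symm))
    simpa using this
  · intro i j h
    have := hf ((hv i).trans ((congrArg Sum.inr h).trans (hv j).symm))
    simpa using this
  · intro i j h
    have := hf ((hu i).trans ((congrArg Sum.inl h).trans (hB j).symm))
    simp at this
  · intro i j h
    have := hf ((hv i).trans ((congrArg Sum.inr h).trans (hA j).symm))
    simp at this
  · intro j i k
    have h : (doubleStar s p).Adj (c, Sum.inr j) (c, Sum.inl i) := rfl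
    have := f.map_rel h
    rw [hu, hA] at this
    exact this k
  · intro j i k
    have h : (doubleStar s p).Adj (!c, Sum.inl i) (!c, Sum.inr j) := rfl
    have := f.map_rel h
    rw [hB, hv] at this
    exact this k
  · intro j k
    have h : (doubleStar s p).Adj (c, Sum.inr j) (!c, Sum.inr j) := ⟨hc', rfl⟩
    have := f.map_rel h
    rw [hu, hv] at this
    exact this k

lemma exists_doubleStarIn {w : PolyTuple F a b D} {s p : ℕ} (hs : 0 < s) (hp : 0 < p)
    (h : (polyGraph w).Contains (doubleStar s p)) :
    ∃ A B : Fin s → Fin b → F, ∃ u v : Fin p → Fin b → F, DoubleStarIn w A B p u v := by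
  obtain ⟨f, hf⟩ := h
  rcases h0 : f (false, Sum.inr ⟨0, hp⟩) with x | x
  · exact exists_doubleStarIn_of_hom hs hp f hf false ⟨x, h0⟩
  · refine exists_doubleStarIn_of_hom hs hp f hf true ?_
    have h : (doubleStar s p).Adj (false, Sum.inr ⟨0, hp⟩) (true, Sum.inr ⟨0, hp⟩) :=
      ⟨by simp, rfl⟩
    have := f.map_rel h
    rw [h0] at this
    exact polyGraph_adj_inr this

lemma card_doubleStarIn_le [Finite F] {s : ℕ} (r : ℕ) (A B : Fin s → Fin (2 * s + 1) → F) :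
    Nat.card {w : PolyTuple F 2 (2 * s + 1) (r + s) // ∃ u v,
      DoubleStarIn w A B (cutBound ((2 * s + 1) * 2) (2 * (r + s)) r + 1) u v} *
        Nat.card F ^ (r + 1) ≤
      cutWeight ((2 * s + 1) * 2) (2 * (r + s)) * Nat.card (PolyTuple F 2 (2 * s + 1) (r + s)) := by
  classical
  by_cases hinj : Function.Injective A ∧ Function.Injective B
  swap
  · have : IsEmpty {w : PolyTuple F 2 (2 * s + 1) (r + s) // ∃ u v,
        DoubleStarIn w A B (cutBound ((2 * s + 1) * 2) (2 * (r + s)) r + 1) u v} :=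
      ⟨fun ⟨w, u, v, h⟩ => hinj ⟨h.injA, h.injB⟩⟩
    simp
  obtain ⟨hA, hB⟩ := hinj
  let b := 2 * s + 1
  let X := Fin 2 × Fin b → F
  let pu : X → Fin b → F := fun σ k => σ (0, k)
  let pv : X → Fin b → F := fun σ k => σ (1, k)
  let P : ℕ → X → Fin b → F := fun e σ =>
    if h : s ≤ e ∧ e < 2 * s then B ⟨e - s, by omega⟩ else pu σ
  let Q : ℕ → X → Fin b → F := fun e σ => if h : e < s then A ⟨e, h⟩ else pv σ
  have hP : ∀ e, IsPolyMap (P e) := by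
    intro e
    by_cases h : s ≤ e ∧ e < 2 * s
    · simp only [P, h, and_self, dite_true]
      exact isPolyMap_const _
    · simp only [P, h, dite_false]
      exact isPolyMap_comp _
  have hQ : ∀ e, IsPolyMap (Q e) := by
    intro e
    by_cases h : e < s
    · simp only [Q, h, dite_true]
      exact isPolyMap_const _
    · simp only [Q, h, dite_false]
      exact isPolyMap_comp _
  let S : Set X := {σ | (∀ i, pu σ ≠ B i) ∧ ∀ i, pv σ ≠ A i}
  let Dis : X → X → Prop := fun σ σ' => pu σ ≠ pu σ' ∧ pv σ ≠ pv σ'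
  have hAc : (Finset.univ.image A).card ≤ s := Finset.card_image_le.trans (by simp)
  have hBc : (Finset.univ.image B).card ≤ s := Finset.card_image_le.trans (by simp)
  have main := card_large_edgeCut_le (D := r + s) (a := 2) (R := r) (r := r) (t := 2 * s + 1)
    (by norm_num) (Dis := Dis) (by simp [b, mul_comm]) P Q hP hQ S (fun _ => False) ?_
  · simp only [Nat.card_eq_zero.2 (Or.inl (inferInstance : IsEmpty {w : PolyTuple F 2 b (r + s) //
      False})), zero_mul, add_zero] at main
    refine le_trans (Nat.mul_le_mul_right _ ?_) main
    refine Nat.card_le_card_of_injective (fun w => ⟨w.1, ?_⟩) ?_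
    · obtain ⟨w, u, v, h⟩ := w
      let σ : Fin (cutBound ((2 * s + 1) * 2) (2 * (r + s)) r + 1) → X := fun j i =>
        if i.1 = 0 then u j i.2 else v j i.2
      have hσu : ∀ j, pu (σ j) = u j := fun j => by ext k; simp [pu, σ]
      have hσv : ∀ j, pv (σ j) = v j := fun j => by ext k; simp [pv, σ]
      have hσ : Function.Injective σ := fun i j hij => h.inju (by rw [← hσu, ← hσu, hij])
      refine ⟨Finset.univ.image σ, ?_, ?_, ?_⟩
      · intro τ hτ
        simp only [Finset.coe_image, Finset.coe_univ, Set.image_univ, Set.mem_range] at hτ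
        obtain ⟨j, rfl⟩ := hτ
        refine ⟨⟨fun i => ?_, fun i => ?_⟩, fun e _ k => ?_⟩
        · rw [hσu]; exact h.uB j i
        · rw [hσv]; exact h.vA j i
        · simp only [P, Q, hσu, hσv]
          split_ifs
          · omega
          · exact h.adjB j _ k
          · exact h.adjA j _ k
          · exact h.adj j k
      · intro τ hτ τ' hτ' hne
        simp only [Finset.coe_image, Finset.coe_univ, Set.image_univ, Set.mem_range] at hτ hτ'
        obtain ⟨i, rfl⟩ := hτ
        obtain ⟨j, rfl⟩ := hτ'
        have hij : i ≠ j := fun h => hne (by rw [h])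
        simp only [Dis, hσu, hσv]
        exact ⟨h.inju.ne hij, h.injv.ne hij⟩
      · rw [Finset.card_image_of_injective _ hσ]
        simp
    · rintro ⟨x, _⟩ ⟨y, _⟩ h
      simpa using h
  · intro w _ e he Z hZ hZD hR
    obtain ⟨τ, hτi, hτ⟩ := exists_fin_embedding Z hR
    refine ⟨τ, hτ, ?_⟩
    have hdis : ∀ i j, i ≠ j → Dis (τ i) (τ j) := fun i j hij =>
      hZD (hτ i) (hτ j) (hτi.ne hij)
    have hS : ∀ j, τ j ∈ S := fun j => (hZ (hτ j)).1
    have hui : Function.Injective fun j => pu (τ j) := fun i j h => by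
      by_contra hij; exact (hdis i j hij).1 h
    have hvi : Function.Injective fun j => pv (τ j) := fun i j h => by
      by_contra hij; exact (hdis i j hij).2 h
    obtain ⟨L, hL, hL1, hL0, hLB⟩ := exists_separating (D := r + s) _ hui (Finset.univ.image B)
      (fun j => by simpa using fun i => ((hS j).1 i).symm) (by omega)
    obtain ⟨M, hM, hM1, hM0, hMA⟩ := exists_separating (D := r + s) _ hvi (Finset.univ.image A)
      (fun j => by simpa using fun i => ((hS j).2 i).symm) (by omega)
    have hLB' : ∀ j i, L j (B i) = 0 := fun j i => hLB j _ (by simp)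
    have hMA' : ∀ j i, M j (A i) = 0 := fun j i => hMA j _ (by simp)
    by_cases he1 : e < s
    · obtain ⟨l, hl, hl1, hl0⟩ := exists_separating_one (D := r + s) (A ⟨e, he1⟩)
        ((Finset.univ.erase ⟨e, he1⟩).image A) (by simp [hA.eq_iff])
        (Finset.card_image_le.trans (by simp; omega))
      have hPe : ∀ σ, P e σ = pu σ := fun σ => by simp [P, not_le.2 he1]
      have hQe : ∀ σ, Q e σ = A ⟨e, he1⟩ := fun σ => by simp [Q, he1]
      refine ⟨L, fun _ => l, hL, fun _ => hl, ?_, ?_, ?_⟩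
      · intro j; beta_reduce; rw [hPe, hQe, hL1, hl1, one_mul]
      · intro j j' h; rw [hPe, hL0 j j' h, zero_mul]
      · intro j e' he' σ _
        have : Q e' σ = A ⟨e', by omega⟩ := by simp [Q, show e' < s by omega]
        beta_reduce
        rw [this, hl0, mul_zero]
        exact Finset.mem_image_of_mem _ (by simp; omega)
    by_cases he2 : e < 2 * s
    · have hes : e - s < s := by omega
      obtain ⟨l, hl, hl1, hl0⟩ := exists_separating_one (D := r + s) (B ⟨e - s, hes⟩)
        ((Finset.univ.erase ⟨e - s, hes⟩).image B) (by simp [hB.eq_iff])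
        (Finset.card_image_le.trans (by simp; omega))
      have hPe : ∀ σ, P e σ = B ⟨e - s, hes⟩ := fun σ => by
        simp [P, not_lt.1 he1, he2]
      have hQe : ∀ σ, Q e σ = pv σ := fun σ => by simp [Q, he1]
      refine ⟨fun _ => l, M, fun _ => hl, hM, ?_, ?_, ?_⟩
      · intro j; beta_reduce; rw [hPe, hQe, hM1, hl1, one_mul]
      · intro j j' h; rw [hQe, hM0 j j' h, mul_zero]
      · intro j e' he' σ _
        by_cases he3 : e' < s
        · have : Q e' σ = A ⟨e', by omega⟩ := by simp [Q, he3]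
          rw [this, hMA', mul_zero]
        · have : P e' σ = B ⟨e' - s, by omega⟩ := by
            simp [P, not_lt.1 he3, he'.trans he2]
          beta_reduce
          rw [this, hl0, zero_mul]
          exact Finset.mem_image_of_mem _ (by simp; omega)
    · have hPe : ∀ σ, P e σ = pu σ := fun σ => by simp [P, he2]
      have hQe : ∀ σ, Q e σ = pv σ := fun σ => by simp [Q, he1]
      refine ⟨L, M, hL, hM, ?_, ?_, ?_⟩
      · intro j; rw [hPe, hQe, hM1, hL1, one_mul]
      · intro j j' h; rw [hPe, hL0 j j' h, zero_mul]
      · intro j e' he' σ _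
        by_cases he3 : e' < s
        · have : Q e' σ = A ⟨e', by omega⟩ := by simp [Q, he3]
          rw [this, hMA', mul_zero]
        · have : P e' σ = B ⟨e' - s, by omega⟩ := by
            simp [P, not_lt.1 he3, show e' < 2 * s by omega]
          rw [this, hLB', zero_mul]

end DoubleStar

theorem doubleStar_lower_bound {s : ℕ} (hs : 0 < s) : ∃ p, 0 < p ∧ ∃ c : ℝ, 0 < c ∧
    ∀ᶠ n : ℕ in atTop, c * (n : ℝ) ^ (2 - ((2 : ℕ) : ℝ) / ((2 * s + 1 : ℕ) : ℝ)) ≤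
      exNum n (doubleStar s p) := by
  set r := 2 + (2 * s + 1) * (2 * s) with hr
  set p := cutBound ((2 * s + 1) * 2) (2 * (r + s)) r + 1 with hp
  refine ⟨p, by omega, exists_lower_bound _ (doubleStar_exists_adj hs (by omega)) 2 (2 * s + 1)
    (r + s) (cutWeight ((2 * s + 1) * 2) (2 * (r + s))) (by omega) (by omega) ?_⟩
  intro F _ _
  have h := card_mul_le_of_forall_exists
    (fun w : PolyTuple F 2 (2 * s + 1) (r + s) => (polyGraph w).Contains (doubleStar s p))
    (fun (AB : (Fin s → Fin (2 * s + 1) → F) × (Fin s → Fin (2 * s + 1) → F)) w =>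
      ∃ u v, DoubleStarIn w AB.1 AB.2 p u v)
    (fun w hw => by
      obtain ⟨A, B, u, v, h⟩ := exists_doubleStarIn hs (by omega) hw
      exact ⟨(A, B), u, v, h⟩) _ _ (fun AB => card_doubleStarIn_le r AB.1 AB.2)
  have hI : Nat.card ((Fin s → Fin (2 * s + 1) → F) × (Fin s → Fin (2 * s + 1) → F)) =
      Nat.card F ^ ((2 * s + 1) * (2 * s)) := by
    rw [Nat.card_prod, Nat.card_fun, Nat.card_fun, Nat.card_fin, Nat.card_fin, ← pow_mul,
      ← pow_add]
    congr 1; ring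
  have hq : 0 < Nat.card F ^ ((2 * s + 1) * (2 * s)) := pow_pos Nat.card_pos _
  rw [hI, show r + 1 = (2 + 1) + (2 * s + 1) * (2 * s) by omega, pow_add, ← mul_assoc,
    mul_comm (Nat.card F ^ ((2 * s + 1) * (2 * s)))] at h
  exact Nat.le_of_mul_le_mul_right h hq

/-- `p` combs with three teeth sharing the end vertices of their teeth. The shared vertices are
`Sum.inl i`, and the spine of the `j`-th comb is `Sum.inr (0, j)`, `Sum.inr (1, j)`,
`Sum.inr (2, j)`. -/
def combPower (p : ℕ) : SimpleGraph (Fin 3 ⊕ Fin 3 × Fin p) where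
  Adj
    | Sum.inl i, Sum.inr (i', _) => i = i'
    | Sum.inr (i', _), Sum.inl i => i = i'
    | Sum.inr (i, j), Sum.inr (i', j') => j = j' ∧ (i = 1 ↔ i' ≠ 1)
    | Sum.inl _, Sum.inl _ => False
  symm := ⟨by
    rintro (i | ⟨i, j⟩) (i' | ⟨i', j'⟩) <;> simp
    intro h h'
    exact ⟨h.symm, by tauto⟩⟩
  loopless := ⟨by rintro (i | ⟨i, j⟩) <;> simp⟩

lemma combPower_colorable (p : ℕ) : (combPower p).Colorable 2 := by
  refine ⟨SimpleGraph.Coloring.mk (Sum.elim (fun i => if i = 1 then (1 : Fin 2) else 0)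
    (fun x => if x.1 = 1 then 0 else 1)) ?_⟩
  rintro (i | ⟨i, j⟩) (i' | ⟨i', j'⟩)
  · simp [combPower]
  · rintro (rfl : i = i')
    by_cases h : i = 1 <;> simp [h]
  · rintro (rfl : i' = i)
    by_cases h : i' = 1 <;> simp [h]
  · rintro ⟨-, h⟩
    by_cases h' : i = 1 <;> by_cases h'' : i' = 1 <;> simp_all

lemma combPower_exists_adj {p : ℕ} (hp : 0 < p) (v : Fin 3 ⊕ Fin 3 × Fin p) :
    ∃ u, (combPower p).Adj v u := by
  rcases v with i | ⟨i, j⟩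
  · exact ⟨Sum.inr (i, ⟨0, hp⟩), rfl⟩
  · exact ⟨Sum.inl i, rfl⟩

section Comb

variable {F : Type*} [Field F] {a b D : ℕ}

lemma swap_mem_biPoly {f : (Fin b → F) → (Fin b → F) → F} (hf : f ∈ biPoly F b D) :
    (fun x y => f y x) ∈ biPoly F b D := by
  induction hf using Submodule.span_induction with
  | mem f hf =>
    obtain ⟨g, hg, h, hh, rfl⟩ := hf
    exact Submodule.subset_span ⟨h, hh, g, hg, by ext; ring⟩
  | zero => exact Submodule.zero_mem _
  | add f g _ _ hf hg => exact Submodule.add_mem _ hf hg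
  | smul c f _ hf => exact Submodule.smul_mem _ c hf

/-- Exchange of the two sets of variables. -/
def swapTuple (w : PolyTuple F a b D) : PolyTuple F a b D :=
  fun k => ⟨fun x y => (w k).1 y x, swap_mem_biPoly (w k).2⟩

lemma swapTuple_injective : Function.Injective (swapTuple (F := F) (a := a) (b := b) (D := D)) := by
  intro w w' h
  funext k
  have := congrArg Subtype.val (congrFun h k)
  refine Subtype.ext ?_
  funext x y
  exact congrFun (congrFun this y) x

/-- A copy of the comb power in `polyGraph w`, in coordinates. -/
structure CombIn (w : PolyTuple F a b D) (α β γ : Fin b → F) (p : ℕ)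
    (x y z : Fin p → Fin b → F) : Prop where
  ne : α ≠ γ
  injx : Function.Injective x
  injy : Function.Injective y
  injz : Function.Injective z
  xβ : ∀ j, x j ≠ β
  zβ : ∀ j, z j ≠ β
  yα : ∀ j, y j ≠ α
  yγ : ∀ j, y j ≠ γ
  adjα : ∀ j k, (w k).1 α (x j) = 0
  adjγ : ∀ j k, (w k).1 γ (z j) = 0
  adjβ : ∀ j k, (w k).1 (y j) β = 0
  adjx : ∀ j k, (w k).1 (y j) (x j) = 0
  adjz : ∀ j k, (w k).1 (y j) (z j) = 0

lemma exists_combIn_of_hom {w : PolyTuple F a b D} {p : ℕ} (hp : 0 < p)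
    (f : combPower p →g polyGraph w) (hf : Function.Injective f)
    (hc : ∃ x, f (Sum.inr (1, ⟨0, hp⟩)) = Sum.inl x) :
    ∃ α β γ x y z, CombIn w α β γ p x y z := by
  have hadj : ∀ i j, (polyGraph w).Adj (f (Sum.inl i)) (f (Sum.inr (i, j))) := fun i j =>
    f.map_rel (show (combPower p).Adj (Sum.inl i) (Sum.inr (i, j)) from rfl)
  have hadj' : ∀ i j, i ≠ 1 → (polyGraph w).Adj (f (Sum.inr (1, j))) (f (Sum.inr (i, j))) :=
    fun i j hi => f.map_rel (show (combPower p).Adj (Sum.inr (1, j)) (Sum.inr (i, j)) from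
      ⟨rfl, by simpa using hi⟩)
  have hβ : ∃ y, f (Sum.inl 1) = Sum.inr y := by
    obtain ⟨x, hx⟩ := hc
    have := (hadj 1 ⟨0, hp⟩).symm
    rw [hx] at this
    exact polyGraph_adj_inl this
  obtain ⟨β, hβ⟩ := hβ
  have hy : ∀ j, ∃ y, f (Sum.inr (1, j)) = Sum.inl y := fun j => by
    have := hadj 1 j
    rw [hβ] at this
    exact polyGraph_adj_inr this
  choose y hy using hy
  have hx : ∀ i j, i ≠ 1 → ∃ x, f (Sum.inr (i, j)) = Sum.inr x := fun i j hi => by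
    have := hadj' i j hi
    rw [hy] at this
    exact polyGraph_adj_inl this
  have hα : ∀ i, i ≠ 1 → ∃ α, f (Sum.inl i) = Sum.inl α := fun i hi => by
    obtain ⟨x, hx⟩ := hx i ⟨0, hp⟩ hi
    have := (hadj i ⟨0, hp⟩).symm
    rw [hx] at this
    exact polyGraph_adj_inr this
  have hz := fun j => hx 2 j (by decide)
  have hx := fun j => hx 0 j (by decide)
  choose x hx using hx
  choose z hz using hz
  obtain ⟨γ, hγ⟩ := hα 2 (by decide)
  obtain ⟨α, hα⟩ := hα 0 (by decide)
  refine ⟨α, β, γ, x, y, z, ?_, ?_, ?_, ?_, ?_, ?_, ?_, ?_, ?_, ?_, ?_, ?_, ?_⟩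
  · intro h
    have := hf (hα.trans ((congrArg Sum.inl h).trans hγ.symm))
    simp at this
  · intro i j h
    have := hf ((hx i).trans ((congrArg Sum.inr h).trans (hx j).symm))
    simpa using this
  · intro i j h
    have := hf ((hy i).trans ((congrArg Sum.inl h).trans (hy j).symm))
    simpa using this
  · intro i j h
    have := hf ((hz i).trans ((congrArg Sum.inr h).trans (hz j).symm))
    simpa using this
  · intro i h
    have := hf ((hx i).trans ((congrArg Sum.inr h).trans hβ.symm))
    simp at this
  · intro i h
    have := hf ((hz i).trans ((congrArg Sum.inr h).trans hβ.symm))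
    simp at this
  · intro i h
    have := hf ((hy i).trans ((congrArg Sum.inl h).trans hα.symm))
    simp at this
  · intro i h
    have := hf ((hy i).trans ((congrArg Sum.inl h).trans hγ.symm))
    simp at this
  · intro j k
    have := hadj 0 j
    rw [hα, hx] at this
    exact this k
  · intro j k
    have := hadj 2 j
    rw [hγ, hz] at this
    exact this k
  · intro j k
    have := hadj 1 j
    rw [hβ, hy] at this
    exact this k
  · intro j k
    have := hadj' 0 j (by decide)
    rw [hy, hx] at this
    exact this k
  · intro j k
    have := hadj' 2 j (by decide)
    rw [hy, hz] at this
    exact this k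

lemma exists_combIn {w : PolyTuple F a b D} {p : ℕ} (hp : 0 < p)
    (h : (polyGraph w).Contains (combPower p)) :
    (∃ α β γ x y z, CombIn w α β γ p x y z) ∨
      ∃ α β γ x y z, CombIn (swapTuple w) α β γ p x y z := by
  obtain ⟨f, hf⟩ := h
  rcases h0 : f (Sum.inr (1, ⟨0, hp⟩)) with x | x
  · exact Or.inl (exists_combIn_of_hom hp f hf ⟨x, h0⟩)
  · right
    let g : polyGraph w →g polyGraph (swapTuple w) :=
      ⟨Sum.swap, by rintro (x | x) (y | y) h <;> exact h⟩
    refine exists_combIn_of_hom hp (g.comp f)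
      ((Sum.swap_leftInverse.injective : Function.Injective Sum.swap).comp hf) ⟨x, ?_⟩
    simp [g, h0]

/-- Two linear forms on `F ^ a` that are linearly independent, as witnessed by a dual pair. -/
def DualPair (μ₁ μ₂ : Fin a → F) : Prop :=
  ∃ ν₁ ν₂ : Fin a → F, ∑ k, μ₁ k * ν₁ k = 1 ∧ ∑ k, μ₁ k * ν₂ k = 0 ∧ ∑ k, μ₂ k * ν₂ k = 1

lemma exists_dualPair (t : Fin 3 → F) :
    ∃ μ₁ μ₂ : Fin 3 → F, DualPair μ₁ μ₂ ∧ ∑ k, μ₁ k * t k = 0 ∧ ∑ k, μ₂ k * t k = 0 := by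
  by_cases h0 : t 0 = 0
  · by_cases h1 : t 1 = 0
    · exact ⟨![1, 0, 0], ![0, 1, 0], ⟨![1, 0, 0], ![0, 1, 0], by simp [Fin.sum_univ_three]⟩,
        by simp [Fin.sum_univ_three, h0], by simp [Fin.sum_univ_three, h1]⟩
    · refine ⟨![1, 0, 0], ![0, -(t 2 / t 1), 1],
        ⟨![1, 0, 0], ![0, 0, 1], by simp [Fin.sum_univ_three]⟩,
        by simp [Fin.sum_univ_three, h0], ?_⟩
      simp [Fin.sum_univ_three, h0, h1]
  · refine ⟨![-(t 1 / t 0), 1, 0], ![-(t 2 / t 0), 0, 1],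
      ⟨![0, 1, 0], ![0, 0, 1], by simp [Fin.sum_univ_three]⟩, ?_, ?_⟩
    · simp [Fin.sum_univ_three, h0]
    · simp [Fin.sum_univ_three, h0]

variable [Finite F]

lemma card_degenerate_le {r : ℕ} (hD : r + 1 ≤ D) {α γ : Fin 5 → F} (h : α ≠ γ)
    {μ₁ μ₂ : Fin 3 → F} (hμ : DualPair μ₁ μ₂) :
    Nat.card {w : PolyTuple F 3 5 D // ∃ Z : Finset (Fin 5 → F), (∀ z ∈ Z,
      (∀ k, (w k).1 γ z = 0) ∧ ∑ k, μ₁ k * (w k).1 α z = 0 ∧ ∑ k, μ₂ k * (w k).1 α z = 0) ∧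
      cutBound 5 (2 * D) r < Z.card} * Nat.card F ^ (r + 1) ≤
    cutWeight 5 (2 * D) * Nat.card (PolyTuple F 3 5 D) := by
  classical
  obtain ⟨ν₁, ν₂, h11, h12, h22⟩ := hμ
  let c : ℕ → Fin 3 → F := fun i =>
    if i < 3 then Pi.single (Fin.ofNat 3 i) 1 else if i = 3 then μ₁ else μ₂
  let ν : ℕ → Fin 3 → F := fun i =>
    if i < 3 then Pi.single (Fin.ofNat 3 i) 1 else if i = 3 then ν₁ else ν₂
  let pt : ℕ → Fin 5 → F := fun i => if i < 3 then γ else α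
  let E : ℕ → PolyTuple F 3 5 D →+ ((Fin 5 → F) → F) := fun i =>
    evalStep D (c i) (fun _ => pt i) (fun σ => σ)
  have hcν : ∀ i, ∑ k, c i k * ν i k = 1 := by
    intro i
    simp only [c, ν]
    split_ifs
    · rw [Finset.sum_eq_single (Fin.ofNat 3 i)]
      · simp
      · intro k _ hk
        rw [Pi.single_eq_of_ne hk, zero_mul]
      · simp
    · exact h11
    · exact h22
  have main := card_large_cutSet_le (D := fun σ σ' => σ ≠ σ') (R := r) (r := r) (m := 2 * D)
    (N := 5) (by simp) E
    (fun i w => evalStep_mem _ (isPolyMap_const _) (isPolyMap_comp fun k => k) w) Set.univ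
    (fun _ => False) ?_
  · simp only [Nat.card_eq_zero.2 (Or.inl (inferInstance : IsEmpty {w : PolyTuple F 3 5 D //
      False})), zero_mul, add_zero] at main
    refine le_trans (Nat.mul_le_mul_right _ ?_) main
    refine Nat.card_le_card_of_injective (fun w => ⟨w.1, ?_⟩) ?_
    · obtain ⟨w, Z, hZ, hcard⟩ := w
      refine ⟨Z, fun z hz => ⟨trivial, fun i hi => ?_⟩, fun z _ z' _ hne => hne, hcard⟩
      obtain ⟨h1, h2, h3⟩ := hZ z hz
      simp only [E, evalStep_apply, c, pt]
      split_ifs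
      · exact Finset.sum_eq_zero fun k _ => by rw [h1, mul_zero]
      · exact h2
      · exact h3
    · rintro ⟨x, _⟩ ⟨y, _⟩ h
      simpa using h
  · intro w _ i hi
    refine spreads_of_tensorSpread (c i) _ _ _ (ν i) (hcν i)
      (fun L _ => 3 ≤ i → L γ = 0) ?_ ?_
    · intro L M hL hM hV g i' hi' σ _
      rw [evalStep_tensorTuple]
      by_cases h3 : 3 ≤ i
      · by_cases h3' : i' < 3
        · have h0 : ∑ j, g j * (L j (pt i') * M j σ) = 0 := Finset.sum_eq_zero fun j _ => by
            simp only [pt, h3', if_true, hV j h3]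
            ring
          rw [h0, mul_zero]
        · obtain rfl : i' = 3 := by omega
          obtain rfl : i = 4 := by omega
          have h0 : ∑ k, c 3 k * ν 4 k = 0 := by simpa [c, ν] using h12
          rw [h0, zero_mul]
      · have h0 : ∑ k, c i' k * ν i k = 0 := by
          refine Finset.sum_eq_zero fun k _ => ?_
          simp only [c, ν, show i' < 3 by omega, show i < 3 by omega, if_true]
          by_cases hk : k = Fin.ofNat 3 i'
          · have hne : k ≠ Fin.ofNat 3 i := by
              rw [hk]
              intro hcon
              have := congrArg Fin.val hcon
              simp only [Fin.ofNat] at this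
              omega
            rw [Pi.single_eq_of_ne hne, mul_zero]
          · rw [Pi.single_eq_of_ne hk, zero_mul]
        rw [h0, zero_mul]
    · intro Z _ _ hR
      obtain ⟨τ, hτi, hτ⟩ := exists_fin_embedding Z hR
      obtain ⟨M, hM, hM1, hM0, -⟩ := exists_separating (D := D) τ hτi ∅ (by simp)
        (by simp; omega)
      obtain ⟨l, hl, hl1, hl0⟩ : ∃ l ∈ polyFun F (Fin 5) D, l (pt i) = 1 ∧ (3 ≤ i → l γ = 0) := by
        by_cases h3 : 3 ≤ i
        · obtain ⟨l, hl, hl1, hl0⟩ := exists_separating_one (D := D) α {γ} (by simpa using h)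
            (by simp; omega)
          refine ⟨l, hl, ?_, fun _ => hl0 _ (by simp)⟩
          simpa [pt, not_lt.2 h3] using hl1
        · exact ⟨fun _ => 1, const_mem_polyFun _ _, rfl, fun h => absurd h h3⟩
      refine ⟨τ, hτ, fun _ => l, M, fun _ => hl, hM, ?_, ?_, fun _ => hl0⟩
      · intro j; beta_reduce; rw [hl1, hM1, one_mul]
      · intro j j' hj; rw [hM0 j j' hj, mul_zero]

/-- For some `μ₁`, `μ₂` there are many neighbours `z` of `γ` at which both `∑ k, μ₁ k * w k α z`
and `∑ k, μ₂ k * w k α z` vanish. -/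
def Degenerate (r : ℕ) (α γ : Fin 5 → F) (w : PolyTuple F 3 5 D) : Prop :=
  ∃ μ₁ μ₂ : Fin 3 → F, DualPair μ₁ μ₂ ∧ ∃ Z : Finset (Fin 5 → F), (∀ z ∈ Z,
    (∀ k, (w k).1 γ z = 0) ∧ ∑ k, μ₁ k * (w k).1 α z = 0 ∧ ∑ k, μ₂ k * (w k).1 α z = 0) ∧
    cutBound 5 (2 * D) (r + 6) < Z.card

lemma card_degenerate_mul_le {r : ℕ} (hD : r + 7 ≤ D) {α γ : Fin 5 → F} (h : α ≠ γ) :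
    Nat.card {w : PolyTuple F 3 5 D // Degenerate r α γ w} * Nat.card F ^ (r + 1) ≤
      cutWeight 5 (2 * D) * Nat.card (PolyTuple F 3 5 D) := by
  have key := card_mul_le_of_forall_exists (I := (Fin 3 → F) × (Fin 3 → F))
    (fun w : PolyTuple F 3 5 D => Degenerate r α γ w)
    (fun μ w => DualPair μ.1 μ.2 ∧ ∃ Z : Finset (Fin 5 → F), (∀ z ∈ Z,
      (∀ k, (w k).1 γ z = 0) ∧ ∑ k, μ.1 k * (w k).1 α z = 0 ∧
      ∑ k, μ.2 k * (w k).1 α z = 0) ∧ cutBound 5 (2 * D) (r + 6) < Z.card)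
    (fun w ⟨μ₁, μ₂, hμ⟩ => ⟨(μ₁, μ₂), hμ⟩) (Nat.card F ^ (r + 6 + 1))
    (cutWeight 5 (2 * D) * Nat.card (PolyTuple F 3 5 D)) (fun μ => by
      by_cases hμ : DualPair μ.1 μ.2
      · simp only [hμ, true_and]
        exact card_degenerate_le (r := r + 6) (by omega) h hμ
      · simp [hμ])
  have hI : Nat.card ((Fin 3 → F) × (Fin 3 → F)) = Nat.card F ^ 6 := by
    rw [Nat.card_prod, Nat.card_fun, Nat.card_fin, ← pow_add]
  have hq : 0 < Nat.card F ^ 6 := pow_pos Nat.card_pos _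
  rw [hI, show r + 6 + 1 = (r + 1) + 6 by omega, pow_add, ← mul_assoc,
    mul_comm (Nat.card F ^ 6)] at key
  exact Nat.le_of_mul_le_mul_right key hq

lemma card_combIn_le (r : ℕ) {R : ℕ} (hR : R = r + cutBound 5 (2 * (r + 8)) (r + 6))
    (α β γ : Fin 5 → F) :
    Nat.card {w : PolyTuple F 3 5 (r + 8) // ∃ x y z,
      CombIn w α β γ (cutBound (5 * 3) (2 * (r + 8)) R + 1) x y z} * Nat.card F ^ (r + 1) ≤
      (cutWeight (5 * 3) (2 * (r + 8)) + cutWeight 5 (2 * (r + 8))) *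
        Nat.card (PolyTuple F 3 5 (r + 8)) := by
  classical
  by_cases hαγ : α = γ
  · have : IsEmpty {w : PolyTuple F 3 5 (r + 8) // ∃ x y z,
        CombIn w α β γ (cutBound (5 * 3) (2 * (r + 8)) R + 1) x y z} :=
      ⟨fun ⟨w, x, y, z, h⟩ => h.ne hαγ⟩
    simp
  let X := Fin 3 × Fin 5 → F
  let px : X → Fin 5 → F := fun σ k => σ (0, k)
  let py : X → Fin 5 → F := fun σ k => σ (1, k)
  let pz : X → Fin 5 → F := fun σ k => σ (2, k)
  let P : ℕ → X → Fin 5 → F := fun e σ =>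
    if e = 0 then α else if e = 1 then γ else py σ
  let Q : ℕ → X → Fin 5 → F := fun e σ =>
    if e = 0 then px σ else if e = 1 then pz σ else if e = 2 then β else
    if e = 3 then px σ else pz σ
  have hP : ∀ e, IsPolyMap (P e) := by
    intro e
    simp only [P]
    split_ifs
    · exact isPolyMap_const _
    · exact isPolyMap_const _
    · exact isPolyMap_comp _
  have hQ : ∀ e, IsPolyMap (Q e) := by
    intro e
    simp only [Q]
    split_ifs
    · exact isPolyMap_comp _
    · exact isPolyMap_comp _
    · exact isPolyMap_const _
    · exact isPolyMap_comp _
    · exact isPolyMap_comp _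
  let S : Set X := {σ | px σ ≠ β ∧ pz σ ≠ β ∧ py σ ≠ α ∧ py σ ≠ γ}
  let Dis : X → X → Prop := fun σ σ' => px σ ≠ px σ' ∧ py σ ≠ py σ' ∧ pz σ ≠ pz σ'
  have main := card_large_edgeCut_le (D := r + 8) (a := 3) (R := R) (r := r) (t := 5)
    (by norm_num) (Dis := Dis) (by simp) P Q hP hQ S (Degenerate r α γ) ?_
  · rw [add_mul]
    refine le_trans (Nat.mul_le_mul_right _ ?_) (main.trans
      (Nat.add_le_add_left (card_degenerate_mul_le (by omega) hαγ) _))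
    refine Nat.card_le_card_of_injective (fun w => ⟨w.1, ?_⟩) ?_
    · obtain ⟨w, x, y, z, h⟩ := w
      let σ : Fin (cutBound (5 * 3) (2 * (r + 8)) R + 1) → X := fun j i =>
        if i.1 = 0 then x j i.2 else if i.1 = 1 then y j i.2 else z j i.2
      have hσx : ∀ j, px (σ j) = x j := fun j => by ext k; simp [px, σ]
      have hσy : ∀ j, py (σ j) = y j := fun j => by ext k; simp [py, σ]
      have hσz : ∀ j, pz (σ j) = z j := fun j => by ext k; simp [pz, σ]
      have hσ : Function.Injective σ := fun i j hij => h.injx (by rw [← hσx, ← hσx, hij])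
      refine ⟨Finset.univ.image σ, ?_, ?_, ?_⟩
      · intro τ hτ
        simp only [Finset.coe_image, Finset.coe_univ, Set.image_univ, Set.mem_range] at hτ
        obtain ⟨j, rfl⟩ := hτ
        refine ⟨⟨?_, ?_, ?_, ?_⟩, fun e _ k => ?_⟩
        · rw [hσx]; exact h.xβ j
        · rw [hσz]; exact h.zβ j
        · rw [hσy]; exact h.yα j
        · rw [hσy]; exact h.yγ j
        · simp only [P, Q, hσx, hσy, hσz]
          split_ifs
          · exact h.adjα j k
          · exact h.adjγ j k
          · exact h.adjβ j k
          · exact h.adjx j k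
          · exact h.adjz j k
      · intro τ hτ τ' hτ' hne
        simp only [Finset.coe_image, Finset.coe_univ, Set.image_univ, Set.mem_range] at hτ hτ'
        obtain ⟨i, rfl⟩ := hτ
        obtain ⟨j, rfl⟩ := hτ'
        have hij : i ≠ j := fun h => hne (by rw [h])
        simp only [Dis, hσx, hσy, hσz]
        exact ⟨h.injx.ne hij, h.injy.ne hij, h.injz.ne hij⟩
      · rw [Finset.card_image_of_injective _ hσ]
        simp
    · rintro ⟨x, _⟩ ⟨y, _⟩ h
      simpa using h
  · intro w hw e he Z hZ hZD hRZ
    have hS : ∀ σ ∈ Z, σ ∈ S := fun σ hσ => (hZ hσ).1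
    have hxi : Set.InjOn px Z := fun σ hσ σ' hσ' h => by
      by_contra hne; exact (hZD hσ hσ' hne).1 h
    have hyi : Set.InjOn py Z := fun σ hσ σ' hσ' h => by
      by_contra hne; exact (hZD hσ hσ' hne).2.1 h
    have hzi : Set.InjOn pz Z := fun σ hσ σ' hσ' h => by
      by_contra hne; exact (hZD hσ hσ' hne).2.2 h
    by_cases he4 : e = 4
    · subst he4
      obtain ⟨μ₁, μ₂, hμ, hμ₁, hμ₂⟩ := exists_dualPair fun k => (w k).1 α β
      let φ : (Fin 3 → F) → (Fin 5 → F) → F := fun μ z => ∑ k, μ k * (w k).1 α z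
      have hφ : ∀ μ, φ μ ∈ polyFun F (Fin 5) (r + 8) := fun μ => by
        have : φ μ = ∑ k, μ k • (w k).1 α := by
          ext z; simp [φ, Finset.sum_apply]
        rw [this]
        exact Submodule.sum_mem _ fun k _ => Submodule.smul_mem _ _ (biPoly_apply_mem (w k).2 α)
      let B : Finset X := Z.filter fun σ => φ μ₁ (pz σ) = 0 ∧ φ μ₂ (pz σ) = 0
      have hBZ : B ⊆ Z := Finset.filter_subset _ _
      have hY : r < (Z \ B).card := by
        have hsplit := Finset.card_sdiff_add_card_eq_card hBZ
        have hle : B.card ≤ cutBound 5 (2 * (r + 8)) (r + 6) := by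
          by_contra! hlt
          refine hw ⟨μ₁, μ₂, hμ, B.image pz, ?_, ?_⟩
          · intro z hz
            obtain ⟨σ, hσ, rfl⟩ := Finset.mem_image.1 hz
            obtain ⟨hσZ, h1, h2⟩ := Finset.mem_filter.1 hσ
            exact ⟨fun k => by simpa [P, Q] using (hZ hσZ).2 1 (by norm_num) k, h1, h2⟩
          · rwa [Finset.card_image_of_injOn (hzi.mono (by exact_mod_cast hBZ))]
        omega
      obtain ⟨τ, hτi, hτY⟩ := exists_fin_embedding (Z \ B) hY
      have hτ : ∀ j, τ j ∈ Z := fun j => (Finset.mem_sdiff.1 (hτY j)).1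
      have hex : ∀ j, ∃ μ, φ μ β = 0 ∧ φ μ (pz (τ j)) ≠ 0 := fun j => by
        have := (Finset.mem_sdiff.1 (hτY j)).2
        by_cases h1 : φ μ₁ (pz (τ j)) = 0
        · exact ⟨μ₂, hμ₂, fun h2 => this (Finset.mem_filter.2 ⟨hτ j, h1, h2⟩)⟩
        · exact ⟨μ₁, hμ₁, h1⟩
      choose μ hμβ hμz using hex
      obtain ⟨L, hL, hL1, hL0, hLZ⟩ := exists_separating (D := r + 8) (fun j => py (τ j))
        (fun i j h => hτi (hyi (hτ i) (hτ j) h)) {α, γ}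
        (fun j => by simpa using ⟨(hS _ (hτ j)).2.2.1, (hS _ (hτ j)).2.2.2⟩)
        (by have := Finset.card_le_two (a := α) (b := γ); omega)
      refine ⟨τ, hτ, L, fun j => (φ (μ j) (pz (τ j)))⁻¹ • φ (μ j), hL,
        fun j => Submodule.smul_mem _ _ (hφ _), ?_, ?_, ?_⟩
      · intro j
        have h1 : P 4 (τ j) = py (τ j) := rfl
        have h2 : Q 4 (τ j) = pz (τ j) := rfl
        beta_reduce
        rw [h1, h2, hL1, Pi.smul_apply, smul_eq_mul, inv_mul_cancel₀ (hμz j), one_mul]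
      · intro j j' h
        have h1 : P 4 (τ j') = py (τ j') := rfl
        rw [h1, hL0 j j' h, zero_mul]
      · intro j e' he' σ hσ
        beta_reduce
        rw [Pi.smul_apply, smul_eq_mul]
        interval_cases e'
        · rw [show P 0 σ = α from rfl, hLZ j α (by simp), zero_mul]
        · rw [show P 1 σ = γ from rfl, hLZ j γ (by simp), zero_mul]
        · rw [show Q 2 σ = β from rfl, hμβ, mul_zero, mul_zero]
        · have : φ (μ j) (Q 3 σ) = 0 := Finset.sum_eq_zero fun k _ => by
            have : (w k).1 α (Q 3 σ) = 0 := hσ.2 0 (by norm_num) k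
            rw [this, mul_zero]
          rw [this, mul_zero, mul_zero]
    obtain ⟨τ, hτi, hτ⟩ := exists_fin_embedding (p := r + 1) Z (by omega)
    refine ⟨τ, hτ, ?_⟩
    have hpx : Function.Injective fun j => px (τ j) := fun i j h => hτi (hxi (hτ i) (hτ j) h)
    have hpy : Function.Injective fun j => py (τ j) := fun i j h => hτi (hyi (hτ i) (hτ j) h)
    have hpz : Function.Injective fun j => pz (τ j) := fun i j h => hτi (hzi (hτ i) (hτ j) h)
    obtain ⟨L, hL, hL1, hL0, hLZ⟩ := exists_separating (D := r + 8) _ hpy {α, γ}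
      (fun j => by simpa using ⟨(hS _ (hτ j)).2.2.1, (hS _ (hτ j)).2.2.2⟩)
      (by have := Finset.card_le_two (a := α) (b := γ); omega)
    obtain ⟨M, hM, hM1, hM0, hMβ⟩ := exists_separating (D := r + 8) _ hpx {β}
      (fun j => by simpa using (hS _ (hτ j)).1) (by simp)
    obtain ⟨N, hN, hN1, hN0, -⟩ := exists_separating (D := r + 8) _ hpz ∅ (by simp) (by simp)
    have hLα : ∀ j, L j α = 0 := fun j => hLZ j α (by simp)
    have hLγ : ∀ j, L j γ = 0 := fun j => hLZ j γ (by simp)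
    have he : e < 4 := by omega
    interval_cases e
    · refine ⟨fun _ _ => 1, M, fun _ => const_mem_polyFun _ _, hM, ?_, ?_, ?_⟩
      · intro j; rw [show Q 0 (τ j) = px (τ j) from rfl, hM1, one_mul]
      · intro j j' h; rw [show Q 0 (τ j') = px (τ j') from rfl, hM0 j j' h, mul_zero]
      · intro j e' he'; omega
    · obtain ⟨l, hl, hl1, hl0⟩ := exists_separating_one (D := r + 8) γ {α}
        (by simpa using Ne.symm hαγ) (by simp)
      refine ⟨fun _ => l, N, fun _ => hl, hN, ?_, ?_, ?_⟩
      · intro j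
        beta_reduce
        rw [show P 1 (τ j) = γ from rfl, show Q 1 (τ j) = pz (τ j) from rfl, hN1, hl1, one_mul]
      · intro j j' h; rw [show Q 1 (τ j') = pz (τ j') from rfl, hN0 j j' h, mul_zero]
      · intro j e' he' σ _
        obtain rfl : e' = 0 := by omega
        beta_reduce
        rw [show P 0 σ = α from rfl, hl0 α (by simp), zero_mul]
    · refine ⟨L, fun _ _ => 1, hL, fun _ => const_mem_polyFun _ _, ?_, ?_, ?_⟩
      · intro j; rw [show P 2 (τ j) = py (τ j) from rfl, hL1, one_mul]
      · intro j j' h; rw [show P 2 (τ j') = py (τ j') from rfl, hL0 j j' h, zero_mul]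
      · intro j e' he' σ _
        interval_cases e'
        · rw [show P 0 σ = α from rfl, hLα, zero_mul]
        · rw [show P 1 σ = γ from rfl, hLγ, zero_mul]
    · refine ⟨L, M, hL, hM, ?_, ?_, ?_⟩
      · intro j
        rw [show P 3 (τ j) = py (τ j) from rfl, show Q 3 (τ j) = px (τ j) from rfl, hL1, hM1,
          one_mul]
      · intro j j' h; rw [show P 3 (τ j') = py (τ j') from rfl, hL0 j j' h, zero_mul]
      · intro j e' he' σ _
        interval_cases e'
        · rw [show P 0 σ = α from rfl, hLα, zero_mul]
        · rw [show P 1 σ = γ from rfl, hLγ, zero_mul]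
        · rw [show Q 2 σ = β from rfl, hMβ j β (by simp), mul_zero]

end Comb

theorem combPower_lower_bound : ∃ p, 0 < p ∧ ∃ c : ℝ, 0 < c ∧
    ∀ᶠ n : ℕ in atTop, c * (n : ℝ) ^ (2 - ((3 : ℕ) : ℝ) / ((5 : ℕ) : ℝ)) ≤
      exNum n (combPower p) := by
  obtain ⟨r, hr⟩ : ∃ r, r = 18 := ⟨_, rfl⟩
  obtain ⟨R, hR⟩ : ∃ R, R = r + cutBound 5 (2 * (r + 8)) (r + 6) := ⟨_, rfl⟩
  obtain ⟨p, hp⟩ : ∃ p, p = cutBound (5 * 3) (2 * (r + 8)) R + 1 := ⟨_, rfl⟩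
  obtain ⟨C, hC⟩ : ∃ C, C = cutWeight (5 * 3) (2 * (r + 8)) + cutWeight 5 (2 * (r + 8)) :=
    ⟨_, rfl⟩
  refine ⟨p, by omega, exists_lower_bound _ (combPower_exists_adj (by omega)) 3 5
    (r + 8) (2 * C) (by omega) (by omega) ?_⟩
  intro F _ _
  have h := card_mul_le_of_forall_exists
    (I := Bool × (Fin 5 → F) × (Fin 5 → F) × (Fin 5 → F))
    (fun w : PolyTuple F 3 5 (r + 8) => (polyGraph w).Contains (combPower p))
    (fun i w => ∃ x y z,
      CombIn (if i.1 then swapTuple w else w) i.2.1 i.2.2.1 i.2.2.2 p x y z)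
    (fun w hw => by
      rcases exists_combIn (by omega) hw with ⟨α, β, γ, x, y, z, h⟩ | ⟨α, β, γ, x, y, z, h⟩
      · exact ⟨(false, α, β, γ), x, y, z, by simpa using h⟩
      · exact ⟨(true, α, β, γ), x, y, z, by simpa using h⟩)
    (Nat.card F ^ (r + 1)) (C * Nat.card (PolyTuple F 3 5 (r + 8))) (by
      rintro ⟨i, α, β, γ⟩
      have hle := card_combIn_le r hR α β γ
      rw [← hp, ← hC] at hle
      cases i
      · simpa using hle
      · refine le_trans (Nat.mul_le_mul_right _ ?_) hle
        refine Nat.card_le_card_of_injective (fun w => ⟨swapTuple w.1, by simpa using w.2⟩) ?_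
        rintro ⟨x, _⟩ ⟨y, _⟩ h
        exact Subtype.ext (swapTuple_injective (Subtype.mk.inj h)))
  have hI : Nat.card (Bool × (Fin 5 → F) × (Fin 5 → F) × (Fin 5 → F)) =
      2 * Nat.card F ^ 15 := by
    simp only [Nat.card_prod, Nat.card_fun, Nat.card_fin, Nat.card_eq_fintype_card (α := Bool),
      Fintype.card_bool, ← pow_add]
  have hq : 0 < Nat.card F ^ 15 := pow_pos Nat.card_pos _
  rw [hI, show r + 1 = (3 + 1) + 15 by omega, pow_add, ← mul_assoc, mul_comm 2, mul_assoc _ 2,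
    ← mul_assoc 2, mul_comm (Nat.card F ^ 15)] at h
  exact Nat.le_of_mul_le_mul_right h hq

section Regularize

variable {V : Type*} (G : SimpleGraph V) [DecidableRel G.Adj]

lemma card_interedges_self (S : Finset V) :
    (G.interedges S S).card = ∑ v ∈ S, (S.filter (G.Adj v)).card := by
  rw [SimpleGraph.interedges, Rel.interedges, Finset.card_filter, Finset.sum_product]
  exact Finset.sum_congr rfl fun v _ => (Finset.card_filter _ _).symm

variable [DecidableEq V]

lemma card_interedges_self_erase {S : Finset V} {v : V} (hv : v ∈ S) :
    (G.interedges S S).card ≤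
      (G.interedges (S.erase v) (S.erase v)).card + 2 * (S.filter (G.Adj v)).card := by
  have : G.interedges S S ⊆ G.interedges (S.erase v) (S.erase v) ∪
      ((S.filter (G.Adj v)).image (fun u => (v, u)) ∪
        (S.filter (G.Adj v)).image (fun u => (u, v))) := by
    rintro ⟨x, y⟩ h
    rw [SimpleGraph.mem_interedges_iff] at h
    obtain ⟨hx, hy, hxy⟩ := h
    by_cases h1 : x = v
    · subst h1
      simp [hy, hxy]
    · by_cases h2 : y = v
      · subst h2
        simp [hx, hxy.symm]
      · simp [SimpleGraph.mem_interedges_iff, h1, h2, hx, hy, hxy]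
  refine (Finset.card_le_card this).trans ((Finset.card_union_le _ _).trans ?_)
  refine Nat.add_le_add_left ((Finset.card_union_le _ _).trans ?_) _
  have h1 := Finset.card_image_le (s := S.filter (G.Adj v)) (f := fun u => (v, u))
  have h2 := Finset.card_image_le (s := S.filter (G.Adj v)) (f := fun u => (u, v))
  omega

lemma card_interedges_self_le (S B : Finset V) (P : Finpartition S) :
    (G.interedges S S).card ≤ (G.interedges (S \ B) (S \ B)).card +
      ∑ T ∈ P.parts, (G.interedges (B ∪ T) (B ∪ T)).card := by
  have : G.interedges S S ⊆ G.interedges (S \ B) (S \ B) ∪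
      P.parts.biUnion fun T => G.interedges (B ∪ T) (B ∪ T) := by
    rintro ⟨x, y⟩ h
    rw [SimpleGraph.mem_interedges_iff] at h
    obtain ⟨hx, hy, hxy⟩ := h
    rw [Finset.mem_union, Finset.mem_biUnion]
    by_cases h1 : x ∈ B
    · obtain ⟨T, hT, hyT⟩ := P.exists_mem hy
      exact Or.inr ⟨T, hT, by simp [SimpleGraph.mem_interedges_iff, h1, hyT, hxy]⟩
    · by_cases h2 : y ∈ B
      · obtain ⟨T, hT, hxT⟩ := P.exists_mem hx
        exact Or.inr ⟨T, hT, by simp [SimpleGraph.mem_interedges_iff, h2, hxT, hxy]⟩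
      · exact Or.inl (by simp [SimpleGraph.mem_interedges_iff, h1, h2, hx, hy, hxy])
  exact (Finset.card_le_card this).trans ((Finset.card_union_le _ _).trans
    (Nat.add_le_add_left Finset.card_biUnion_le _))

/-- A graph with many edges has a nonempty almost regular induced subgraph. -/
lemma exists_almost_regular_subset [Fintype V] {ε : ℝ} (hε : 0 < ε) {l : ℕ} (hl : 0 < l)
    (hlε : 4 * 3 ^ (1 + ε) ≤ (l : ℝ) ^ ε) {c : ℝ} (hc : (l : ℝ) ≤ c)
    (hG : c * (Fintype.card V : ℝ) ^ (1 + ε) < (G.interedges Finset.univ Finset.univ).card) :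
    ∃ S : Finset V, S.Nonempty ∧ ∃ δ : ℝ, c / 4 * (S.card : ℝ) ^ ε ≤ δ ∧
      ∀ v ∈ S, δ ≤ (S.filter (G.Adj v)).card ∧ ((S.filter (G.Adj v)).card : ℝ) ≤ 4 * l * δ := by
  have hl' : (1 : ℝ) ≤ l := by exact_mod_cast hl
  have hc0 : 0 < c := by linarith
  let e : Finset V → ℝ := fun S => (G.interedges S S).card
  obtain ⟨S, -, hS⟩ := Finset.exists_max_image (Finset.univ : Finset (Finset V))
    (fun S => e S / (S.card : ℝ) ^ (1 + ε)) Finset.univ_nonempty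
  obtain ⟨φ, hφ⟩ : ∃ φ, φ = e S / (S.card : ℝ) ^ (1 + ε) := ⟨_, rfl⟩
  rw [← hφ] at hS
  have he0 : e ∅ = 0 := by simp [e]
  have hφc : c < φ := by
    have hne : 0 < Fintype.card V := by
      rw [Nat.pos_iff_ne_zero]
      intro h0
      have : (Finset.univ : Finset V) = ∅ := by simpa [← Finset.card_eq_zero] using h0
      rw [this, h0] at hG
      simp [Real.zero_rpow (by linarith : 1 + ε ≠ 0)] at hG
    have hpos : 0 < (Fintype.card V : ℝ) ^ (1 + ε) := Real.rpow_pos_of_pos (by exact_mod_cast hne) _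
    refine lt_of_lt_of_le ?_ (hS Finset.univ (Finset.mem_univ _))
    rw [lt_div_iff₀ (by simpa using hpos)]
    simpa using hG
  have hφ0 : 0 < φ := hc0.trans hφc
  have hSne : S.Nonempty := by
    rw [Finset.nonempty_iff_ne_empty]
    rintro rfl
    rw [he0, zero_div] at hφ
    linarith
  have hm0 : (0 : ℝ) < S.card := by exact_mod_cast hSne.card_pos
  obtain ⟨m, hm⟩ : ∃ m : ℝ, m = S.card := ⟨_, rfl⟩
  rw [← hm] at hφ hm0
  have hm1 : 1 ≤ m := by rw [hm]; exact_mod_cast hSne.card_pos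
  have hE : e S = φ * m ^ (1 + ε) := by
    rw [hφ, div_mul_cancel₀ _ (Real.rpow_pos_of_pos hm0 _).ne']
  have hT : ∀ T : Finset V, e T ≤ φ * (T.card : ℝ) ^ (1 + ε) := by
    intro T
    rcases T.eq_empty_or_nonempty with rfl | hT
    · rw [he0]
      exact mul_nonneg hφ0.le (Real.rpow_nonneg (Nat.cast_nonneg _) _)
    · have := hS T (Finset.mem_univ _)
      rwa [div_le_iff₀ (Real.rpow_pos_of_pos (by exact_mod_cast hT.card_pos) _)] at this
  have hE0 : 0 < e S := by
    rw [hE]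
    exact mul_pos hφ0 (Real.rpow_pos_of_pos hm0 _)
  have hlm : (l : ℝ) ≤ m := by
    have h1 : e S ≤ m * m := by
      have : (G.interedges S S).card ≤ S.card * S.card := G.card_interedges_le_mul S S
      simp only [e, hm]
      exact_mod_cast this
    have h2 : m ≤ m ^ (1 + ε) := by
      simpa using Real.rpow_le_rpow_of_exponent_le hm1 (by linarith : (1 : ℝ) ≤ 1 + ε)
    rw [hE] at h1
    have h3 : φ * m ≤ m * m := (mul_le_mul_of_nonneg_left h2 hφ0.le).trans h1
    have := le_of_mul_le_mul_right h3 hm0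
    linarith
  have hsum : e S = ∑ v ∈ S, ((S.filter (G.Adj v)).card : ℝ) := by
    simp only [e, card_interedges_self]
    push_cast
    rfl
  let B : Finset V := S.filter fun v => l * e S / m < (S.filter (G.Adj v)).card
  have hB : (B.card : ℝ) ≤ m / l := by
    have h1 : (B.card : ℝ) * (l * e S / m) ≤ e S := by
      rw [hsum, ← nsmul_eq_mul]
      refine (Finset.card_nsmul_le_sum B _ _ fun v hv => ?_).trans
        (Finset.sum_le_sum_of_subset_of_nonneg (Finset.filter_subset _ _)
          fun _ _ _ => Nat.cast_nonneg _)
      rw [← hsum]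
      exact (Finset.mem_filter.1 hv).2.le
    rw [le_div_iff₀ (by linarith)]
    have h2 : (B.card : ℝ) * (l * e S / m) = (B.card * l / m) * e S := by ring
    rw [h2] at h1
    have := le_of_mul_le_mul_right (h1.trans_eq (one_mul _).symm) hE0
    rwa [div_le_one hm0] at this
  obtain ⟨P, hPe, hPc⟩ := Finpartition.exists_equipartition_card_eq S hl.ne'
    (by rw [hm] at hlm; exact_mod_cast hlm)
  have hpart : ∑ T ∈ P.parts, e (B ∪ T) ≤ e S / 4 := by
    have h1 : ∀ T ∈ P.parts, e (B ∪ T) ≤ φ * (3 * m / l) ^ (1 + ε) := by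
      intro T hTP
      refine (hT _).trans (mul_le_mul_of_nonneg_left
        (Real.rpow_le_rpow (Nat.cast_nonneg _) ?_ (by linarith)) hφ0.le)
      have h2 : (T.card : ℝ) ≤ m / l + 1 := by
        have h3 := hPe.card_part_le_average_add_one hTP
        rw [hPc] at h3
        have h4 : ((S.card / l : ℕ) : ℝ) ≤ m / l := hm ▸ Nat.cast_div_le
        have h5 : (T.card : ℝ) ≤ ((S.card / l : ℕ) : ℝ) + 1 := by exact_mod_cast h3
        linarith
      have h3 : 1 ≤ m / l := by rwa [le_div_iff₀ (by linarith), one_mul]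
      have h4 : ((B ∪ T).card : ℝ) ≤ B.card + T.card := by
        exact_mod_cast Finset.card_union_le B T
      have h5 : 3 * m / l = 3 * (m / l) := by ring
      linarith
    refine (Finset.sum_le_card_nsmul _ _ _ h1).trans ?_
    rw [hPc, nsmul_eq_mul, hE, mul_div_assoc 3 m, Real.mul_rpow (by norm_num) (by positivity),
      Real.div_rpow hm0.le (by linarith), Real.rpow_add (by linarith : (0 : ℝ) < l),
      Real.rpow_one]
    have hlε0 : 0 < (l : ℝ) ^ ε := by positivity
    have hmε0 : 0 < m ^ (1 + ε) := by positivity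
    have : (l : ℝ) * (φ * (3 ^ (1 + ε) * (m ^ (1 + ε) / (l * (l : ℝ) ^ ε)))) =
        φ * m ^ (1 + ε) * (3 ^ (1 + ε) / (l : ℝ) ^ ε) := by
      field_simp
    rw [this, div_eq_mul_one_div (φ * m ^ (1 + ε)) 4]
    refine mul_le_mul_of_nonneg_left ?_ (by positivity)
    rw [div_le_div_iff₀ hlε0 (by norm_num)]
    linarith
  have hSB : 3 / 4 * e S ≤ e (S \ B) := by
    have h := card_interedges_self_le G S B P
    have h' : e S ≤ e (S \ B) + ∑ T ∈ P.parts, e (B ∪ T) := by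
      simp only [e]
      exact_mod_cast h
    linarith
  obtain ⟨δ, hδ⟩ : ∃ δ, δ = e S / (4 * m) := ⟨_, rfl⟩
  have hδ0 : 0 < δ := by rw [hδ]; exact div_pos hE0 (by positivity)
  obtain ⟨U, hU, hUmax⟩ := Finset.exists_max_image (S \ B).powerset
    (fun U => e U - 2 * δ * U.card) ⟨_, Finset.mem_powerset_self _⟩
  rw [Finset.mem_powerset] at hU
  have hUS : U ⊆ S := hU.trans Finset.sdiff_subset
  have hUpos : 0 < e U - 2 * δ * U.card := by
    refine lt_of_lt_of_le ?_ (hUmax _ (Finset.mem_powerset_self _))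
    have h1 : ((S \ B).card : ℝ) ≤ m := by
      rw [hm]; exact_mod_cast Finset.card_le_card Finset.sdiff_subset
    have h2 : 2 * δ * m = e S / 2 := by rw [hδ]; field_simp; norm_num
    have h3 : 2 * δ * ((S \ B).card : ℝ) ≤ 2 * δ * m :=
      mul_le_mul_of_nonneg_left h1 (by positivity)
    linarith
  refine ⟨U, ?_, δ, ?_, fun v hv => ⟨?_, ?_⟩⟩
  · rw [Finset.nonempty_iff_ne_empty]
    rintro rfl
    simp [he0] at hUpos
  · have h1 : (U.card : ℝ) ^ ε ≤ m ^ ε :=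
      Real.rpow_le_rpow (Nat.cast_nonneg _)
        (by rw [hm]; exact_mod_cast Finset.card_le_card hUS) hε.le
    have h2 : δ = φ / 4 * m ^ ε := by
      rw [hδ, hE, Real.rpow_add hm0, Real.rpow_one]
      field_simp
    rw [h2]
    exact mul_le_mul (by linarith) h1 (Real.rpow_nonneg (Nat.cast_nonneg _) _) (by positivity)
  · have h1 := hUmax (U.erase v) (Finset.mem_powerset.2 ((Finset.erase_subset _ _).trans hU))
    have h2 : e U ≤ e (U.erase v) + 2 * (U.filter (G.Adj v)).card := by
      simp only [e]
      exact_mod_cast card_interedges_self_erase G hv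
    have h3 : (U.card : ℝ) = (U.erase v).card + 1 := by
      exact_mod_cast (Finset.card_erase_add_one hv).symm
    rw [h3] at h1
    linarith
  · have h1 : v ∉ B := (Finset.mem_sdiff.1 (hU hv)).2
    have h2 : ((S.filter (G.Adj v)).card : ℝ) ≤ l * e S / m := by
      by_contra! h
      exact h1 (Finset.mem_filter.2 ⟨hUS hv, h⟩)
    have h3 : ((U.filter (G.Adj v)).card : ℝ) ≤ (S.filter (G.Adj v)).card := by
      exact_mod_cast Finset.card_le_card (Finset.filter_subset_filter _ hUS)
    have h4 : 4 * l * δ = l * e S / m := by rw [hδ]; field_simp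
    linarith

end Regularize

/-- To bound the Turán number of `H` it suffices to find `H` in dense almost regular graphs. -/
theorem exists_upper_bound {β : Type} (H : SimpleGraph β) {ε : ℝ} (hε : 0 < ε)
    (h : ∀ K : ℝ, ∃ C : ℝ, ∀ (V : Type) [Fintype V] [DecidableEq V] [Nonempty V]
      (G : SimpleGraph V) [DecidableRel G.Adj] (δ : ℝ), 0 < δ → C * (Fintype.card V : ℝ) ^ ε ≤ δ →
      (∀ v, δ ≤ G.degree v ∧ (G.degree v : ℝ) ≤ K * δ) → G.Contains H) :
    ∃ c : ℝ, 0 < c ∧ ∀ n : ℕ, (exNum n H : ℝ) ≤ c * (n : ℝ) ^ (1 + ε) := by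
  classical
  obtain ⟨l, hl, hlε⟩ : ∃ l : ℕ, 0 < l ∧ 4 * 3 ^ (1 + ε) ≤ (l : ℝ) ^ ε := by
    have := ((tendsto_rpow_atTop hε).comp tendsto_natCast_atTop_atTop).eventually_ge_atTop
      (4 * 3 ^ (1 + ε) : ℝ)
    obtain ⟨l, h1, h2⟩ := (this.and (eventually_gt_atTop 0)).exists
    exact ⟨l, h2, h1⟩
  obtain ⟨C, hC⟩ := h (4 * l)
  have hl' : (1 : ℝ) ≤ l := by exact_mod_cast hl
  set c : ℝ := max l (4 * C) with hc
  have hcl : (l : ℝ) ≤ c := le_max_left _ _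
  refine ⟨c, by linarith, fun n => ?_⟩
  have hbound : ∀ N ∈ {N | ∃ G : SimpleGraph (Fin n), ¬ G.Contains H ∧ G.edgeSet.ncard = N},
      (N : ℝ) ≤ c * (n : ℝ) ^ (1 + ε) := by
    rintro N ⟨G, hG, rfl⟩
    by_contra! hlt
    apply hG
    have hcard : G.edgeSet.ncard ≤ (G.interedges Finset.univ Finset.univ).card := by
      have h1 : (G.interedges Finset.univ Finset.univ).card = 2 * G.edgeFinset.card := by
        rw [card_interedges_self, ← G.sum_degrees_eq_twice_card_edges]
        refine Finset.sum_congr rfl fun v _ => ?_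
        rw [← G.card_neighborFinset_eq_degree]
        congr 1
        ext
        simp
      rw [h1, Set.ncard_eq_toFinset_card', ← SimpleGraph.edgeFinset]
      omega
    obtain ⟨S, hSne, δ, hδ, hdeg⟩ := exists_almost_regular_subset G hε hl hlε hcl (by
      rw [Fintype.card_fin]
      exact hlt.trans_le (by exact_mod_cast hcard))
    have hdegree : ∀ v : S, ((G.induce (S : Set (Fin n))).degree v) =
        (S.filter (G.Adj v)).card := by
      intro v
      rw [← SimpleGraph.card_neighborFinset_eq_degree]
      refine Finset.card_bij (fun u _ => u.1) ?_ ?_ ?_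
      · intro u hu
        simpa using hu
      · intro u _ u' _ h
        exact Subtype.ext h
      · intro u hu
        rw [Finset.mem_filter] at hu
        exact ⟨⟨u, hu.1⟩, by simpa using hu.2, rfl⟩
    have hS0 : (0 : ℝ) < (S.card : ℝ) ^ ε :=
      Real.rpow_pos_of_pos (by exact_mod_cast hSne.card_pos) _
    have : Nonempty S := hSne.to_subtype
    obtain ⟨f, hf⟩ := hC S (G.induce (S : Set (Fin n))) δ
      (lt_of_lt_of_le (by have : 0 < c := by linarith
                          positivity) hδ)
      (le_trans (by
        rw [Fintype.card_coe]
        refine mul_le_mul_of_nonneg_right ?_ hS0.le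
        have := le_max_right (l : ℝ) (4 * C)
        linarith) hδ) (fun v => by
        rw [hdegree v]
        exact hdeg v v.2)
    exact ⟨(SimpleGraph.Embedding.induce (G := G) (S : Set (Fin n))).toHom.comp f,
      (SimpleGraph.Embedding.induce (G := G) (S : Set (Fin n))).injective.comp hf⟩
  rcases Set.eq_empty_or_nonempty
    {N | ∃ G : SimpleGraph (Fin n), ¬ G.Contains H ∧ G.edgeSet.ncard = N} with h0 | h0
  · rw [exNum, h0]
    simp only [csSup_empty, bot_eq_zero, Nat.cast_zero]
    have : 0 < c := by linarith
    positivity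
  · refine hbound _ (Nat.sSup_mem h0 ⟨⌊c * (n : ℝ) ^ (1 + ε)⌋₊, fun N hN => ?_⟩)
    exact Nat.le_floor (hbound N hN)

/-- A version of `exists_upper_bound` with natural-number parameters. -/
theorem exists_upper_bound_of_degree {β : Type} (H : SimpleGraph β) {a b : ℕ} (ha : 0 < a)
    (hab : a < b) (h : ∀ K : ℕ, ∃ C : ℕ, ∀ (V : Type) [Fintype V] [DecidableEq V] [Nonempty V]
      (G : SimpleGraph V) [DecidableRel G.Adj] (d : ℕ), C ^ b * Fintype.card V ^ (b - a) ≤ d ^ b →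
      (∀ v, d ≤ G.degree v ∧ G.degree v ≤ K * d) → G.Contains H) :
    ∃ c : ℝ, 0 < c ∧ ∀ n : ℕ, (exNum n H : ℝ) ≤ c * (n : ℝ) ^ (2 - (a : ℝ) / (b : ℝ)) := by
  have hb : (0 : ℝ) < b := by exact_mod_cast (by omega : 0 < b)
  have hε : 0 < 1 - (a : ℝ) / b := by
    rw [sub_pos, div_lt_one hb]
    exact_mod_cast hab
  have := exists_upper_bound H hε fun K => by
    obtain ⟨C, hC⟩ := h ⌈K⌉₊
    refine ⟨C, fun V _ _ _ G _ δ hδ hCδ hdeg => hC V G ⌈δ⌉₊ ?_ fun v => ⟨?_, ?_⟩⟩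
    · have h1 : (C : ℝ) * (Fintype.card V : ℝ) ^ (1 - (a : ℝ) / b) ≤ ⌈δ⌉₊ :=
        hCδ.trans (Nat.le_ceil δ)
      have h2 := pow_le_pow_left₀ (by positivity) h1 b
      rw [mul_pow, ← Real.rpow_natCast ((Fintype.card V : ℝ) ^ (1 - (a : ℝ) / b)),
        ← Real.rpow_mul (Nat.cast_nonneg _)] at h2
      have h3 : (1 - (a : ℝ) / b) * b = ((b - a : ℕ) : ℝ) := by
        rw [Nat.cast_sub hab.le]
        field_simp
      rw [h3, Real.rpow_natCast] at h2
      exact_mod_cast h2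
    · exact Nat.ceil_le.2 (hdeg v).1
    · have h1 : (G.degree v : ℝ) ≤ ⌈K⌉₊ * ⌈δ⌉₊ :=
        (hdeg v).2.trans (mul_le_mul (Nat.le_ceil K) (Nat.le_ceil δ) hδ.le (Nat.cast_nonneg _))
      exact_mod_cast h1
  convert this using 7
  ring

/-- Greedy choice of objects with pairwise disjoint supports. -/
lemma exists_disjoint_supports {ι X V : Type*} [Fintype ι] [DecidableEq V] {k D : ℕ}
    (A : ι → Finset X) (supp : X → Finset V) (F : Finset V)
    (hk : ∀ i, ∀ x ∈ A i, (supp x).card ≤ k)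
    (hD : ∀ i v, ((A i).filter fun x => v ∈ supp x).card ≤ D)
    (hA : ∀ i, (k * Fintype.card ι + F.card) * D < (A i).card) :
    ∃ f : ι → X, (∀ i, f i ∈ A i) ∧ (∀ i, Disjoint (supp (f i)) F) ∧
      Pairwise fun i j => Disjoint (supp (f i)) (supp (f j)) := by
  classical
  have step : ∀ s : Finset ι, ∃ f : ι → X, (∀ i, f i ∈ A i) ∧
      (∀ i ∈ s, Disjoint (supp (f i)) F) ∧
      (s : Set ι).Pairwise fun i j => Disjoint (supp (f i)) (supp (f j)) := by
    intro s
    induction s using Finset.induction_on with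
    | empty =>
      choose f hf using fun i => Finset.card_pos.1 (Nat.zero_lt_of_lt (hA i))
      exact ⟨f, hf, by simp, by simp⟩
    | insert i s his ih =>
      obtain ⟨f, hfA, hfF, hfs⟩ := ih
      let U := s.biUnion (fun j => supp (f j)) ∪ F
      have hU : U.card ≤ k * Fintype.card ι + F.card := by
        refine (Finset.card_union_le _ _).trans (Nat.add_le_add_right ?_ _)
        refine (Finset.card_biUnion_le_card_mul s _ k fun j _ => hk j _ (hfA j)).trans ?_
        rw [mul_comm]
        exact Nat.mul_le_mul_left _ (Finset.card_le_univ s)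
      obtain ⟨x, hxA, hx⟩ : ∃ x ∈ A i, Disjoint (supp x) U := by
        by_contra! hcon
        have hsub : A i ⊆ U.biUnion fun v => (A i).filter fun x => v ∈ supp x := by
          intro x hx
          obtain ⟨v, hv1, hv2⟩ := Finset.not_disjoint_iff.1 (hcon x hx)
          simp only [Finset.mem_biUnion, Finset.mem_filter]
          exact ⟨v, hv2, hx, hv1⟩
        have h1 := (Finset.card_le_card hsub).trans
          (Finset.card_biUnion_le_card_mul U _ D fun v _ => hD i v)
        have h2 := Nat.mul_le_mul_right D hU
        have h3 := hA i
        omega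
      rw [Finset.disjoint_union_right, Finset.disjoint_biUnion_right] at hx
      have hne : ∀ j ∈ s, j ≠ i := fun j hj h => his (h ▸ hj)
      refine ⟨Function.update f i x, ?_, ?_, ?_⟩
      · intro j
        by_cases hj : j = i
        · subst hj; simpa using hxA
        · simpa [hj] using hfA j
      · intro j hj
        rcases Finset.mem_insert.1 hj with rfl | hj
        · simpa using hx.2
        · simpa [hne j hj] using hfF j hj
      · rw [Finset.coe_insert, Set.pairwise_insert]
        refine ⟨fun j hj j' hj' hjj => ?_, fun j hj _ => ?_⟩
        · simpa [hne j hj, hne j' hj'] using hfs hj hj' hjj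
        · simpa [hne j hj, disjoint_comm] using hx.1 j hj
  obtain ⟨f, h1, h2, h3⟩ := step Finset.univ
  exact ⟨f, h1, fun i => h2 i (Finset.mem_univ i), fun i j hij => h3 (by simp) (by simp) hij⟩

lemma sum_le_mul_of_card_le {X : Type*} {s : Finset X} {f : X → ℕ} {Δ M : ℕ} (hs : s.card ≤ Δ)
    (hf : ∀ i ∈ s, f i ≤ M) : ∑ i ∈ s, f i ≤ Δ * M :=
  (Finset.sum_le_card_nsmul s f M hf).trans (by simpa using Nat.mul_le_mul_right M hs)

lemma mul_le_sum_of_le_card {X : Type*} {s : Finset X} {f : X → ℕ} {d M : ℕ} (hs : d ≤ s.card)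
    (hf : ∀ i ∈ s, M ≤ f i) : d * M ≤ ∑ i ∈ s, f i :=
  (Nat.mul_le_mul_right M hs).trans (by simpa using Finset.card_nsmul_le_sum s f M hf)

lemma sum_eq_ite_le_one {X : Type*} [DecidableEq X] (s : Finset X) (x : X) :
    ∑ i ∈ s, (if x = i then 1 else 0) ≤ 1 := by
  rw [Finset.sum_ite_eq]
  split_ifs <;> simp

section Codegree

variable {V : Type*} [Fintype V] (G : SimpleGraph V) [DecidableRel G.Adj]

lemma sum_neighborFinset_comm (f : V → V → ℕ) :
    ∑ u, ∑ v ∈ G.neighborFinset u, f u v = ∑ v, ∑ u ∈ G.neighborFinset v, f u v :=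
  Finset.sum_comm' fun u v => by simp [G.adj_comm]

variable [DecidableEq V]

/-- The set of common neighbours of two vertices. -/
def commonNbr (u v : V) : Finset V := G.neighborFinset u ∩ G.neighborFinset v

/-- A pair of vertices is heavy if it has at least `t` common neighbours. -/
def Heavy (t : ℕ) (u v : V) : Prop := t ≤ (commonNbr G u v).card

instance (t : ℕ) (u v : V) : Decidable (Heavy G t u v) :=
  inferInstanceAs (Decidable (t ≤ _))

/-- The common neighbours of a pair, if it is not heavy. -/
def lightNbr (t : ℕ) (u v : V) : Finset V := if Heavy G t u v then ∅ else commonNbr G u v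

variable {G}

lemma mem_commonNbr {u v w : V} : w ∈ commonNbr G u v ↔ G.Adj u w ∧ G.Adj v w := by
  simp [commonNbr]

lemma heavy_comm {t : ℕ} {u v : V} : Heavy G t u v ↔ Heavy G t v u := by
  rw [Heavy, Heavy, commonNbr, commonNbr, Finset.inter_comm]

lemma mem_lightNbr {t : ℕ} {u v w : V} :
    w ∈ lightNbr G t u v ↔ ¬ Heavy G t u v ∧ G.Adj u w ∧ G.Adj v w := by
  rw [lightNbr]
  split_ifs with h
  · simp [h]
  · simp [h, mem_commonNbr]

lemma card_lightNbr_le (t : ℕ) (u v : V) : (lightNbr G t u v).card ≤ t := by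
  rw [lightNbr]
  split_ifs with h
  · simp
  · exact (not_le.1 h).le

end Codegree

section Comb

variable {V : Type*} {G : SimpleGraph V}

lemma contains_combPower {p : ℕ} (e : Fin 3 → V) (g : Fin 3 → Fin p → V)
    (he : Function.Injective e) (hg : ∀ i j i' j', g i j = g i' j' → i = i' ∧ j = j')
    (hne : ∀ i i' j, e i ≠ g i' j) (h1 : ∀ i j, G.Adj (e i) (g i j))
    (h2 : ∀ i j, i ≠ 1 → G.Adj (g 1 j) (g i j)) : G.Contains (combPower p) := by
  refine ⟨⟨Sum.elim e fun ij => g ij.1 ij.2, ?_⟩, ?_⟩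
  · rintro (i | ⟨i, j⟩) (i' | ⟨i', j'⟩) h
    · exact h.elim
    · obtain rfl : i = i' := h
      exact h1 i j'
    · obtain rfl : i' = i := h
      exact (h1 i' j).symm
    · obtain ⟨rfl, h⟩ : j = j' ∧ (i = 1 ↔ i' ≠ 1) := h
      by_cases hi : i = 1
      · subst hi
        exact h2 i' j (h.1 rfl)
      · have : i' = 1 := by
          by_contra h'
          exact hi (h.2 h')
        subst this
        exact (h2 i j hi).symm
  · rintro (i | ⟨i, j⟩) (i' | ⟨i', j'⟩) h
    · exact congrArg Sum.inl (he h)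
    · exact (hne _ _ _ h).elim
    · exact (hne _ _ _ h.symm).elim
    · obtain ⟨rfl, rfl⟩ := hg _ _ _ _ h
      rfl

variable [Fintype V] [DecidableEq V] [DecidableRel G.Adj]

/-- Many vertices forming heavy pairs with both `a` and `c` inside a neighbourhood give a copy of
`combPower p`. -/
lemma contains_combPower_of_heavy {p t : ℕ} (ht : 3 * p + 3 < t) {w a c : V} (hac : a ≠ c)
    (ha : G.Adj w a) (hc : G.Adj w c) (y : Fin p → V) (hy : Function.Injective y)
    (hw : ∀ j, G.Adj w (y j)) (hya : ∀ j, y j ≠ a) (hyc : ∀ j, y j ≠ c)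
    (hHa : ∀ j, Heavy G t a (y j)) (hHc : ∀ j, Heavy G t c (y j)) :
    G.Contains (combPower p) := by
  let F : Finset V := {a, w, c} ∪ Finset.univ.image y
  have hF : F.card ≤ 3 + p := by
    refine (Finset.card_union_le _ _).trans (Nat.add_le_add Finset.card_le_three ?_)
    exact Finset.card_image_le.trans (by simp)
  obtain ⟨f, hfA, hfF, hfd⟩ := exists_disjoint_supports (ι := Bool × Fin p) (k := 1) (D := 1)
    (fun i => commonNbr G (if i.1 then c else a) (y i.2)) (fun v => {v}) F (by simp)
    (fun i v => by
      refine (Finset.card_le_card (t := {v}) fun x hx => ?_).trans (by simp)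
      simpa [eq_comm] using (Finset.mem_filter.1 hx).2)
    (fun i => by
      have : t ≤ (commonNbr G (if i.1 then c else a) (y i.2)).card := by
        split_ifs
        · exact hHc _
        · exact hHa _
      simp only [Fintype.card_prod, Fintype.card_bool, Fintype.card_fin]
      omega)
  have hf : ∀ i, f i ∉ F := fun i => by simpa using hfF i
  have hfi : Function.Injective f := fun i j h => by
    by_contra hij
    simpa [h] using hfd hij
  have hx : ∀ j, G.Adj a (f (false, j)) ∧ G.Adj (y j) (f (false, j)) := fun j => by
    simpa [mem_commonNbr] using hfA (false, j)
  have hz : ∀ j, G.Adj c (f (true, j)) ∧ G.Adj (y j) (f (true, j)) := fun j => by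
    simpa [mem_commonNbr] using hfA (true, j)
  have hfe : ∀ i, f i ≠ a ∧ f i ≠ w ∧ f i ≠ c ∧ ∀ j, y j ≠ f i := fun i => by
    simpa [F, and_assoc] using hf i
  refine contains_combPower ![a, w, c] ![fun j => f (false, j), y, fun j => f (true, j)]
    ?_ ?_ ?_ ?_ ?_
  · intro i j hij
    fin_cases i <;> fin_cases j <;>
      simp_all [ha.ne, ha.ne', hc.ne, hc.ne', hac.symm]
  · intro i j i' j' h
    fin_cases i <;> fin_cases i' <;> simp at h ⊢
    · simpa using hfi h
    · exact absurd h.symm ((hfe _).2.2.2 _)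
    · simpa using hfi h
    · exact absurd h ((hfe _).2.2.2 _)
    · exact hy h
    · exact absurd h ((hfe _).2.2.2 _)
    · simpa using hfi h
    · exact absurd h.symm ((hfe _).2.2.2 _)
    · simpa using hfi h
  · intro i i' j
    fin_cases i' <;> fin_cases i <;> simp
    · exact (hfe _).1.symm
    · exact (hfe _).2.1.symm
    · exact (hfe _).2.2.1.symm
    · exact (hya j).symm
    · exact (hw j).ne
    · exact (hyc j).symm
    · exact (hfe _).1.symm
    · exact (hfe _).2.1.symm
    · exact (hfe _).2.2.1.symm
  · intro i j
    fin_cases i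
    · exact (hx j).1
    · exact hw j
    · exact (hz j).1
  · intro i j hi
    fin_cases i
    · exact (hx j).2
    · exact absurd rfl hi
    · exact (hz j).2

end Comb

section CombSum

variable {V : Type*} [Fintype V] {G : SimpleGraph V} [DecidableRel G.Adj]

/-- The sum of `g` over all homomorphic images of the comb. -/
def combSum (G : SimpleGraph V) [DecidableRel G.Adj] (g : V → V → V → V → V → V → ℕ) : ℕ :=
  ∑ y, ∑ x ∈ G.neighborFinset y, ∑ a ∈ G.neighborFinset x, ∑ z ∈ G.neighborFinset y,
    ∑ c ∈ G.neighborFinset z, ∑ b ∈ G.neighborFinset y, g y x a z c b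

lemma combSum_add (g h : V → V → V → V → V → V → ℕ) :
    combSum G (fun y x a z c b => g y x a z c b + h y x a z c b) = combSum G g + combSum G h := by
  simp only [combSum, Finset.sum_add_distrib]

lemma le_combSum_one {d : ℕ} (hd : ∀ v, d ≤ G.degree v) :
    Fintype.card V * d ^ 5 ≤ combSum G fun _ _ _ _ _ _ => 1 := by
  have hN : ∀ v, d ≤ (G.neighborFinset v).card := fun v => by
    rw [G.card_neighborFinset_eq_degree]; exact hd v
  have h : Fintype.card V * (d * (d * (d * (d * (d * 1))))) ≤ combSum G fun _ _ _ _ _ _ => 1 :=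
    mul_le_sum_of_le_card le_rfl fun _ _ => mul_le_sum_of_le_card (hN _) fun _ _ =>
      mul_le_sum_of_le_card (hN _) fun _ _ => mul_le_sum_of_le_card (hN _) fun _ _ =>
      mul_le_sum_of_le_card (hN _) fun _ _ => mul_le_sum_of_le_card (hN _) fun _ _ => le_rfl
  calc _ = Fintype.card V * (d * (d * (d * (d * (d * 1))))) := by ring
    _ ≤ _ := h

end CombSum

section Comb

variable {V : Type*} [Fintype V] [DecidableEq V] (G : SimpleGraph V) [DecidableRel G.Adj]

/-- The number of ordered heavy pairs in the neighbourhood of `w`. -/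
def heavyCount (t : ℕ) (w : V) : ℕ :=
  ∑ u ∈ G.neighborFinset w, ∑ v ∈ G.neighborFinset w, if Heavy G t u v then 1 else 0

/-- The paths `x y z` extending to a comb with ends `a`, `b`, `c` without heavy pairs. -/
def lightComb (t : ℕ) (a b c : V) : Finset (V × V × V) :=
  Finset.univ.filter fun τ => τ.1 ∈ lightNbr G t a τ.2.1 ∧ τ.2.2 ∈ lightNbr G t τ.2.1 c ∧
    τ.2.1 ∈ lightNbr G t τ.1 b ∧ τ.2.1 ∈ lightNbr G t τ.2.2 b ∧ τ.1 ≠ τ.2.2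

variable {G}

lemma heavyCount_sq_le {p t : ℕ} (ht : 3 * p + 3 < t) (hH : ¬ G.Contains (combPower p)) (w : V) :
    heavyCount G t w ^ 2 ≤ (p + 3) * G.degree w ^ 3 := by
  let N := G.neighborFinset w
  have hN : N.card = G.degree w := G.card_neighborFinset_eq_degree w
  let h : V → V → ℕ := fun u v => if Heavy G t u v then 1 else 0
  have hpair : ∀ a ∈ N, ∀ c ∈ N, a ≠ c → ∑ y ∈ N, h a y * h c y ≤ p + 2 := by
    intro a ha c hc hac
    have hsum : ∑ y ∈ N, h a y * h c y =
        (N.filter fun y => Heavy G t a y ∧ Heavy G t c y).card := by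
      rw [Finset.card_filter]
      refine Finset.sum_congr rfl fun y _ => ?_
      simp only [h, ite_and]
      split_ifs <;> rfl
    rw [hsum]
    by_contra! hlt
    have hcard : p ≤ ((N.filter fun y => Heavy G t a y ∧ Heavy G t c y) \ {a, c}).card := by
      have := Finset.le_card_sdiff ({a, c} : Finset V)
        (N.filter fun y => Heavy G t a y ∧ Heavy G t c y)
      have := Finset.card_le_two (a := a) (b := c)
      omega
    obtain ⟨y, hy, hyN⟩ := exists_fin_embedding _ hcard
    have hφ : ∀ j, (G.Adj w (y j) ∧ Heavy G t a (y j) ∧ Heavy G t c (y j)) ∧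
        y j ≠ a ∧ y j ≠ c := fun j => by
      simpa [N] using hyN j
    exact hH (contains_combPower_of_heavy ht hac (by simpa [N] using ha) (by simpa [N] using hc)
      y hy (fun j => (hφ j).1.1) (fun j => (hφ j).2.1) (fun j => (hφ j).2.2)
      (fun j => (hφ j).1.2.1) (fun j => (hφ j).1.2.2))
  have hcount : heavyCount G t w = ∑ y ∈ N, ∑ a ∈ N, h a y := Finset.sum_comm
  rw [hcount]
  have hsq : ∑ y ∈ N, (∑ a ∈ N, h a y) ^ 2 ≤ G.degree w * (G.degree w * (p + 3)) := by
    have h1 : ∑ y ∈ N, (∑ a ∈ N, h a y) ^ 2 = ∑ a ∈ N, ∑ c ∈ N, ∑ y ∈ N, h a y * h c y := by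
      simp only [sq, Finset.sum_mul_sum]
      rw [Finset.sum_comm]
      exact Finset.sum_congr rfl fun a _ => Finset.sum_comm
    rw [h1]
    refine sum_le_mul_of_card_le hN.le fun a ha => ?_
    have h2 : ∀ c ∈ N, ∑ y ∈ N, h a y * h c y ≤
        (p + 2) + G.degree w * (if a = c then 1 else 0) := by
      intro c hc
      by_cases hac : a = c
      · rw [if_pos hac]
        refine (sum_le_mul_of_card_le (M := 1) hN.le fun y _ => ?_).trans (Nat.le_add_left _ _)
        simp only [h]
        split_ifs <;> simp
      · rw [if_neg hac]
        exact hpair a ha c hc hac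
    refine (Finset.sum_le_sum h2).trans ?_
    rw [Finset.sum_add_distrib, ← Finset.mul_sum, Finset.sum_const, hN, smul_eq_mul]
    have h3 := Nat.mul_le_mul_left (G.degree w) (sum_eq_ite_le_one N a)
    linarith
  calc (∑ y ∈ N, ∑ a ∈ N, h a y) ^ 2 ≤ N.card * ∑ y ∈ N, (∑ a ∈ N, h a y) ^ 2 :=
        sq_sum_le_card_mul_sum_sq
    _ ≤ G.degree w * (G.degree w * (G.degree w * (p + 3))) := by
        rw [hN]; exact Nat.mul_le_mul_left _ hsq
    _ = (p + 3) * G.degree w ^ 3 := by ring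

lemma card_lightComb_filter_le (t : ℕ) (a b c v : V) :
    ((lightComb G t a b c).filter fun τ => v ∈ ({τ.1, τ.2.1, τ.2.2} : Finset V)).card ≤
      3 * (t * t) := by
  have hsub : ((lightComb G t a b c).filter fun τ => v ∈ ({τ.1, τ.2.1, τ.2.2} : Finset V)) ⊆
      (lightNbr G t v b).biUnion (fun y => (lightNbr G t y c).image fun z => (v, y, z)) ∪
      ((lightNbr G t a v).biUnion (fun x => (lightNbr G t v c).image fun z => (x, v, z)) ∪
      (lightNbr G t v b).biUnion (fun y => (lightNbr G t a y).image fun x => (x, y, v))) := by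
    rintro ⟨x, y, z⟩ h
    simp only [lightComb, Finset.mem_filter, Finset.mem_univ, true_and, Finset.mem_insert,
      Finset.mem_singleton] at h
    obtain ⟨⟨h1, h2, h3, h4, -⟩, rfl | rfl | rfl⟩ := h
    · exact Finset.mem_union_left _ (Finset.mem_biUnion.2 ⟨y, h3, Finset.mem_image.2 ⟨z, h2, rfl⟩⟩)
    · exact Finset.mem_union_right _ (Finset.mem_union_left _
        (Finset.mem_biUnion.2 ⟨x, h1, Finset.mem_image.2 ⟨z, h2, rfl⟩⟩))
    · exact Finset.mem_union_right _ (Finset.mem_union_right _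
        (Finset.mem_biUnion.2 ⟨y, h4, Finset.mem_image.2 ⟨x, h1, rfl⟩⟩))
  have hbi : ∀ (u v : V) (f : V → Finset (V × V × V)), (∀ w, (f w).card ≤ t) →
      ((lightNbr G t u v).biUnion f).card ≤ t * t := fun u v f hf =>
    (Finset.card_biUnion_le_card_mul _ _ t fun w _ => hf w).trans
      (Nat.mul_le_mul_right _ (card_lightNbr_le t u v))
  have him : ∀ (u v : V) (f : V → V × V × V), ((lightNbr G t u v).image f).card ≤ t :=
    fun u v f => Finset.card_image_le.trans (card_lightNbr_le t u v)
  refine (Finset.card_le_card hsub).trans ((Finset.card_union_le _ _).trans ?_)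
  have h1 := hbi v b (fun y => (lightNbr G t y c).image fun z => (v, y, z)) fun _ => him _ _ _
  have h2 := Finset.card_union_le
    ((lightNbr G t a v).biUnion fun x => (lightNbr G t v c).image fun z => (x, v, z))
    ((lightNbr G t v b).biUnion fun y => (lightNbr G t a y).image fun x => (x, y, v))
  have h3 := hbi a v (fun x => (lightNbr G t v c).image fun z => (x, v, z)) fun _ => him _ _ _
  have h4 := hbi v b (fun y => (lightNbr G t a y).image fun x => (x, y, v)) fun _ => him _ _ _
  omega

lemma contains_combPower_of_lightComb {p t : ℕ} {a b c : V} (hab : a ≠ b) (hac : a ≠ c)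
    (hbc : b ≠ c) (h : (3 * p + 3) * (3 * (t * t)) < (lightComb G t a b c).card) :
    G.Contains (combPower p) := by
  obtain ⟨f, hfA, hfF, hfd⟩ := exists_disjoint_supports (ι := Fin p) (k := 3)
    (fun _ => lightComb G t a b c) (fun τ => {τ.1, τ.2.1, τ.2.2}) {a, b, c}
    (fun _ _ _ => Finset.card_le_three) (fun _ v => card_lightComb_filter_le t a b c v)
    (fun _ => by
      refine lt_of_le_of_lt (Nat.mul_le_mul_right _ ?_) h
      rw [Fintype.card_fin]
      exact Nat.add_le_add_left Finset.card_le_three _)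
  simp only [lightComb, Finset.mem_filter, Finset.mem_univ, true_and, mem_lightNbr] at hfA
  let g : Fin 3 → Fin p → V := fun i j => ![(f j).1, (f j).2.1, (f j).2.2] i
  have hgm : ∀ i j, g i j ∈ ({(f j).1, (f j).2.1, (f j).2.2} : Finset V) := by
    intro i j
    fin_cases i <;> simp [g]
  refine contains_combPower ![a, b, c] g ?_ ?_ ?_ ?_ ?_
  · intro i j hij
    fin_cases i <;> fin_cases j <;> simp_all
  · intro i j i' j' h
    have hj : j = j' := by
      by_contra hj
      exact Finset.disjoint_left.1 (hfd hj) (hgm i j) (h ▸ hgm i' j')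
    subst hj
    refine ⟨?_, rfl⟩
    obtain ⟨⟨-, h1, h1'⟩, ⟨-, h2, h2'⟩, -, -, h5⟩ := hfA j
    have h6 := h1'.ne
    have h7 := h2.ne
    have h8 := h5.symm
    clear hfA hgm hfd hfF
    fin_cases i <;> fin_cases i' <;> simp_all [g, eq_comm]
  · intro i i' j h
    refine Finset.disjoint_left.1 (hfF j) (hgm i' j) ?_
    rw [← h]
    fin_cases i <;> simp
  · intro i j
    obtain ⟨⟨-, h1, h1'⟩, ⟨-, h2, h2'⟩, ⟨-, h3, h3'⟩, -, h5⟩ := hfA j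
    fin_cases i
    · exact h1
    · exact h3'
    · exact h2'
  · intro i j hi
    obtain ⟨⟨-, h1, h1'⟩, ⟨-, h2, h2'⟩, -, -, h5⟩ := hfA j
    fin_cases i
    · exact h1'
    · exact absurd rfl hi
    · exact h2

/-- The sum over combs of the number of failures of being a light comb with distinct ends. -/
lemma combSum_defect_le {t Δ : ℕ} (hΔ : ∀ v, G.degree v ≤ Δ) :
    combSum G (fun y x a z c b => (if Heavy G t a y then 1 else 0) +
      ((if Heavy G t y c then 1 else 0) + ((if Heavy G t x b then 1 else 0) +
      ((if Heavy G t z b then 1 else 0) + ((if a = c then 1 else 0) + ((if a = b then 1 else 0) +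
      ((if c = b then 1 else 0) + (if x = z then 1 else 0)))))))) ≤
    4 * (Δ ^ 3 * ∑ w, heavyCount G t w) + 4 * (Fintype.card V * Δ ^ 4) := by
  have hN : ∀ v, (G.neighborFinset v).card ≤ Δ := fun v => by
    rw [G.card_neighborFinset_eq_degree]; exact hΔ v
  have hV : (Finset.univ : Finset V).card ≤ Fintype.card V := le_rfl
  have h1 : combSum G (fun y _ a _ _ _ => if Heavy G t a y then 1 else 0) ≤
      Δ ^ 3 * ∑ w, heavyCount G t w := by
    have h : combSum G (fun y _ a _ _ _ => if Heavy G t a y then 1 else 0) ≤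
        ∑ y, ∑ x ∈ G.neighborFinset y, ∑ a ∈ G.neighborFinset x,
          Δ * (Δ * (Δ * if Heavy G t a y then 1 else 0)) :=
      Finset.sum_le_sum fun _ _ => Finset.sum_le_sum fun _ _ => Finset.sum_le_sum fun _ _ =>
        sum_le_mul_of_card_le (hN _) fun _ _ => sum_le_mul_of_card_le (hN _) fun _ _ =>
        sum_le_mul_of_card_le (hN _) fun _ _ => le_rfl
    rw [sum_neighborFinset_comm] at h
    refine h.trans_eq ?_
    simp only [heavyCount, Finset.mul_sum, heavy_comm (G := G) (t := t)]
    refine Finset.sum_congr rfl fun w _ => Finset.sum_congr rfl fun u _ =>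
      Finset.sum_congr rfl fun v _ => ?_
    ring
  have h2 : combSum G (fun y _ _ _ c _ => if Heavy G t y c then 1 else 0) ≤
      Δ ^ 3 * ∑ w, heavyCount G t w := by
    have h : combSum G (fun y _ _ _ c _ => if Heavy G t y c then 1 else 0) ≤
        ∑ y, Δ * (Δ * ∑ z ∈ G.neighborFinset y, ∑ c ∈ G.neighborFinset z,
          Δ * if Heavy G t y c then 1 else 0) :=
      Finset.sum_le_sum fun _ _ => sum_le_mul_of_card_le (hN _) fun _ _ =>
        sum_le_mul_of_card_le (hN _) fun _ _ => Finset.sum_le_sum fun _ _ =>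
        Finset.sum_le_sum fun _ _ => sum_le_mul_of_card_le (hN _) fun _ _ => le_rfl
    rw [← Finset.mul_sum, ← Finset.mul_sum, sum_neighborFinset_comm] at h
    refine h.trans_eq ?_
    simp only [heavyCount, Finset.mul_sum]
    refine Finset.sum_congr rfl fun w _ => Finset.sum_congr rfl fun u _ =>
      Finset.sum_congr rfl fun v _ => ?_
    ring
  have h3 : combSum G (fun _ x _ _ _ b => if Heavy G t x b then 1 else 0) ≤
      Δ ^ 3 * ∑ w, heavyCount G t w := by
    have h : combSum G (fun _ x _ _ _ b => if Heavy G t x b then 1 else 0) ≤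
        ∑ y, ∑ x ∈ G.neighborFinset y, Δ * (Δ * (Δ * ∑ b ∈ G.neighborFinset y,
          if Heavy G t x b then 1 else 0)) :=
      Finset.sum_le_sum fun _ _ => Finset.sum_le_sum fun _ _ =>
        sum_le_mul_of_card_le (hN _) fun _ _ => sum_le_mul_of_card_le (hN _) fun _ _ =>
        sum_le_mul_of_card_le (hN _) fun _ _ => le_rfl
    refine h.trans_eq ?_
    simp only [heavyCount, Finset.mul_sum]
    refine Finset.sum_congr rfl fun w _ => Finset.sum_congr rfl fun u _ =>
      Finset.sum_congr rfl fun v _ => ?_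
    ring
  have h4 : combSum G (fun _ _ _ z _ b => if Heavy G t z b then 1 else 0) ≤
      Δ ^ 3 * ∑ w, heavyCount G t w := by
    have h : combSum G (fun _ _ _ z _ b => if Heavy G t z b then 1 else 0) ≤
        ∑ y, Δ * (Δ * ∑ z ∈ G.neighborFinset y, Δ * ∑ b ∈ G.neighborFinset y,
          if Heavy G t z b then 1 else 0) :=
      Finset.sum_le_sum fun _ _ => sum_le_mul_of_card_le (hN _) fun _ _ =>
        sum_le_mul_of_card_le (hN _) fun _ _ => Finset.sum_le_sum fun _ _ =>
        sum_le_mul_of_card_le (hN _) fun _ _ => le_rfl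
    refine h.trans_eq ?_
    simp only [heavyCount, Finset.mul_sum]
    refine Finset.sum_congr rfl fun w _ => Finset.sum_congr rfl fun u _ =>
      Finset.sum_congr rfl fun v _ => ?_
    ring
  have h5 : combSum G (fun _ _ a _ c _ => if a = c then 1 else 0) ≤ Fintype.card V * Δ ^ 4 := by
    have h : combSum G (fun _ _ a _ c _ => if a = c then 1 else 0) ≤
        Fintype.card V * (Δ * (Δ * (Δ * (Δ * 1)))) :=
      sum_le_mul_of_card_le hV fun y _ => sum_le_mul_of_card_le (hN _) fun _ _ =>
        sum_le_mul_of_card_le (hN _) fun a _ => sum_le_mul_of_card_le (hN _) fun z _ => by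
          have h' : ∀ c ∈ G.neighborFinset z, ∑ _b ∈ G.neighborFinset y, (if a = c then 1 else 0) ≤
              Δ * if a = c then 1 else 0 := fun c _ =>
            sum_le_mul_of_card_le (hN _) fun _ _ => le_rfl
          refine (Finset.sum_le_sum h').trans ?_
          rw [← Finset.mul_sum]
          exact Nat.mul_le_mul_left _ (sum_eq_ite_le_one _ a)
    exact h.trans_eq (by ring)
  have h6 : combSum G (fun _ _ a _ _ b => if a = b then 1 else 0) ≤ Fintype.card V * Δ ^ 4 := by
    have h : combSum G (fun _ _ a _ _ b => if a = b then 1 else 0) ≤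
        Fintype.card V * (Δ * (Δ * (Δ * (Δ * 1)))) :=
      sum_le_mul_of_card_le hV fun _ _ => sum_le_mul_of_card_le (hN _) fun _ _ =>
        sum_le_mul_of_card_le (hN _) fun a _ => sum_le_mul_of_card_le (hN _) fun _ _ =>
        sum_le_mul_of_card_le (hN _) fun _ _ => sum_eq_ite_le_one _ a
    exact h.trans_eq (by ring)
  have h7 : combSum G (fun _ _ _ _ c b => if c = b then 1 else 0) ≤ Fintype.card V * Δ ^ 4 := by
    have h : combSum G (fun _ _ _ _ c b => if c = b then 1 else 0) ≤
        Fintype.card V * (Δ * (Δ * (Δ * (Δ * 1)))) :=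
      sum_le_mul_of_card_le hV fun _ _ => sum_le_mul_of_card_le (hN _) fun _ _ =>
        sum_le_mul_of_card_le (hN _) fun _ _ => sum_le_mul_of_card_le (hN _) fun _ _ =>
        sum_le_mul_of_card_le (hN _) fun c _ => sum_eq_ite_le_one _ c
    exact h.trans_eq (by ring)
  have h8 : combSum G (fun _ x _ z _ _ => if x = z then 1 else 0) ≤ Fintype.card V * Δ ^ 4 := by
    have h : combSum G (fun _ x _ z _ _ => if x = z then 1 else 0) ≤
        Fintype.card V * (Δ * (Δ * (Δ * (Δ * 1)))) :=
      sum_le_mul_of_card_le hV fun y _ => sum_le_mul_of_card_le (hN _) fun x _ =>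
        sum_le_mul_of_card_le (hN _) fun _ _ => by
          have h' : ∀ z ∈ G.neighborFinset y, ∑ _c ∈ G.neighborFinset z,
              ∑ _b ∈ G.neighborFinset y, (if x = z then 1 else 0) ≤
              Δ * (Δ * if x = z then 1 else 0) := fun z _ =>
            sum_le_mul_of_card_le (hN _) fun _ _ => sum_le_mul_of_card_le (hN _) fun _ _ => le_rfl
          refine (Finset.sum_le_sum h').trans ?_
          rw [← Finset.mul_sum, ← Finset.mul_sum]
          exact Nat.mul_le_mul_left _ (Nat.mul_le_mul_left _ (sum_eq_ite_le_one _ x))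
    exact h.trans_eq (by ring)
  simp only [combSum_add]
  linarith

lemma combSum_light_le {t M : ℕ} (hM : ∀ a b c : V, a ≠ b → a ≠ c → b ≠ c →
      (lightComb G t a b c).card ≤ M) :
    combSum G (fun y x a z c b => if (x, y, z) ∈ lightComb G t a b c ∧ a ≠ b ∧ a ≠ c ∧ b ≠ c
      then 1 else 0) ≤ M * Fintype.card V ^ 3 := by
  let P : V × V × V × V × V × V → Prop := fun τ => (τ.2.1, τ.1, τ.2.2.2.1) ∈
    lightComb G t τ.2.2.1 τ.2.2.2.2.2 τ.2.2.2.2.1 ∧ τ.2.2.1 ≠ τ.2.2.2.2.2 ∧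
    τ.2.2.1 ≠ τ.2.2.2.2.1 ∧ τ.2.2.2.2.2 ≠ τ.2.2.2.2.1
  let A : Finset (V × V × V × V × V × V) := Finset.univ.filter P
  have h1 : combSum G (fun y x a z c b => if (x, y, z) ∈ lightComb G t a b c ∧ a ≠ b ∧ a ≠ c ∧
      b ≠ c then 1 else 0) ≤ A.card := by
    rw [Finset.card_filter]
    simp only [Fintype.sum_prod_type]
    refine Finset.sum_le_sum fun y _ => ?_
    refine (Finset.sum_le_sum fun x _ => (Finset.sum_le_sum fun a _ => (Finset.sum_le_sum fun z _ =>
      (Finset.sum_le_sum fun c _ => Finset.sum_le_sum_of_subset (Finset.subset_univ _)).trans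
      (Finset.sum_le_sum_of_subset (Finset.subset_univ _))).trans
      (Finset.sum_le_sum_of_subset (Finset.subset_univ _))).trans
      (Finset.sum_le_sum_of_subset (Finset.subset_univ _))).trans
      (Finset.sum_le_sum_of_subset (Finset.subset_univ _))
  refine h1.trans ?_
  let φ : V × V × V × V × V × V → V × V × V := fun τ => (τ.2.2.1, τ.2.2.2.2.2, τ.2.2.2.2.1)
  refine (Finset.card_le_mul_card_image_of_maps_to (f := φ) (t := Finset.univ)
    (fun _ _ => Finset.mem_univ _) M ?_).trans_eq ?_
  · rintro ⟨a, b, c⟩ -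
    by_cases habc : a ≠ b ∧ a ≠ c ∧ b ≠ c
    · refine le_trans (Finset.card_le_card_of_injOn (fun τ => (τ.2.1, τ.1, τ.2.2.2.1)) ?_ ?_)
        (hM a b c habc.1 habc.2.1 habc.2.2)
      · rintro ⟨y, x, a', z, c', b'⟩ h
        simp only [A, P, φ, Finset.coe_filter, Finset.mem_filter, Finset.mem_univ, true_and,
          Set.mem_ofPred_eq, Prod.mk.injEq] at h
        obtain ⟨⟨h, -⟩, rfl, rfl, rfl⟩ := h
        exact h
      · rintro ⟨y, x, a', z, c', b'⟩ h ⟨y₁, x₁, a₁, z₁, c₁, b₁⟩ h₁ heq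
        simp only [φ, Finset.coe_filter, Set.mem_ofPred_eq, Prod.mk.injEq] at h h₁ heq
        obtain ⟨-, rfl, rfl, rfl⟩ := h
        obtain ⟨-, rfl, rfl, rfl⟩ := h₁
        obtain ⟨rfl, rfl, rfl⟩ := heq
        rfl
    · rw [Finset.filter_eq_empty_iff.2, Finset.card_empty]
      · exact Nat.zero_le _
      rintro ⟨y, x, a', z, c', b'⟩ h heq
      simp only [A, P, φ, Finset.mem_filter, Finset.mem_univ, true_and, Prod.mk.injEq] at h heq
      obtain ⟨rfl, rfl, rfl⟩ := heq
      exact habc h.2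
  · simp only [Finset.card_univ, Fintype.card_prod]
    ring

end Comb

theorem combPower_upper_bound (p : ℕ) : ∃ c : ℝ, 0 < c ∧ ∀ n : ℕ,
    (exNum n (combPower p) : ℝ) ≤ c * (n : ℝ) ^ (2 - ((3 : ℕ) : ℝ) / ((5 : ℕ) : ℝ)) := by
  refine exists_upper_bound_of_degree (combPower p) (by norm_num) (by norm_num) fun K => ?_
  let t := 3 * p + 4
  let M := (3 * p + 3) * (3 * (t * t))
  refine ⟨256 * K ^ 9 * (p + 3) + 16 * K ^ 4 + 2 * M + t + 1, ?_⟩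
  intro V _ _ _ G _ d hd hdeg
  by_contra hH
  set n := Fintype.card V with hn
  have hn1 : 1 ≤ n := Fintype.card_pos
  set C := 256 * K ^ 9 * (p + 3) + 16 * K ^ 4 + 2 * M + t + 1 with hC
  have hCd : C ≤ d := by
    refine le_of_not_gt fun hlt => ?_
    have h1 := Nat.pow_lt_pow_left hlt (by norm_num : 5 ≠ 0)
    have h2 : 1 ≤ n ^ (5 - 3) := Nat.one_le_pow _ _ hn1
    nlinarith [Nat.mul_le_mul_left (C ^ 5) h2]
  have hheavy : ∀ w, 16 * K ^ 3 * heavyCount G t w ≤ d ^ 2 := by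
    intro w
    have h1 := heavyCount_sq_le (by omega : 3 * p + 3 < t) hH w
    have h2 := Nat.pow_le_pow_left (hdeg w).2 3
    refine le_of_not_gt fun hlt => ?_
    have h3 := Nat.pow_lt_pow_left hlt (by norm_num : 2 ≠ 0)
    have h4 : 256 * K ^ 9 * (p + 3) ≤ d := by omega
    have h5 : (16 * K ^ 3 * heavyCount G t w) ^ 2 ≤ (d ^ 2) ^ 2 := by
      calc (16 * K ^ 3 * heavyCount G t w) ^ 2 = 256 * K ^ 6 * heavyCount G t w ^ 2 := by ring
        _ ≤ 256 * K ^ 6 * ((p + 3) * (K * d) ^ 3) :=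
            Nat.mul_le_mul_left _ (h1.trans (Nat.mul_le_mul_left _ h2))
        _ = 256 * K ^ 9 * (p + 3) * d ^ 3 := by ring
        _ ≤ d * d ^ 3 := Nat.mul_le_mul_right _ h4
        _ = (d ^ 2) ^ 2 := by ring
    omega
  have hlight := combSum_light_le (G := G) (t := t) (M := M) fun a b c hab hac hbc =>
    le_of_not_gt fun hlt => hH (contains_combPower_of_lightComb hab hac hbc hlt)
  have hdefect := combSum_defect_le (G := G) (t := t) fun v => (hdeg v).2
  have hone := le_combSum_one (G := G) fun v => (hdeg v).1
  have hsplit : (combSum G fun _ _ _ _ _ _ => 1) ≤ combSum G (fun y x a z c b =>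
      (if (x, y, z) ∈ lightComb G t a b c ∧ a ≠ b ∧ a ≠ c ∧ b ≠ c then 1 else 0) +
      ((if Heavy G t a y then 1 else 0) +
      ((if Heavy G t y c then 1 else 0) + ((if Heavy G t x b then 1 else 0) +
      ((if Heavy G t z b then 1 else 0) + ((if a = c then 1 else 0) + ((if a = b then 1 else 0) +
      ((if c = b then 1 else 0) + (if x = z then 1 else 0))))))))) := by
    refine Finset.sum_le_sum fun y _ => Finset.sum_le_sum fun x hx => Finset.sum_le_sum fun a ha =>
      Finset.sum_le_sum fun z hz => Finset.sum_le_sum fun c hc => Finset.sum_le_sum fun b hb => ?_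
    beta_reduce
    rw [mem_neighborFinset] at hx ha hz hc hb
    by_cases h : (x, y, z) ∈ lightComb G t a b c ∧ a ≠ b ∧ a ≠ c ∧ b ≠ c
    · rw [if_pos h]; exact Nat.le_add_right _ _
    · refine le_of_not_gt fun hlt => h ?_
      rw [if_neg h] at hlt
      have h1 : ¬ Heavy G t a y := fun h' => by rw [if_pos h'] at hlt; omega
      have h2 : ¬ Heavy G t y c := fun h' => by rw [if_pos h'] at hlt; omega
      have h3 : ¬ Heavy G t x b := fun h' => by rw [if_pos h'] at hlt; omega
      have h4 : ¬ Heavy G t z b := fun h' => by rw [if_pos h'] at hlt; omega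
      have h5 : ¬ a = c := fun h' => by rw [if_pos h'] at hlt; omega
      have h6 : ¬ a = b := fun h' => by rw [if_pos h'] at hlt; omega
      have h7 : ¬ c = b := fun h' => by rw [if_pos h'] at hlt; omega
      have h8 : ¬ x = z := fun h' => by rw [if_pos h'] at hlt; omega
      simp only [lightComb, Finset.mem_filter, Finset.mem_univ, true_and, mem_lightNbr]
      exact ⟨⟨⟨h1, ha.symm, hx⟩, ⟨h2, hz, hc.symm⟩, ⟨h3, hx.symm, hb.symm⟩,
        ⟨h4, hz.symm, hb.symm⟩, h8⟩, h6, h5, Ne.symm h7⟩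
  rw [combSum_add] at hsplit
  have hsum : 16 * K ^ 3 * ∑ w, heavyCount G t w ≤ n * d ^ 2 := by
    rw [Finset.mul_sum]
    exact sum_le_mul_of_card_le le_rfl fun w _ => hheavy w
  have hA : 16 * ((K * d) ^ 3 * ∑ w, heavyCount G t w) ≤ n * d ^ 5 := by
    calc _ = d ^ 3 * (16 * K ^ 3 * ∑ w, heavyCount G t w) := by ring
      _ ≤ d ^ 3 * (n * d ^ 2) := Nat.mul_le_mul_left _ hsum
      _ = n * d ^ 5 := by ring
  have hB : 16 * (n * (K * d) ^ 4) ≤ n * d ^ 5 := by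
    calc _ = 16 * K ^ 4 * (n * d ^ 4) := by ring
      _ ≤ d * (n * d ^ 4) := Nat.mul_le_mul_right _ (by omega)
      _ = n * d ^ 5 := by ring
  have hD : 2 * M * n ^ 3 < n * d ^ 5 := by
    have h1 : 2 * M < C ^ 5 := lt_of_lt_of_le (by omega) (Nat.le_self_pow (by norm_num) C)
    calc 2 * M * n ^ 3 < C ^ 5 * n ^ 3 := Nat.mul_lt_mul_of_pos_right h1 (by positivity)
      _ = n * (C ^ 5 * n ^ (5 - 3)) := by ring
      _ ≤ n * d ^ 5 := Nat.mul_le_mul_left _ hd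
  linarith

/-- The embeddings `Fin s ↪ V` with values in `S`. -/
noncomputable def embeddingsIn {V : Type*} [Fintype V] [DecidableEq V] (s : ℕ) (S : Finset V) :
    Finset (Fin s ↪ V) :=
  Finset.univ.filter fun A => ∀ i, A i ∈ S

lemma mem_embeddingsIn {V : Type*} [Fintype V] [DecidableEq V] {s : ℕ} {S : Finset V}
    {A : Fin s ↪ V} : A ∈ embeddingsIn s S ↔ ∀ i, A i ∈ S := by
  simp [embeddingsIn]

lemma card_embeddingsIn {V : Type*} [Fintype V] [DecidableEq V] (s : ℕ) (S : Finset V) :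
    (embeddingsIn s S).card = S.card.descFactorial s := by
  have h : (embeddingsIn s S).card = Fintype.card (Fin s ↪ S) := by
    rw [← Finset.card_univ]
    symm
    refine Finset.card_bij (fun A _ => A.trans (Function.Embedding.subtype _)) ?_ ?_ ?_
    · intro A _
      exact mem_embeddingsIn.2 fun i => (A i).2
    · intro A _ B _ h
      ext i
      exact DFunLike.congr_fun h i
    · intro A hA
      rw [mem_embeddingsIn] at hA
      exact ⟨⟨fun i => ⟨A i, hA i⟩, fun i j h => A.injective (congrArg Subtype.val h)⟩,
        Finset.mem_univ _, rfl⟩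
  rw [h, Fintype.card_embedding_eq, Fintype.card_fin, Fintype.card_coe]

section DoubleStar

variable {V : Type*} {G : SimpleGraph V}

lemma contains_doubleStar {s p : ℕ} (A B : Fin s → V) (u v : Fin p → V)
    (hA : Function.Injective A) (hB : Function.Injective B) (hu : Function.Injective u)
    (hv : Function.Injective v) (hAB : ∀ i j, A i ≠ B j) (hAv : ∀ i j, A i ≠ v j)
    (hBu : ∀ i j, B i ≠ u j) (huv : ∀ i j, u i ≠ v j) (h1 : ∀ i j, G.Adj (A i) (u j))
    (h2 : ∀ i j, G.Adj (B i) (v j)) (h3 : ∀ j, G.Adj (u j) (v j)) :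
    G.Contains (doubleStar s p) := by
  refine ⟨⟨fun x => x.2.elim (fun i => if x.1 then B i else A i)
    (fun j => if x.1 then v j else u j), ?_⟩, ?_⟩
  · rintro ⟨c, x | x⟩ ⟨c', y | y⟩ h
    · exact h.elim
    · obtain rfl : c = c' := h
      cases c
      · exact h1 x y
      · exact h2 x y
    · obtain rfl : c = c' := h
      cases c
      · exact (h1 y x).symm
      · exact (h2 y x).symm
    · obtain ⟨hc, rfl⟩ : c ≠ c' ∧ x = y := h
      cases c <;> cases c'
      · exact absurd rfl hc
      · exact h3 x
      · exact (h3 x).symm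
      · exact absurd rfl hc
  · have hAu : ∀ i j, A i ≠ u j := fun i j => (h1 i j).ne
    have hBv : ∀ i j, B i ≠ v j := fun i j => (h2 i j).ne
    rintro ⟨c, x | x⟩ ⟨c', y | y⟩ h <;> cases c <;> cases c' <;>
      simp [hA.eq_iff, hB.eq_iff, hu.eq_iff, hv.eq_iff, hAB, hAv, hBu, huv, hAu, hBv,
        fun i j => (hAB i j).symm, fun i j => (hAv i j).symm, fun i j => (hBu i j).symm,
        fun i j => (huv i j).symm, fun i j => (hAu i j).symm, fun i j => (hBv i j).symm] at h ⊢ <;>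
      exact h

variable [Fintype V] [DecidableRel G.Adj] {s : ℕ}

variable (G) in
/-- The common neighbours of a tuple of vertices. -/
def tupleNbr (B : Fin s ↪ V) : Finset V := Finset.univ.filter fun v => ∀ i, G.Adj v (B i)

lemma mem_tupleNbr {B : Fin s ↪ V} {v : V} : v ∈ tupleNbr G B ↔ ∀ i, G.Adj v (B i) := by
  simp [tupleNbr]

variable [DecidableEq V]

variable (G) in
/-- The number of common neighbours of a vertex and a tuple of vertices. -/
def tupleCodeg (u : V) (B : Fin s ↪ V) : ℕ := (G.neighborFinset u ∩ tupleNbr G B).card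

/-- Many vertices adjacent to `A` and having many common neighbours with `B` give a double star. -/
lemma contains_doubleStar_of_tupleCodeg {p t : ℕ} (ht : 2 * p + 2 * s < t) (A B : Fin s ↪ V)
    (hB : B ∈ embeddingsIn s (tupleNbr G A))
    (h : p + s ≤ ((tupleNbr G A).filter fun u => t ≤ tupleCodeg G u B).card) :
    G.Contains (doubleStar s p) := by
  simp only [mem_embeddingsIn, mem_tupleNbr] at hB
  have hcard : p ≤ (((tupleNbr G A).filter fun u => t ≤ tupleCodeg G u B) \
      Finset.univ.image B).card := by
    have h1 := Finset.le_card_sdiff (Finset.univ.image B)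
      ((tupleNbr G A).filter fun u => t ≤ tupleCodeg G u B)
    have h2 : (Finset.univ.image B).card ≤ s := Finset.card_image_le.trans (by simp)
    omega
  obtain ⟨u, hu, huZ⟩ := exists_fin_embedding _ hcard
  simp only [Finset.mem_sdiff, Finset.mem_filter, mem_tupleNbr, Finset.mem_image, Finset.mem_univ,
    true_and, not_exists] at huZ
  let F : Finset V := Finset.univ.image A ∪ Finset.univ.image u
  have hF : F.card ≤ s + p := by
    refine (Finset.card_union_le _ _).trans (Nat.add_le_add ?_ ?_) <;>
      exact Finset.card_image_le.trans (by simp)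
  obtain ⟨v, hvA, hvF, hvd⟩ := exists_disjoint_supports (ι := Fin p) (k := 1) (D := 1)
    (fun j => G.neighborFinset (u j) ∩ tupleNbr G B) (fun v => {v}) F (by simp)
    (fun i v => by
      refine (Finset.card_le_card (t := {v}) fun x hx => ?_).trans (by simp)
      simpa [eq_comm] using (Finset.mem_filter.1 hx).2)
    (fun j => by
      have h1 : t ≤ (G.neighborFinset (u j) ∩ tupleNbr G B).card := (huZ j).1.2
      rw [Fintype.card_fin]
      omega)
  simp only [Finset.mem_inter, mem_neighborFinset, mem_tupleNbr] at hvA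
  simp only [Finset.disjoint_singleton_left, F, Finset.mem_union, Finset.mem_image,
    Finset.mem_univ, true_and, not_or, not_exists] at hvF
  refine contains_doubleStar A B u v A.injective B.injective hu ?_ ?_ ?_ ?_ ?_ ?_ ?_ ?_
  · intro i j hij
    by_contra hne
    exact Finset.disjoint_singleton.1 (hvd hne) hij
  · exact fun i j => (hB j i).symm.ne
  · exact fun i j => (hvF j).1 i
  · exact fun i j => (huZ j).2 i
  · exact fun i j => (hvF j).2 i
  · exact fun i j => ((huZ j).1.1 i).symm
  · exact fun i j => ((hvA j).2 i).symm
  · exact fun j => (hvA j).1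

variable (G) in
/-- The edges joining a common neighbour of `A` to a common neighbour of `B` such that both ends
have few common neighbours with the opposite tuple. -/
def lightEdges (t : ℕ) (A B : Fin s ↪ V) : Finset (V × V) :=
  Finset.univ.filter fun e => G.Adj e.1 e.2 ∧ e.1 ∈ tupleNbr G A ∧ e.2 ∈ tupleNbr G B ∧
    tupleCodeg G e.1 B < t ∧ tupleCodeg G e.2 A < t

lemma card_lightEdges_filter_le (t : ℕ) (A B : Fin s ↪ V) (w : V) :
    ((lightEdges G t A B).filter fun e => w ∈ ({e.1, e.2} : Finset V)).card ≤ 2 * t := by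
  have hsub : ((lightEdges G t A B).filter fun e => w ∈ ({e.1, e.2} : Finset V)) ⊆
      (if tupleCodeg G w B < t then (G.neighborFinset w ∩ tupleNbr G B).image (Prod.mk w) else ∅) ∪
      (if tupleCodeg G w A < t then (G.neighborFinset w ∩ tupleNbr G A).image (fun u => (u, w))
        else ∅) := by
    rintro ⟨u, v⟩ h
    simp only [lightEdges, Finset.mem_filter, Finset.mem_univ, true_and, Finset.mem_insert,
      Finset.mem_singleton] at h
    obtain ⟨⟨h1, h2, h3, h4, h5⟩, rfl | rfl⟩ := h
    · refine Finset.mem_union_left _ ?_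
      rw [if_pos h4]
      exact Finset.mem_image.2 ⟨v, by simp [h1, h3], rfl⟩
    · refine Finset.mem_union_right _ ?_
      rw [if_pos h5]
      exact Finset.mem_image.2 ⟨u, by simp [h1.symm, h2], rfl⟩
  have hcard : ∀ (C : Fin s ↪ V) (f : V → V × V), (if tupleCodeg G w C < t then
      (G.neighborFinset w ∩ tupleNbr G C).image f else ∅).card ≤ t := by
    intro C f
    split_ifs with h
    · exact Finset.card_image_le.trans h.le
    · simp
  refine (Finset.card_le_card hsub).trans ((Finset.card_union_le _ _).trans ?_)
  have h1 := hcard B (Prod.mk w)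
  have h2 := hcard A (fun u => (u, w))
  omega

lemma contains_doubleStar_of_lightEdges {p t : ℕ} (A B : Fin s ↪ V) (hAB : ∀ i j, A i ≠ B j)
    (h : (2 * p + 2 * s) * (2 * t) < (lightEdges G t A B).card) :
    G.Contains (doubleStar s p) := by
  let F : Finset V := Finset.univ.image A ∪ Finset.univ.image B
  have hF : F.card ≤ s + s := by
    refine (Finset.card_union_le _ _).trans (Nat.add_le_add ?_ ?_) <;>
      exact Finset.card_image_le.trans (by simp)
  obtain ⟨f, hfA, hfF, hfd⟩ := exists_disjoint_supports (ι := Fin p) (k := 2)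
    (fun _ => lightEdges G t A B) (fun e => {e.1, e.2}) F (fun _ _ _ => Finset.card_le_two)
    (fun _ w => card_lightEdges_filter_le t A B w)
    (fun _ => by
      refine lt_of_le_of_lt (Nat.mul_le_mul_right _ ?_) h
      rw [Fintype.card_fin]
      omega)
  simp only [lightEdges, Finset.mem_filter, Finset.mem_univ, true_and, mem_tupleNbr] at hfA
  simp only [Finset.disjoint_insert_left, Finset.disjoint_singleton_left, F, Finset.mem_union,
    Finset.mem_image, Finset.mem_univ, true_and, not_or, not_exists] at hfF
  have hdis : ∀ i j, i ≠ j → ∀ x ∈ ({(f i).1, (f i).2} : Finset V),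
      x ∉ ({(f j).1, (f j).2} : Finset V) := fun i j hij x hx =>
    Finset.disjoint_left.1 (hfd hij) hx
  refine contains_doubleStar A B (fun j => (f j).1) (fun j => (f j).2) A.injective B.injective
    ?_ ?_ hAB ?_ ?_ ?_ ?_ ?_ ?_
  · intro i j hij
    by_contra hne
    exact hdis i j hne (f i).1 (by simp) (by simp only [hij]; simp)
  · intro i j hij
    by_contra hne
    exact hdis i j hne (f i).2 (by simp) (by simp only [hij]; simp)
  · exact fun i j => (hfF j).2.1 i
  · exact fun i j => (hfF j).1.2 i
  · intro i j hij
    by_cases hne : i = j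
    · subst hne
      exact (hfA i).1.ne hij
    · exact hdis i j hne (f i).1 (by simp) (by simp only [hij]; simp)
  · exact fun i j => ((hfA j).2.1 i).symm
  · exact fun i j => ((hfA j).2.2.1 i).symm
  · exact fun j => (hfA j).1

end DoubleStar

section DoubleStar

variable {V : Type*} [Fintype V] [DecidableEq V] {G : SimpleGraph V} [DecidableRel G.Adj] {s : ℕ}

lemma sum_tupleNbr_eq (w : V → (Fin s ↪ V) → ℕ) :
    ∑ A : Fin s ↪ V, ∑ B ∈ embeddingsIn s (tupleNbr G A), ∑ u ∈ tupleNbr G A, w u B =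
      ∑ u, ∑ B, w u B * (tupleCodeg G u B).descFactorial s := by
  have h1 : ∀ u (B : Fin s ↪ V), w u B * (tupleCodeg G u B).descFactorial s =
      ∑ A : Fin s ↪ V, if (∀ i j, G.Adj (B i) (A j)) ∧ ∀ i, G.Adj u (A i) then w u B else 0 := by
    intro u B
    rw [tupleCodeg, ← card_embeddingsIn, embeddingsIn, Finset.card_filter, Finset.mul_sum]
    refine Finset.sum_congr rfl fun A _ => ?_
    have h : (∀ i, A i ∈ G.neighborFinset u ∩ tupleNbr G B) ↔
        (∀ i j, G.Adj (B i) (A j)) ∧ ∀ i, G.Adj u (A i) := by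
      simp only [Finset.mem_inter, mem_neighborFinset, mem_tupleNbr]
      exact ⟨fun h => ⟨fun i j => ((h j).2 i).symm, fun i => (h i).1⟩,
        fun h i => ⟨h.2 i, fun j => (h.1 j i).symm⟩⟩
    simp only [h, mul_ite, mul_one, mul_zero]
  have h2 : ∀ A : Fin s ↪ V, ∑ B ∈ embeddingsIn s (tupleNbr G A), ∑ u ∈ tupleNbr G A, w u B =
      ∑ B : Fin s ↪ V, ∑ u, if (∀ i j, G.Adj (B i) (A j)) ∧ ∀ i, G.Adj u (A i) then w u B
        else 0 := by
    intro A
    rw [embeddingsIn, Finset.sum_filter]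
    refine Finset.sum_congr rfl fun B _ => ?_
    simp only [mem_tupleNbr, ite_and]
    split_ifs with h
    · rw [tupleNbr, Finset.sum_filter]
    · simp
  simp only [h1, h2]
  rw [Finset.sum_comm]
  simp only [Finset.sum_comm (s := (Finset.univ : Finset V))]

lemma sum_neighborFinset_embeddingsIn (u : V) (f : (Fin s ↪ V) → ℕ) :
    ∑ v ∈ G.neighborFinset u, ∑ B ∈ embeddingsIn s (G.neighborFinset v), f B =
      ∑ B, f B * tupleCodeg G u B := by
  have h : ∀ B : Fin s ↪ V, f B * tupleCodeg G u B =
      ∑ v ∈ G.neighborFinset u, if v ∈ tupleNbr G B then f B else 0 := by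
    intro B
    rw [← Finset.sum_filter, Finset.sum_const, smul_eq_mul, mul_comm, Finset.filter_mem_eq_inter,
      tupleCodeg]
  simp only [h]
  rw [Finset.sum_comm]
  refine Finset.sum_congr rfl fun v _ => ?_
  rw [embeddingsIn, Finset.sum_filter]
  simp [mem_tupleNbr]

lemma card_embeddingsIn_neighborFinset_le {Δ : ℕ} (hΔ : ∀ v, G.degree v ≤ Δ) (v : V) :
    (embeddingsIn s (G.neighborFinset v)).card ≤ Δ ^ s := by
  rw [card_embeddingsIn, G.card_neighborFinset_eq_degree]
  exact (Nat.descFactorial_le_pow _ _).trans (Nat.pow_le_pow_left (hΔ v) s)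

lemma descFactorial_le_pow_mul {h t s : ℕ} (hs : 0 < s) (ht : h ≤ t) :
    h.descFactorial s ≤ t ^ (s - 1) * h := by
  obtain ⟨k, rfl⟩ := Nat.exists_eq_add_of_lt hs
  calc h.descFactorial (0 + k + 1) ≤ h ^ (k + 1) := by
        simpa using Nat.descFactorial_le_pow h (k + 1)
    _ ≤ t ^ (0 + k + 1 - 1) * h := by
        rw [pow_succ]
        simpa using Nat.mul_le_mul_right h (Nat.pow_le_pow_left ht k)

lemma pow_mul_le_descFactorial {h t s : ℕ} (hs : 0 < s) (ht : t + s ≤ h) :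
    t ^ (s - 1) * h ≤ h.descFactorial s := by
  obtain ⟨k, rfl⟩ : ∃ k, s = k + 1 := ⟨s - 1, by omega⟩
  obtain ⟨l, rfl⟩ : ∃ l, h = l + 1 := ⟨h - 1, by omega⟩
  rw [Nat.succ_descFactorial_succ, mul_comm, Nat.add_sub_cancel]
  exact Nat.mul_le_mul_left _ ((Nat.pow_le_pow_left (by omega) k).trans
    (Nat.pow_sub_le_descFactorial l k))

/-- A moment inequality for the tuples having many common neighbours with some vertex. -/
lemma mul_sum_heavy_le {p t Δ L : ℕ} (hs : 0 < s) (hp : 0 < p + s) (ht : 2 * p + 2 * s < t)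
    (hΔ : ∀ v, G.degree v ≤ Δ) (hH : ¬ G.Contains (doubleStar s p)) :
    L * ∑ u, ∑ B : Fin s ↪ V, (if t ≤ tupleCodeg G u B then 1 else 0) *
        (tupleCodeg G u B).descFactorial s ≤
      ((p + s) * (L + 1)) ^ (s + 1) * Fintype.card V ^ s +
        t ^ (s - 1) * (Fintype.card V * Δ ^ (s + 1)) := by
  set Y := ∑ u, ∑ B : Fin s ↪ V, (if t ≤ tupleCodeg G u B then 1 else 0) *
    (tupleCodeg G u B).descFactorial s with hY
  let M := (p + s) * (L + 1)
  have h1 : Y ≤ ∑ A : Fin s ↪ V, (tupleNbr G A).card.descFactorial s * (p + s) := by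
    rw [hY, ← sum_tupleNbr_eq fun u B => if t ≤ tupleCodeg G u B then 1 else 0]
    refine Finset.sum_le_sum fun A _ => ?_
    refine sum_le_mul_of_card_le (card_embeddingsIn _ _).le fun B hB => ?_
    rw [← Finset.card_filter]
    exact le_of_not_gt fun hlt => hH (contains_doubleStar_of_tupleCodeg ht A B hB hlt.le)
  have h2 : ∑ A : Fin s ↪ V, M * (tupleNbr G A).card.descFactorial s ≤
      M ^ (s + 1) * Fintype.card V ^ s +
        ∑ A : Fin s ↪ V, (tupleNbr G A).card.descFactorial s * (tupleNbr G A).card := by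
    have hpt : ∀ A : Fin s ↪ V, M * (tupleNbr G A).card.descFactorial s ≤
        M ^ (s + 1) + (tupleNbr G A).card.descFactorial s * (tupleNbr G A).card := by
      intro A
      rcases le_total (tupleNbr G A).card M with h | h
      · refine le_trans ?_ (Nat.le_add_right _ _)
        rw [pow_succ, mul_comm]
        exact Nat.mul_le_mul_right _ ((Nat.descFactorial_le_pow _ _).trans
          (Nat.pow_le_pow_left h s))
      · refine le_trans ?_ (Nat.le_add_left _ _)
        rw [mul_comm]
        exact Nat.mul_le_mul_left _ h
    refine (Finset.sum_le_sum fun A _ => hpt A).trans ?_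
    rw [Finset.sum_add_distrib, Finset.sum_const, smul_eq_mul, mul_comm (M ^ (s + 1))]
    refine Nat.add_le_add_right (Nat.mul_le_mul_right _ ?_) _
    rw [Finset.card_univ, Fintype.card_embedding_eq, Fintype.card_fin]
    exact Nat.descFactorial_le_pow _ _
  have h3 : ∑ A : Fin s ↪ V, (tupleNbr G A).card.descFactorial s * (tupleNbr G A).card =
      ∑ u, ∑ B : Fin s ↪ V, (tupleCodeg G u B).descFactorial s := by
    have h := sum_tupleNbr_eq (G := G) (s := s) fun _ _ => 1
    simpa [card_embeddingsIn] using h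
  have h4 : ∑ u, ∑ B : Fin s ↪ V, tupleCodeg G u B ≤ Fintype.card V * Δ ^ (s + 1) := by
    refine sum_le_mul_of_card_le le_rfl fun u _ => ?_
    have h := sum_neighborFinset_embeddingsIn (G := G) (s := s) u fun _ => 1
    simp only [one_mul] at h
    rw [← h, pow_succ, mul_comm]
    refine sum_le_mul_of_card_le ((G.card_neighborFinset_eq_degree u).trans_le (hΔ u))
      fun v _ => ?_
    simpa using card_embeddingsIn_neighborFinset_le hΔ v
  have h5 : ∑ u, ∑ B : Fin s ↪ V, (tupleCodeg G u B).descFactorial s ≤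
      Y + t ^ (s - 1) * (Fintype.card V * Δ ^ (s + 1)) := by
    refine le_trans ?_ (Nat.add_le_add_left (Nat.mul_le_mul_left _ h4) _)
    rw [hY, Finset.mul_sum, ← Finset.sum_add_distrib]
    refine Finset.sum_le_sum fun u _ => ?_
    rw [Finset.mul_sum, ← Finset.sum_add_distrib]
    refine Finset.sum_le_sum fun B _ => ?_
    split_ifs with h
    · rw [one_mul]; exact Nat.le_add_right _ _
    · rw [zero_mul, zero_add]
      exact descFactorial_le_pow_mul hs (not_le.1 h).le
  have h6 : (p + s) * ((L + 1) * Y) ≤ (p + s) * (M ^ (s + 1) * Fintype.card V ^ s +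
      (Y + t ^ (s - 1) * (Fintype.card V * Δ ^ (s + 1)))) := by
    calc (p + s) * ((L + 1) * Y) = M * Y := by ring
      _ ≤ M * ∑ A : Fin s ↪ V, (tupleNbr G A).card.descFactorial s * (p + s) :=
          Nat.mul_le_mul_left _ h1
      _ = (p + s) * ∑ A : Fin s ↪ V, M * (tupleNbr G A).card.descFactorial s := by
          rw [← Finset.sum_mul, ← Finset.mul_sum]; ring
      _ ≤ _ := Nat.mul_le_mul_left _ (h2.trans (Nat.add_le_add_left (h3.le.trans h5) _))
  have h7 := Nat.le_of_mul_le_mul_left h6 hp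
  have h8 : (L + 1) * Y = L * Y + Y := by ring
  have h9 : M = (p + s) * (L + 1) := rfl
  rw [h8, h9] at h7
  omega

lemma pow_le_two_pow_mul_descFactorial {d m s : ℕ} (h : d + 2 * s ≤ 2 * m) :
    d ^ s ≤ 2 ^ s * m.descFactorial s := by
  calc d ^ s ≤ (2 * (m + 1 - s)) ^ s := Nat.pow_le_pow_left (by omega) s
    _ = 2 ^ s * (m + 1 - s) ^ s := mul_pow _ _ _
    _ ≤ _ := Nat.mul_le_mul_left _ (Nat.pow_sub_le_descFactorial m s)

/-- Counting edges `u v` together with disjoint `s`-tuples in the neighbourhoods of `u` and `v`. -/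
lemma card_mul_pow_le {p t d Δ : ℕ} (hd : 4 * s ≤ d) (hdeg : ∀ v, d ≤ G.degree v)
    (hΔ : ∀ v, G.degree v ≤ Δ) (hH : ¬ G.Contains (doubleStar s p)) :
    Fintype.card V * d ^ (2 * s + 1) ≤ 4 ^ s * ((2 * p + 2 * s) * (2 * t) *
      Fintype.card V ^ (2 * s) + 2 * (Δ ^ s * ∑ u, ∑ B : Fin s ↪ V,
      (if t ≤ tupleCodeg G u B then 1 else 0) * tupleCodeg G u B)) := by
  let M := (2 * p + 2 * s) * (2 * t)
  let Z := ∑ u, ∑ B : Fin s ↪ V, (if t ≤ tupleCodeg G u B then 1 else 0) * tupleCodeg G u B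
  let R : V → (Fin s ↪ V) → Finset V := fun v A => G.neighborFinset v \ Finset.univ.image A
  let hv : V → (Fin s ↪ V) → ℕ := fun u B => if t ≤ tupleCodeg G u B then 1 else 0
  let good : V → V → (Fin s ↪ V) → (Fin s ↪ V) → ℕ := fun u v A B =>
    if (∀ i j, A i ≠ B j) ∧ (u, v) ∈ lightEdges G t A B then 1 else 0
  have hRB : ∀ v A, embeddingsIn s (R v A) ⊆ embeddingsIn s (G.neighborFinset v) := by
    intro v A B hB
    rw [mem_embeddingsIn] at hB ⊢
    exact fun i => (Finset.mem_sdiff.1 (hB i)).1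
  have hlow : Fintype.card V * (d * (d ^ s * d ^ s)) ≤ 4 ^ s * ∑ u, ∑ v ∈ G.neighborFinset u,
      ∑ A ∈ embeddingsIn s (G.neighborFinset u), ∑ _B ∈ embeddingsIn s (R v A), 1 := by
    rw [show 4 ^ s = 2 ^ s * 2 ^ s by rw [← mul_pow]; norm_num]
    have h1 : ∀ v A, d ^ s ≤ 2 ^ s * ∑ _B ∈ embeddingsIn s (R v A), 1 := by
      intro v A
      rw [Finset.sum_const, smul_eq_mul, mul_one, card_embeddingsIn]
      refine pow_le_two_pow_mul_descFactorial ?_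
      have h1 := Finset.le_card_sdiff (Finset.univ.image A) (G.neighborFinset v)
      have h2 : (Finset.univ.image A).card ≤ s := Finset.card_image_le.trans (by simp)
      rw [G.card_neighborFinset_eq_degree] at h1
      have h3 := hdeg v
      change d + 2 * s ≤ 2 * (G.neighborFinset v \ Finset.univ.image A).card
      omega
    have h2 : ∀ u, d ^ s ≤ 2 ^ s * (embeddingsIn s (G.neighborFinset u)).card := by
      intro u
      rw [card_embeddingsIn, G.card_neighborFinset_eq_degree]
      refine pow_le_two_pow_mul_descFactorial ?_
      have h3 := hdeg u
      omega
    rw [Finset.mul_sum]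
    refine mul_le_sum_of_le_card le_rfl fun u _ => ?_
    rw [Finset.mul_sum]
    refine mul_le_sum_of_le_card ((hdeg u).trans_eq (G.card_neighborFinset_eq_degree u).symm)
      fun v _ => ?_
    rw [mul_assoc, Finset.mul_sum]
    calc d ^ s * d ^ s ≤ 2 ^ s * (embeddingsIn s (G.neighborFinset u)).card * d ^ s :=
          Nat.mul_le_mul_right _ (h2 u)
      _ = 2 ^ s * ((embeddingsIn s (G.neighborFinset u)).card * d ^ s) := by ring
      _ ≤ _ := Nat.mul_le_mul_left _ (mul_le_sum_of_le_card le_rfl fun A _ => h1 v A)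
  have hsplit : ∑ u, ∑ v ∈ G.neighborFinset u, ∑ A ∈ embeddingsIn s (G.neighborFinset u),
      ∑ _B ∈ embeddingsIn s (R v A), 1 ≤ ∑ u, ∑ v ∈ G.neighborFinset u,
      ∑ A ∈ embeddingsIn s (G.neighborFinset u), ∑ B ∈ embeddingsIn s (R v A),
      (good u v A B + (hv u B + hv v A)) := by
    refine Finset.sum_le_sum fun u _ => Finset.sum_le_sum fun v huv => Finset.sum_le_sum
      fun A hA => Finset.sum_le_sum fun B hB => ?_
    simp only [mem_neighborFinset, mem_embeddingsIn, R, Finset.mem_sdiff, Finset.mem_image,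
      Finset.mem_univ, true_and, not_exists] at huv hA hB
    by_cases h1 : t ≤ tupleCodeg G u B
    · simp only [hv, if_pos h1]; omega
    by_cases h2 : t ≤ tupleCodeg G v A
    · simp only [hv, if_pos h2]; omega
    have h3 : (∀ i j, A i ≠ B j) ∧ (u, v) ∈ lightEdges G t A B := by
      refine ⟨fun i j => (hB j).2 i, ?_⟩
      simp only [lightEdges, Finset.mem_filter, Finset.mem_univ, true_and, mem_tupleNbr]
      exact ⟨huv, hA, fun i => (hB i).1, not_le.1 h1, not_le.1 h2⟩
    simp only [good, if_pos h3]; omega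
  have hgood : ∑ u, ∑ v ∈ G.neighborFinset u, ∑ A ∈ embeddingsIn s (G.neighborFinset u),
      ∑ B ∈ embeddingsIn s (R v A), good u v A B ≤ M * Fintype.card V ^ (2 * s) := by
    have h1 : ∑ u, ∑ v ∈ G.neighborFinset u, ∑ A ∈ embeddingsIn s (G.neighborFinset u),
        ∑ B ∈ embeddingsIn s (R v A), good u v A B ≤ ∑ u, ∑ v, ∑ A, ∑ B, good u v A B := by
      refine Finset.sum_le_sum fun u _ => ?_
      exact (Finset.sum_le_sum fun v _ => (Finset.sum_le_sum fun A _ =>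
        Finset.sum_le_sum_of_subset (Finset.subset_univ _)).trans
        (Finset.sum_le_sum_of_subset (Finset.subset_univ _))).trans
        (Finset.sum_le_sum_of_subset (Finset.subset_univ _))
    have h2 : ∑ u, ∑ v, ∑ A, ∑ B, good u v A B =
        ∑ AB : (Fin s ↪ V) × (Fin s ↪ V), ∑ e : V × V, good e.1 e.2 AB.1 AB.2 := by
      rw [Finset.sum_comm (f := fun (AB : (Fin s ↪ V) × (Fin s ↪ V)) (e : V × V) =>
        good e.1 e.2 AB.1 AB.2)]
      simp only [Fintype.sum_prod_type]
    have h3 : Fintype.card (Fin s ↪ V) ≤ Fintype.card V ^ s := by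
      rw [Fintype.card_embedding_eq, Fintype.card_fin]
      exact Nat.descFactorial_le_pow _ _
    rw [h2] at h1
    refine h1.trans ?_
    rw [mul_comm, two_mul, pow_add]
    refine sum_le_mul_of_card_le ?_ fun AB _ => ?_
    · rw [Finset.card_univ, Fintype.card_prod]
      exact Nat.mul_le_mul h3 h3
    · by_cases hAB : ∀ i j, AB.1 i ≠ AB.2 j
      · have h4 : ∑ e : V × V, good e.1 e.2 AB.1 AB.2 = (lightEdges G t AB.1 AB.2).card := by
          have h5 : ∀ e : V × V, good e.1 e.2 AB.1 AB.2 =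
              if e ∈ lightEdges G t AB.1 AB.2 then 1 else 0 := fun e => by
            simp only [good, and_iff_right hAB]
          simp [h5]
        rw [h4]
        exact le_of_not_gt fun hlt => hH (contains_doubleStar_of_lightEdges _ _ hAB hlt)
      · simp [good, hAB]
  have hZ : ∑ u, ∑ v ∈ G.neighborFinset u, ∑ B ∈ embeddingsIn s (G.neighborFinset v), hv u B = Z :=
    Finset.sum_congr rfl fun u _ => sum_neighborFinset_embeddingsIn u (hv u)
  have hheavyB : ∑ u, ∑ v ∈ G.neighborFinset u, ∑ A ∈ embeddingsIn s (G.neighborFinset u),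
      ∑ B ∈ embeddingsIn s (R v A), hv u B ≤ Δ ^ s * Z := by
    rw [← hZ, Finset.mul_sum]
    refine Finset.sum_le_sum fun u _ => ?_
    rw [Finset.mul_sum]
    exact Finset.sum_le_sum fun v _ => sum_le_mul_of_card_le
      (card_embeddingsIn_neighborFinset_le hΔ u) fun A _ => Finset.sum_le_sum_of_subset (hRB v A)
  have hheavyA : ∑ u, ∑ v ∈ G.neighborFinset u, ∑ A ∈ embeddingsIn s (G.neighborFinset u),
      ∑ _B ∈ embeddingsIn s (R v A), hv v A ≤ Δ ^ s * Z := by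
    rw [← hZ, ← sum_neighborFinset_comm G fun u v =>
      ∑ B ∈ embeddingsIn s (G.neighborFinset u), hv v B, Finset.mul_sum]
    refine Finset.sum_le_sum fun u _ => ?_
    rw [Finset.mul_sum]
    refine Finset.sum_le_sum fun v _ => ?_
    rw [Finset.mul_sum]
    exact Finset.sum_le_sum fun A _ => sum_le_mul_of_card_le ((Finset.card_le_card (hRB v A)).trans
      (card_embeddingsIn_neighborFinset_le hΔ v)) fun B _ => le_rfl
  simp only [Finset.sum_add_distrib] at hsplit
  calc Fintype.card V * d ^ (2 * s + 1) = Fintype.card V * (d * (d ^ s * d ^ s)) := by ring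
    _ ≤ _ := hlow
    _ ≤ 4 ^ s * (M * Fintype.card V ^ (2 * s) + 2 * (Δ ^ s * Z)) :=
        Nat.mul_le_mul_left _ (by omega)

end DoubleStar

lemma pow_mul_lt_mul_pow {n d C Q s : ℕ} (hs : 0 < s) (hn : 1 ≤ n) (hQC : Q < C)
    (hd : C ^ (2 * s + 1) * n ^ (2 * s + 1 - 2) ≤ d ^ (2 * s + 1)) :
    Q ^ (s + 1) * n ^ s < n * d ^ (s + 1) := by
  by_contra! hle
  have h1 := Nat.pow_le_pow_left hle (2 * s + 1)
  have h2 := Nat.pow_le_pow_left hd (s + 1)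
  obtain ⟨k, rfl⟩ : ∃ k, s = k + 1 := ⟨s - 1, by omega⟩
  rw [show 2 * (k + 1) + 1 - 2 = 2 * k + 1 by omega, mul_pow, ← pow_mul, ← pow_mul, ← pow_mul] at h2
  rw [mul_pow, mul_pow, ← pow_mul, ← pow_mul, ← pow_mul, mul_comm (k + 1 + 1)] at h1
  generalize hN : (2 * (k + 1) + 1) * (k + 1 + 1) = N at h1 h2
  have hN0 : N ≠ 0 := by rw [← hN]; positivity
  have hexp : (k + 1) * (2 * (k + 1) + 1) ≤ (2 * k + 1) * (k + 1 + 1) + (2 * (k + 1) + 1) := by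
    nlinarith
  have h3 : C ^ N * n ^ ((2 * k + 1) * (k + 1 + 1) + (2 * (k + 1) + 1)) ≤
      Q ^ N * n ^ ((2 * k + 1) * (k + 1 + 1) + (2 * (k + 1) + 1)) := by
    calc _ = n ^ (2 * (k + 1) + 1) * (C ^ N * n ^ ((2 * k + 1) * (k + 1 + 1))) := by
          rw [pow_add]; ring
      _ ≤ n ^ (2 * (k + 1) + 1) * d ^ N := Nat.mul_le_mul_left _ h2
      _ ≤ Q ^ N * n ^ ((k + 1) * (2 * (k + 1) + 1)) := h1
      _ ≤ _ := Nat.mul_le_mul_left _ (Nat.pow_le_pow_right hn hexp)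
  exact absurd (Nat.le_of_mul_le_mul_right h3 (Nat.pow_pos hn))
    (not_le.2 (Nat.pow_lt_pow_left hQC hN0))

theorem doubleStar_upper_bound {s : ℕ} (hs : 0 < s) (p : ℕ) : ∃ c : ℝ, 0 < c ∧ ∀ n : ℕ,
    (exNum n (doubleStar s p) : ℝ) ≤
      c * (n : ℝ) ^ (2 - ((2 : ℕ) : ℝ) / ((2 * s + 1 : ℕ) : ℝ)) := by
  refine exists_upper_bound_of_degree (doubleStar s p) (by norm_num) (by omega) fun K => ?_
  let τ := 2 * p + 2 * s + 1
  let t := τ + s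
  let M := (2 * p + 2 * s) * (2 * t)
  let D := 4 ^ (s + 1) * K ^ s
  let L := D * (2 ^ s * K ^ (s + 1))
  let Q := (p + s) * (L + 1)
  refine ⟨2 * 4 ^ s * M + Q + 4 * s + 1, ?_⟩
  intro V _ _ _ G _ d hd hdeg
  by_contra hH
  set n := Fintype.card V with hn
  have hn1 : 1 ≤ n := Fintype.card_pos
  set C := 2 * 4 ^ s * M + Q + 4 * s + 1 with hC
  have hCd : C ≤ d := by
    refine le_of_not_gt fun hlt => ?_
    have h1 := Nat.pow_lt_pow_left hlt (by omega : 2 * s + 1 ≠ 0)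
    have h2 : 1 ≤ n ^ (2 * s + 1 - 2) := Nat.one_le_pow _ _ hn1
    nlinarith [Nat.mul_le_mul_left (C ^ (2 * s + 1)) h2]
  have hd0 : 0 < d := by omega
  have hquad := card_mul_pow_le (t := t) (by omega : 4 * s ≤ d) (fun v => (hdeg v).1)
    (fun v => (hdeg v).2) hH
  have hmom := mul_sum_heavy_le (t := t) (L := L) hs (by omega) (by omega) (fun v => (hdeg v).2) hH
  set Z := ∑ u, ∑ B : Fin s ↪ V, (if t ≤ tupleCodeg G u B then 1 else 0) * tupleCodeg G u B
    with hZ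
  set Y := ∑ u, ∑ B : Fin s ↪ V, (if t ≤ tupleCodeg G u B then 1 else 0) *
    (tupleCodeg G u B).descFactorial s with hY
  have hYZ : τ ^ (s - 1) * Z ≤ Y := by
    rw [hY, hZ, Finset.mul_sum]
    refine Finset.sum_le_sum fun u _ => ?_
    rw [Finset.mul_sum]
    refine Finset.sum_le_sum fun B _ => ?_
    split_ifs with h
    · rw [one_mul, one_mul]
      exact pow_mul_le_descFactorial hs h
    · simp
  have hZlow : n * d ^ (s + 1) ≤ D * Z := by
    have h1 : 2 * 4 ^ s * M * n ^ (2 * s) ≤ n * d ^ (2 * s + 1) := by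
      have h2 : 2 * 4 ^ s * M ≤ C ^ (2 * s + 1) :=
        le_trans (by omega) (Nat.le_self_pow (by omega) C)
      calc 2 * 4 ^ s * M * n ^ (2 * s) ≤ C ^ (2 * s + 1) * n ^ (2 * s) :=
            Nat.mul_le_mul_right _ h2
        _ = n * (C ^ (2 * s + 1) * n ^ (2 * s + 1 - 2)) := by
            have h3 : n ^ (2 * s) = n ^ (2 * s + 1 - 2) * n := by
              rw [← pow_succ]
              congr 1
              omega
            rw [h3]
            ring
        _ ≤ n * d ^ (2 * s + 1) := Nat.mul_le_mul_left _ hd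
    have h3 : d ^ s * (n * d ^ (s + 1)) ≤ d ^ s * (D * Z) := by
      have h4 : n * d ^ (2 * s + 1) = d ^ s * (n * d ^ (s + 1)) := by ring
      have h5 : 4 ^ s * (M * n ^ (2 * s) + 2 * ((K * d) ^ s * Z)) =
          4 ^ s * M * n ^ (2 * s) + 2 * (4 ^ s * K ^ s * d ^ s * Z) := by ring
      have h6 : d ^ s * (D * Z) = 4 * (4 ^ s * K ^ s * d ^ s * Z) := by
        simp only [D]; ring
      have h7 : 2 * 4 ^ s * M * n ^ (2 * s) = 2 * (4 ^ s * M * n ^ (2 * s)) := by ring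
      have h8 : n * d ^ (2 * s + 1) ≤ 4 ^ s * (M * n ^ (2 * s) + 2 * ((K * d) ^ s * Z)) := hquad
      omega
    exact Nat.le_of_mul_le_mul_left h3 (by positivity)
  have hfin : n * d ^ (s + 1) ≤ Q ^ (s + 1) * n ^ s := by
    have hK : 1 ≤ K := by
      obtain ⟨v⟩ := ‹Nonempty V›
      have h1 := (hdeg v).1.trans (hdeg v).2
      refine Nat.one_le_iff_ne_zero.2 fun h => ?_
      rw [h, zero_mul] at h1
      omega
    have h1 : 2 * t ^ (s - 1) ≤ 2 ^ s * τ ^ (s - 1) := by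
      have h2 : t ^ (s - 1) ≤ (2 * τ) ^ (s - 1) := Nat.pow_le_pow_left (by omega) _
      rw [mul_pow] at h2
      have h3 : 2 ^ s = 2 * 2 ^ (s - 1) := by
        rw [← pow_succ']
        congr 1
        omega
      rw [h3, mul_assoc]
      exact Nat.mul_le_mul_left _ h2
    have h2 : 2 * (t ^ (s - 1) * (n * (K * d) ^ (s + 1))) ≤ L * Y := by
      calc 2 * (t ^ (s - 1) * (n * (K * d) ^ (s + 1))) =
            2 * t ^ (s - 1) * (K ^ (s + 1) * (n * d ^ (s + 1))) := by ring
        _ ≤ 2 ^ s * τ ^ (s - 1) * (K ^ (s + 1) * (D * Z)) :=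
            Nat.mul_le_mul h1 (Nat.mul_le_mul_left _ hZlow)
        _ = L * (τ ^ (s - 1) * Z) := by simp only [L]; ring
        _ ≤ L * Y := Nat.mul_le_mul_left _ hYZ
    have h3 : n * d ^ (s + 1) ≤ t ^ (s - 1) * (n * (K * d) ^ (s + 1)) := by
      calc n * d ^ (s + 1) ≤ n * (K * d) ^ (s + 1) :=
            Nat.mul_le_mul_left _ (Nat.pow_le_pow_left (Nat.le_mul_of_pos_left d hK) _)
        _ ≤ _ := Nat.le_mul_of_pos_left _ (Nat.pow_pos (by omega))
    have h4 : L * Y ≤ Q ^ (s + 1) * n ^ s + t ^ (s - 1) * (n * (K * d) ^ (s + 1)) := hmom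
    omega
  exact absurd hfin (not_le.2 (pow_mul_lt_mul_pow hs hn1 (by omega) hd))

/-- For every rational $r = 2 - 2/(2s+1)$ with $s ≥ 2$, and also for $r = 7/5$, there is a
single bipartite graph $H_r$ with $ex(n, H_r) = Θ(n^r)$. -/
theorem turan_exponents (r : ℚ)
    (hr : (∃ s : ℕ, 2 ≤ s ∧ r = 2 - 2 / (2 * s + 1)) ∨ r = 7 / 5) :
    ∃ (β : Type) (_ : Fintype β) (H : SimpleGraph β), H.Colorable 2 ∧
      ∃ c₁ c₂ : ℝ, 0 < c₁ ∧ 0 < c₂ ∧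
        ∀ᶠ n : ℕ in atTop,
          c₁ * (n : ℝ) ^ (r : ℝ) ≤ (exNum n H : ℝ) ∧
          (exNum n H : ℝ) ≤ c₂ * (n : ℝ) ^ (r : ℝ) := by
  rcases hr with ⟨s, hs, rfl⟩ | rfl
  · have hs0 : 0 < s := by omega
    obtain ⟨p, -, c₁, hc₁, h₁⟩ := doubleStar_lower_bound hs0
    obtain ⟨c₂, hc₂, h₂⟩ := doubleStar_upper_bound hs0 p
    refine ⟨_, inferInstance, doubleStar s p, doubleStar_colorable s p, c₁, c₂, hc₁, hc₂, ?_⟩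
    have hr : ((2 - 2 / (2 * s + 1) : ℚ) : ℝ) = 2 - ((2 : ℕ) : ℝ) / ((2 * s + 1 : ℕ) : ℝ) := by
      push_cast
      rfl
    rw [hr]
    exact h₁.mono fun n hn => ⟨hn, h₂ n⟩
  · obtain ⟨p, -, c₁, hc₁, h₁⟩ := combPower_lower_bound
    obtain ⟨c₂, hc₂, h₂⟩ := combPower_upper_bound p
    refine ⟨_, inferInstance, combPower p, combPower_colorable p, c₁, c₂, hc₁, hc₂, ?_⟩
    have hr : ((7 / 5 : ℚ) : ℝ) = 2 - ((3 : ℕ) : ℝ) / ((5 : ℕ) : ℝ) := by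
      norm_num
    rw [hr]
    exact h₁.mono fun n hn => ⟨hn, h₂ n⟩
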